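/- Let 0 < p < ∞, let ω be a radial continuous weight on the unit disc that is either regular or rapidly increasing, and let g be analytic on 𝔻. Then the integral operator T_g(f)(z) = ∫_0^z f(ζ) g'(ζ) dζ is bounded on A^p_ω (i.e. there exists C > 0 with ‖T_g(f)‖_{A^p_ω} ≤ C ‖f‖_{A^p_ω} for all f ∈ A^p_ω) if and only if sup_{I ⊂ 𝕋} ( ∫_{S(I)} |g'(z)|² ω*(z) dA(z) ) / ω(S(I)) < ∞. -/

import Mathlib

open MeasureTheory Set Filter

noncomputable section

/-- `wInt ω r = ∫_r^1 ω(s) ds`. -/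
def wInt (ω : ℝ → ℝ) (r : ℝ) : ℝ := ∫ s in r..1, ω s

/-- A radial weight on the unit disc, identified with a function on `[0,1)`:
positive and integrable. -/
def IsRadialWeight (ω : ℝ → ℝ) : Prop :=
  (∀ r ∈ Set.Ico (0:ℝ) 1, 0 < ω r) ∧ IntegrableOn ω (Set.Ico (0:ℝ) 1)

/-- A radial continuous weight. -/
def IsRadialContinuousWeight (ω : ℝ → ℝ) : Prop :=
  IsRadialWeight ω ∧ ContinuousOn ω (Set.Ico (0:ℝ) 1)

/-- A regular weight: radial continuous with `ψ_ω(r) ≍ 1 - r`, i.e.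
`(1-r)·ω(r) ≍ ∫_r^1 ω(s) ds` on `[0,1)`. -/
def IsRegularWeight (ω : ℝ → ℝ) : Prop :=
  IsRadialContinuousWeight ω ∧ ∃ c C : ℝ, 0 < c ∧ 0 < C ∧
    ∀ r ∈ Set.Ico (0:ℝ) 1,
      c * ((1 - r) * ω r) ≤ wInt ω r ∧ wInt ω r ≤ C * ((1 - r) * ω r)

/-- A rapidly increasing weight: radial continuous with
`ψ_ω(r)/(1-r) = (∫_r^1 ω)/(ω(r)(1-r)) → ∞` as `r → 1⁻`. -/
def IsRapidlyIncreasing (ω : ℝ → ℝ) : Prop :=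
  IsRadialContinuousWeight ω ∧
    Tendsto (fun r => wInt ω r / (ω r * (1 - r))) (nhdsWithin 1 (Set.Iio 1)) atTop

/-- The open unit disc in `ℂ`. -/
def unitDisc : Set ℂ := {z : ℂ | ‖z‖ < 1}

/-- The Carleson square `S(I)` associated with the arc `I ⊂ 𝕋` with midpoint `e^{iθ}` and
arc length `h`. -/
def CBox (θ h : ℝ) : Set ℂ :=
  {z : ℂ | 1 - h ≤ ‖z‖ ∧ ‖z‖ < 1 ∧
    |Complex.arg (z * Complex.exp (-(θ : ℂ) * Complex.I))| ≤ h / 2}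

/-- The associated weight `ω*(z) = ∫_{|z|}^1 ω(s) log (s/|z|) s ds`. -/
def wStar (ω : ℝ → ℝ) (z : ℂ) : ℝ := ∫ s in ‖z‖..1, ω s * Real.log (s / ‖z‖) * s

/-- The integral operator `T_g(f)(z) = ∫_0^z f(ζ) g'(ζ) dζ`, the integral being taken
along the segment from `0` to `z`. -/
def Tg (g f : ℂ → ℂ) (z : ℂ) : ℂ :=
  ∫ t in (0:ℝ)..1, (f ((t : ℂ) * z) * deriv g ((t : ℂ) * z)) * z

section

open scoped ENNReal ComplexConjugate Topology

section

variable {ι : Type*} [Fintype ι]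

lemma unitDisc_eq_ball : unitDisc = Metric.ball (0 : ℂ) 1 := by
  ext z; simp [unitDisc]

lemma isOpen_unitDisc : IsOpen unitDisc := by
  rw [unitDisc_eq_ball]; exact Metric.isOpen_ball

lemma measurableSet_unitDisc : MeasurableSet unitDisc := isOpen_unitDisc.measurableSet

/-- The squared Euclidean norm of a tuple of functions. -/
def vecSq (F : ι → ℂ → ℂ) (z : ℂ) : ℝ := ∑ i, ‖F i z‖ ^ 2

/-- The squared Euclidean norm of the derivative of a tuple of functions. -/
def vecDerivSq (F : ι → ℂ → ℂ) (z : ℂ) : ℝ := ∑ i, ‖deriv (F i) z‖ ^ 2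

/-- The Hermitian product of a tuple of functions with its derivative. -/
def vecDot (F : ι → ℂ → ℂ) (z : ℂ) : ℂ := ∑ i, conj (F i z) * deriv (F i) z

/-- The bilinear pairing of the conjugate of a tuple with its second derivative. -/
def vecDot₂ (F : ι → ℂ → ℂ) (z : ℂ) : ℂ := ∑ i, conj (F i z) * deriv (deriv (F i)) z

/-- The Laplacian of `vecSq F ^ q` for a tuple of analytic functions. -/
def vecLap (q : ℝ) (F : ι → ℂ → ℂ) (z : ℂ) : ℝ :=
  4 * q * (vecSq F z ^ (q - 1) * vecDerivSq F z) +
    4 * q * (q - 1) * (vecSq F z ^ (q - 2) * ‖vecDot F z‖ ^ 2)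

lemma vecSq_nonneg (F : ι → ℂ → ℂ) (z : ℂ) : 0 ≤ vecSq F z :=
  Finset.sum_nonneg fun _ _ => by positivity

lemma vecDerivSq_nonneg (F : ι → ℂ → ℂ) (z : ℂ) : 0 ≤ vecDerivSq F z :=
  Finset.sum_nonneg fun _ _ => by positivity

lemma norm_vecDot_sq_le (F : ι → ℂ → ℂ) (z : ℂ) :
    ‖vecDot F z‖ ^ 2 ≤ vecSq F z * vecDerivSq F z := by
  have h1 : ‖vecDot F z‖ ≤ ∑ i, ‖F i z‖ * ‖deriv (F i) z‖ := by
    refine (norm_sum_le _ _).trans (le_of_eq ?_)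
    simp
  calc ‖vecDot F z‖ ^ 2 ≤ (∑ i, ‖F i z‖ * ‖deriv (F i) z‖) ^ 2 := by gcongr
    _ ≤ _ := Finset.sum_mul_sq_le_sq_mul_sq _ _ _

lemma vecLap_bounds {q : ℝ} (hq : 0 < q) (F : ι → ℂ → ℂ) {z : ℂ} (hv : 0 < vecSq F z) :
    4 * q * min 1 q * (vecSq F z ^ (q - 1) * vecDerivSq F z) ≤ vecLap q F z ∧
      vecLap q F z ≤ 4 * q * max 1 q * (vecSq F z ^ (q - 1) * vecDerivSq F z) := by
  have hA : vecSq F z ^ (q - 2) * ‖vecDot F z‖ ^ 2 ≤ vecSq F z ^ (q - 1) * vecDerivSq F z := by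
    calc _ ≤ vecSq F z ^ (q - 2) * (vecSq F z * vecDerivSq F z) := by
          gcongr; exact norm_vecDot_sq_le F z
      _ = _ := by
          rw [← mul_assoc, ← Real.rpow_add_one hv.ne']; ring_nf
  have hA0 : 0 ≤ vecSq F z ^ (q - 2) * ‖vecDot F z‖ ^ 2 := by positivity
  unfold vecLap
  set X := vecSq F z ^ (q - 2) * ‖vecDot F z‖ ^ 2
  set Y := vecSq F z ^ (q - 1) * vecDerivSq F z
  rcases le_total 1 q with h | h
  · rw [min_eq_left h, max_eq_right h]
    constructor
    · nlinarith [mul_nonneg (mul_nonneg hq.le (sub_nonneg.2 h)) hA0]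
    · nlinarith [mul_nonneg (mul_nonneg hq.le (sub_nonneg.2 h)) (sub_nonneg.2 hA)]
  · rw [min_eq_right h, max_eq_left h]
    constructor
    · nlinarith [mul_nonneg (mul_nonneg hq.le (sub_nonneg.2 h)) (sub_nonneg.2 hA)]
    · nlinarith [mul_nonneg (mul_nonneg hq.le (sub_nonneg.2 h)) hA0]

lemma vecLap_nonneg {q : ℝ} (hq : 0 < q) (F : ι → ℂ → ℂ) {z : ℂ} (hv : 0 < vecSq F z) :
    0 ≤ vecLap q F z := by
  refine le_trans ?_ (vecLap_bounds hq F hv).1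
  have := vecDerivSq_nonneg F z
  have : 0 < min 1 q := lt_min one_pos hq
  positivity

section Path

variable {F : ι → ℂ → ℂ} (hF : ∀ i, DifferentiableOn ℂ (F i) unitDisc)
  {γ : ℝ → ℂ} {γ' : ℂ} {t : ℝ}

include hF

lemma hasDerivAt_vecSq_comp (hγ : HasDerivAt γ γ' t) (ht : γ t ∈ unitDisc) :
    HasDerivAt (fun s => vecSq F (γ s)) (2 * (vecDot F (γ t) * γ').re) t := by
  have h : ∀ i, HasDerivAt (fun s => ‖F i (γ s)‖ ^ 2)
      (2 * (conj (F i (γ t)) * deriv (F i) (γ t) * γ').re) t := by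
    intro i
    have h1 : HasDerivAt (F i) (deriv (F i) (γ t)) (γ t) :=
      ((hF i).differentiableAt (isOpen_unitDisc.mem_nhds ht)).hasDerivAt
    have h2 := (h1.comp t hγ).norm_sq
    refine HasDerivAt.congr_deriv h2 ?_
    rw [real_inner_eq_re_inner ℂ]
    simp only [RCLike.inner_apply, RCLike.re_to_complex]
    congr 2
    simp only [Function.comp]
    ring
  refine (HasDerivAt.fun_sum (u := Finset.univ) fun i _ => h i).congr_deriv ?_
  unfold vecDot
  rw [← Finset.mul_sum, Finset.sum_mul, Complex.re_sum]

lemma hasDerivAt_vecDot_comp (hγ : HasDerivAt γ γ' t) (ht : γ t ∈ unitDisc) :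
    HasDerivAt (fun s => vecDot F (γ s))
      (vecDerivSq F (γ t) * conj γ' + vecDot₂ F (γ t) * γ') t := by
  have h : ∀ i, HasDerivAt (fun s => conj (F i (γ s)) * deriv (F i) (γ s))
      (((‖deriv (F i) (γ t)‖ ^ 2 : ℝ) : ℂ) * conj γ' +
        conj (F i (γ t)) * deriv (deriv (F i)) (γ t) * γ') t := by
    intro i
    have h1 : HasDerivAt (F i) (deriv (F i) (γ t)) (γ t) :=
      ((hF i).differentiableAt (isOpen_unitDisc.mem_nhds ht)).hasDerivAt
    have h1' : HasDerivAt (deriv (F i)) (deriv (deriv (F i)) (γ t)) (γ t) :=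
      (((hF i).deriv isOpen_unitDisc).differentiableAt (isOpen_unitDisc.mem_nhds ht)).hasDerivAt
    have h2 : HasDerivAt (fun s => conj (F i (γ s))) (conj (deriv (F i) (γ t) * γ')) t :=
      (h1.comp t hγ).star
    have h3 := h2.mul (h1'.comp t hγ)
    refine h3.congr_deriv ?_
    simp only [Function.comp, map_mul]
    have : ((‖deriv (F i) (γ t)‖ ^ 2 : ℝ) : ℂ) =
        conj (deriv (F i) (γ t)) * deriv (F i) (γ t) := by
      rw [mul_comm, Complex.mul_conj, Complex.normSq_eq_norm_sq]
    rw [this]; ring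
  refine (HasDerivAt.fun_sum (u := Finset.univ) fun i _ => h i).congr_deriv ?_
  unfold vecDot₂ vecDerivSq
  rw [Finset.sum_add_distrib, Finset.sum_mul, ← Finset.sum_mul]
  push_cast
  rfl

lemma hasDerivAt_vecSq_rpow_comp (q : ℝ) (hγ : HasDerivAt γ γ' t) (ht : γ t ∈ unitDisc)
    (hv : 0 < vecSq F (γ t)) :
    HasDerivAt (fun s => vecSq F (γ s) ^ q)
      (2 * q * vecSq F (γ t) ^ (q - 1) * (vecDot F (γ t) * γ').re) t := by
  have := (hasDerivAt_vecSq_comp hF hγ ht).rpow_const (p := q) (Or.inl hv.ne')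
  convert this using 1
  ring

lemma hasDerivAt_vecGrad_comp (q : ℝ) (hγ : HasDerivAt γ γ' t) (ht : γ t ∈ unitDisc)
    (hv : 0 < vecSq F (γ t)) :
    HasDerivAt (fun s => ((vecSq F (γ s) ^ (q - 1) : ℝ) : ℂ) * vecDot F (γ s))
      (((2 * (q - 1) * vecSq F (γ t) ^ (q - 2) * (vecDot F (γ t) * γ').re : ℝ) : ℂ) *
          vecDot F (γ t) +
        ((vecSq F (γ t) ^ (q - 1) : ℝ) : ℂ) *
          (vecDerivSq F (γ t) * conj γ' + vecDot₂ F (γ t) * γ')) t := by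
  have h1 := (hasDerivAt_vecSq_rpow_comp hF (q - 1) hγ ht hv).ofReal_comp
  have h2 := h1.mul (hasDerivAt_vecDot_comp hF hγ ht)
  have e : q - 1 - 1 = q - 2 := by ring
  rw [e] at h2
  exact h2

end Path

section Continuity

variable {F : ι → ℂ → ℂ} (hF : ∀ i, DifferentiableOn ℂ (F i) unitDisc)
include hF

lemma continuousOn_vecSq : ContinuousOn (vecSq F) unitDisc :=
  continuousOn_finsetSum _ fun i _ => (hF i).continuousOn.norm.pow 2

lemma continuousOn_vecDerivSq : ContinuousOn (vecDerivSq F) unitDisc :=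
  continuousOn_finsetSum _ fun i _ => ((hF i).deriv isOpen_unitDisc).continuousOn.norm.pow 2

lemma continuousOn_vecDot : ContinuousOn (vecDot F) unitDisc :=
  continuousOn_finsetSum _ fun i _ => (Complex.continuous_conj.comp_continuousOn
    (hF i).continuousOn).mul ((hF i).deriv isOpen_unitDisc).continuousOn

lemma continuousOn_vecDot₂ : ContinuousOn (vecDot₂ F) unitDisc :=
  continuousOn_finsetSum _ fun i _ => (Complex.continuous_conj.comp_continuousOn
    (hF i).continuousOn).mul
      (((hF i).deriv isOpen_unitDisc).deriv isOpen_unitDisc).continuousOn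

lemma continuousOn_vecSq_rpow (q : ℝ) (hv : ∀ z ∈ unitDisc, 0 < vecSq F z) :
    ContinuousOn (fun z => vecSq F z ^ q) unitDisc :=
  (continuousOn_vecSq hF).rpow_const fun z hz => Or.inl (hv z hz).ne'

lemma continuousOn_vecLap (q : ℝ) (hv : ∀ z ∈ unitDisc, 0 < vecSq F z) :
    ContinuousOn (vecLap q F) unitDisc := by
  unfold vecLap
  have h1 := continuousOn_vecSq_rpow hF (q - 1) hv
  have h2 := continuousOn_vecSq_rpow hF (q - 2) hv
  have h3 := continuousOn_vecDerivSq hF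
  have h4 := continuousOn_vecDot hF
  fun_prop

end Continuity

/-- The point `r e^{iθ}`. -/
def polarPt (r θ : ℝ) : ℂ := r * Complex.exp (θ * Complex.I)

/-- The integral of `u` over the circle of radius `r`, with respect to the angle. -/
def circ (u : ℂ → ℝ) (r : ℝ) : ℝ := ∫ θ in (-Real.pi)..Real.pi, u (polarPt r θ)

lemma norm_polarPt (r θ : ℝ) : ‖polarPt r θ‖ = |r| := by
  simp [polarPt, Complex.norm_exp_ofReal_mul_I]

lemma polarPt_mem {r θ : ℝ} (hr : r ∈ Ico (0 : ℝ) 1) : polarPt r θ ∈ unitDisc := by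
  simp only [unitDisc, mem_ofPred_eq, norm_polarPt, abs_of_nonneg hr.1, hr.2]

lemma continuous_polarPt : Continuous (Function.uncurry polarPt) := by
  unfold polarPt Function.uncurry; fun_prop

lemma continuousOn_comp_polarPt {E : Type*} [TopologicalSpace E] {u : ℂ → E}
    (hu : ContinuousOn u unitDisc) :
    ContinuousOn (fun x : ℝ × ℝ => u (polarPt x.1 x.2)) (Ico (0 : ℝ) 1 ×ˢ univ) :=
  hu.comp continuous_polarPt.continuousOn fun _ hx => polarPt_mem hx.1

lemma continuous_comp_polarPt {E : Type*} [TopologicalSpace E] {u : ℂ → E}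
    (hu : ContinuousOn u unitDisc) {r : ℝ} (hr : r ∈ Ico (0 : ℝ) 1) :
    Continuous fun θ => u (polarPt r θ) :=
  hu.comp_continuous (by unfold polarPt; fun_prop) fun _ => polarPt_mem hr

lemma continuousOn_angular_integral {h : ℝ × ℝ → ℝ}
    (hc : ContinuousOn h (Ico (0 : ℝ) 1 ×ˢ univ)) :
    ContinuousOn (fun r => ∫ θ in (-Real.pi)..Real.pi, h (r, θ)) (Ico (0 : ℝ) 1) := by
  intro r hr
  set R := (1 + r) / 2
  have hR : r < R ∧ R < 1 := by constructor <;> simp only [R] <;> linarith [hr.2]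
  have hR0 : 0 ≤ R := hr.1.trans hR.1.le
  have hg : Continuous fun s : ℝ => ∫ θ in (-Real.pi)..Real.pi, h (max 0 (min s R), θ) := by
    apply intervalIntegral.continuous_parametric_intervalIntegral_of_continuous'
      (f := fun s θ => h (max 0 (min s R), θ))
    refine hc.comp_continuous (by fun_prop) fun x => ⟨⟨le_max_left _ _, ?_⟩, mem_univ _⟩
    exact max_lt one_pos ((min_le_right _ _).trans_lt hR.2)
  refine (hg.continuousAt (x := r)).continuousWithinAt.congr_of_eventuallyEq ?_ ?_
  · filter_upwards [self_mem_nhdsWithin, mem_nhdsWithin_of_mem_nhds (Iio_mem_nhds hR.1)]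
      with s hs hs'
    rw [min_eq_left (le_of_lt hs'), max_eq_right hs.1]
  · rw [min_eq_left hR.1.le, max_eq_right hr.1]

lemma continuousOn_circ {u : ℂ → ℝ} (hu : ContinuousOn u unitDisc) :
    ContinuousOn (circ u) (Ico (0 : ℝ) 1) :=
  continuousOn_angular_integral (h := fun x => u (polarPt x.1 x.2)) (continuousOn_comp_polarPt hu)

lemma angular_swap {h : ℝ × ℝ → ℝ} (hc : ContinuousOn h (Ico (0 : ℝ) 1 ×ˢ univ)) {R : ℝ}
    (hR : R ∈ Ico (0 : ℝ) 1) :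
    ∫ r in (0 : ℝ)..R, ∫ θ in (-Real.pi)..Real.pi, h (r, θ) =
      ∫ θ in (-Real.pi)..Real.pi, ∫ r in (0 : ℝ)..R, h (r, θ) := by
  have hpi := Real.pi_pos
  apply intervalIntegral_intervalIntegral_swap (F := fun r θ => h (r, θ))
  refine IntegrableOn.mono_set (t := Icc 0 R ×ˢ Icc (-Real.pi) Real.pi) ?_ ?_
  · refine ContinuousOn.integrableOn_compact (isCompact_Icc.prod isCompact_Icc) ?_
    exact hc.mono (prod_mono (Icc_subset_Ico_right hR.2) (subset_univ _))
  · rw [uIoc_of_le hR.1, uIoc_of_le (by linarith)]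
    exact prod_mono Ioc_subset_Icc_self Ioc_subset_Icc_self

section Green

variable {F : ι → ℂ → ℂ} (hF : ∀ i, DifferentiableOn ℂ (F i) unitDisc) (q : ℝ)
  (hv : ∀ z ∈ unitDisc, 0 < vecSq F z)

/-- The complex gradient of `vecSq F ^ q`. -/
def vecGrad (q : ℝ) (F : ι → ℂ → ℂ) (z : ℂ) : ℂ :=
  ((vecSq F z ^ (q - 1) : ℝ) : ℂ) * vecDot F z

/-- The derivative of `vecGrad q F` at `z` in the direction `a`. -/
def vecGradDeriv (q : ℝ) (F : ι → ℂ → ℂ) (z a : ℂ) : ℂ :=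
  ((2 * (q - 1) * vecSq F z ^ (q - 2) * (vecDot F z * a).re : ℝ) : ℂ) * vecDot F z +
    ((vecSq F z ^ (q - 1) : ℝ) : ℂ) * (vecDerivSq F z * conj a + vecDot₂ F z * a)

lemma hasDerivAt_polarPt_left (r θ : ℝ) :
    HasDerivAt (fun s => polarPt s θ) (Complex.exp (θ * Complex.I)) r := by
  have := (Complex.ofRealCLM.hasDerivAt (x := r)).mul_const (Complex.exp (θ * Complex.I))
  simpa [polarPt] using this

lemma hasDerivAt_polarPt_right (r θ : ℝ) :
    HasDerivAt (fun s => polarPt r s) (Complex.I * r * Complex.exp (θ * Complex.I)) θ := by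
  have h1 : HasDerivAt (fun s : ℝ => (s : ℂ) * Complex.I) (1 * Complex.I) θ :=
    (Complex.ofRealCLM.hasDerivAt (x := θ)).mul_const Complex.I
  refine (h1.cexp.const_mul (r : ℂ)).congr_deriv ?_
  ring

lemma hasDerivAt_exp_mul_I (θ : ℝ) :
    HasDerivAt (fun s : ℝ => Complex.exp (s * Complex.I))
      (Complex.I * Complex.exp (θ * Complex.I)) θ := by
  have h1 : HasDerivAt (fun s : ℝ => (s : ℂ) * Complex.I) (1 * Complex.I) θ :=
    (Complex.ofRealCLM.hasDerivAt (x := θ)).mul_const Complex.I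
  refine h1.cexp.congr_deriv ?_
  ring

include hF hv in
lemma continuousOn_vecGrad : ContinuousOn (vecGrad q F) unitDisc := by
  unfold vecGrad
  have h1 := continuousOn_vecSq_rpow hF (q - 1) hv
  have h4 := continuousOn_vecDot hF
  exact (Complex.continuous_ofReal.comp_continuousOn h1).mul h4

/-- The radial derivative of `vecSq F ^ q`, in polar coordinates. -/
def radDeriv (q : ℝ) (F : ι → ℂ → ℂ) (x : ℝ × ℝ) : ℝ :=
  2 * q * (vecGrad q F (polarPt x.1 x.2) * Complex.exp (x.2 * Complex.I)).re

include hF hv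

lemma continuousOn_radDeriv : ContinuousOn (radDeriv q F) (Ico (0 : ℝ) 1 ×ˢ univ) := by
  have h1 := continuousOn_comp_polarPt (continuousOn_vecGrad hF q hv)
  have h2 : Continuous fun x : ℝ × ℝ => Complex.exp (x.2 * Complex.I) := by fun_prop
  exact continuousOn_const.mul (Complex.continuous_re.comp_continuousOn (h1.mul h2.continuousOn))

lemma circ_sub_circ_zero {R : ℝ} (hR : R ∈ Ico (0 : ℝ) 1) :
    circ (fun z => vecSq F z ^ q) R - circ (fun z => vecSq F z ^ q) 0 =
      ∫ r in (0 : ℝ)..R, ∫ θ in (-Real.pi)..Real.pi, radDeriv q F (r, θ) := by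
  rw [angular_swap (continuousOn_radDeriv hF q hv) hR]
  have hi : ∀ r ∈ Ico (0 : ℝ) 1, IntervalIntegrable
      (fun θ => vecSq F (polarPt r θ) ^ q) volume (-Real.pi) Real.pi := by
    intro r hr
    exact (continuous_comp_polarPt (continuousOn_vecSq_rpow hF q hv) hr).intervalIntegrable _ _
  unfold circ
  rw [← intervalIntegral.integral_sub (hi R hR) (hi 0 ⟨le_rfl, one_pos⟩)]
  congr 1
  ext θ
  symm
  apply intervalIntegral.integral_eq_sub_of_hasDerivAt (f := fun r => vecSq F (polarPt r θ) ^ q)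
  · intro r hr
    rw [uIcc_of_le hR.1] at hr
    have hr' : r ∈ Ico (0 : ℝ) 1 := ⟨hr.1, hr.2.trans_lt hR.2⟩
    have hm := polarPt_mem (θ := θ) hr'
    refine (hasDerivAt_vecSq_rpow_comp hF q (hasDerivAt_polarPt_left r θ) hm
      (hv _ hm)).congr_deriv ?_
    simp only [radDeriv, vecGrad, mul_assoc, Complex.re_ofReal_mul]
  · refine ContinuousOn.intervalIntegrable ?_
    rw [uIcc_of_le hR.1]
    exact (continuousOn_radDeriv hF q hv).comp (by fun_prop : ContinuousOn (fun r : ℝ => (r, θ)) _)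
      fun r hr => ⟨⟨hr.1, hr.2.trans_lt hR.2⟩, mem_univ _⟩

lemma hasDerivAt_vecGrad_comp' {γ : ℝ → ℂ} {γ' : ℂ} {t : ℝ} (hγ : HasDerivAt γ γ' t)
    (ht : γ t ∈ unitDisc) :
    HasDerivAt (fun s => vecGrad q F (γ s)) (vecGradDeriv q F (γ t) γ') t :=
  hasDerivAt_vecGrad_comp hF q hγ ht (hv _ ht)

lemma integral_vecLap_circle {R : ℝ} (hR : R ∈ Ico (0 : ℝ) 1) :
    ∫ r in (0 : ℝ)..R, r * circ (vecLap q F) r =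
      R * ∫ θ in (-Real.pi)..Real.pi, radDeriv q F (R, θ) := by
  have hpi := Real.pi_pos
  -- radial and angular parts of the divergence
  let e : ℝ → ℂ := fun θ => Complex.exp (θ * Complex.I)
  have he : Continuous e := by simp only [e]; fun_prop
  let D₁ : ℝ × ℝ → ℝ := fun x => radDeriv q F x +
    x.1 * (2 * q * (vecGradDeriv q F (polarPt x.1 x.2) (e x.2) * e x.2).re)
  let D₂ : ℝ × ℝ → ℝ := fun x =>
    -(2 * q * (vecGradDeriv q F (polarPt x.1 x.2) (Complex.I * x.1 * e x.2) * e x.2 +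
      vecGrad q F (polarPt x.1 x.2) * (Complex.I * e x.2)).im)
  have cG : ∀ b : ℝ × ℝ → ℂ, Continuous b → ContinuousOn
      (fun x : ℝ × ℝ => vecGradDeriv q F (polarPt x.1 x.2) (b x)) (Ico (0 : ℝ) 1 ×ˢ univ) := by
    intro b hb
    have h1 := continuousOn_comp_polarPt (continuousOn_vecSq_rpow hF (q - 1) hv)
    have h2 := continuousOn_comp_polarPt (continuousOn_vecSq_rpow hF (q - 2) hv)
    have h3 := continuousOn_comp_polarPt (continuousOn_vecDerivSq hF)
    have h4 := continuousOn_comp_polarPt (continuousOn_vecDot hF)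
    have h5 := continuousOn_comp_polarPt (continuousOn_vecDot₂ hF)
    have hb' := hb.continuousOn (s := Ico (0 : ℝ) 1 ×ˢ univ)
    have hre : ContinuousOn (fun x : ℝ × ℝ => (vecDot F (polarPt x.1 x.2) * b x).re)
      (Ico (0 : ℝ) 1 ×ˢ univ) := Complex.continuous_re.comp_continuousOn (h4.mul hb')
    refine ContinuousOn.add (ContinuousOn.mul ?_ h4) (ContinuousOn.mul ?_ (ContinuousOn.add
      (ContinuousOn.mul ?_ ?_) (h5.mul hb')))
    · exact Complex.continuous_ofReal.comp_continuousOn ((continuousOn_const.mul h2).mul hre)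
    · exact Complex.continuous_ofReal.comp_continuousOn h1
    · exact Complex.continuous_ofReal.comp_continuousOn h3
    · exact Complex.continuous_conj.comp_continuousOn hb'
  have ce : Continuous fun x : ℝ × ℝ => e x.2 := he.comp continuous_snd
  have cvg := continuousOn_comp_polarPt (continuousOn_vecGrad hF q hv)
  have cD₁ : ContinuousOn D₁ (Ico (0 : ℝ) 1 ×ˢ univ) := by
    refine (continuousOn_radDeriv hF q hv).add (continuous_fst.continuousOn.mul
      (continuousOn_const.mul (Complex.continuous_re.comp_continuousOn ?_)))
    exact (cG _ ce).mul ce.continuousOn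
  have cD₂ : ContinuousOn D₂ (Ico (0 : ℝ) 1 ×ˢ univ) := by
    refine (continuousOn_const.mul (Complex.continuous_im.comp_continuousOn ?_)).neg
    refine ((cG (fun x => Complex.I * x.1 * e x.2) (by fun_prop)).mul ce.continuousOn).add
      (cvg.mul ?_)
    exact (by fun_prop : Continuous fun x : ℝ × ℝ => Complex.I * e x.2).continuousOn
  have hsum : ∀ x : ℝ × ℝ, x.1 * vecLap q F (polarPt x.1 x.2) = D₁ x + D₂ x := by
    rintro ⟨r, θ⟩
    have hcs : (e θ).re ^ 2 + (e θ).im ^ 2 = 1 := by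
      have : Complex.normSq (e θ) = 1 := by
        rw [Complex.normSq_eq_norm_sq, Complex.norm_exp_ofReal_mul_I]; simp
      rw [Complex.normSq_apply] at this; linarith
    simp only [D₁, D₂, radDeriv, vecGrad, vecGradDeriv, vecLap]
    change _ = 2 * q * (_ * e θ).re + _ + _
    rw [← Complex.normSq_eq_norm_sq, Complex.normSq_apply]
    generalize vecSq F (polarPt r θ) ^ (q - 2) = v2
    generalize vecSq F (polarPt r θ) ^ (q - 1) = v1
    generalize vecDot F (polarPt r θ) = A
    generalize vecDot₂ F (polarPt r θ) = H
    generalize vecDerivSq F (polarPt r θ) = S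
    generalize e θ = w at hcs
    simp only [Complex.add_re, Complex.mul_re, Complex.add_im, Complex.mul_im, Complex.ofReal_re,
      Complex.ofReal_im, Complex.I_re, Complex.I_im, Complex.conj_re, Complex.conj_im]
    linear_combination
      (-4 * q * r * (v1 * S) - 4 * q * (q - 1) * r * v2 * (A.re ^ 2 + A.im ^ 2)) * hcs
  have hD₂ : ∀ r ∈ Ico (0 : ℝ) 1, ∫ θ in (-Real.pi)..Real.pi, D₂ (r, θ) = 0 := by
    intro r hr
    rw [intervalIntegral.integral_eq_sub_of_hasDerivAt
      (f := fun θ => -(2 * q * (vecGrad q F (polarPt r θ) * e θ).im))]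
    · have : e Real.pi = e (-Real.pi) := by
        simp [e, Complex.exp_neg]
      have h2 : polarPt r Real.pi = polarPt r (-Real.pi) := by
        change (r : ℂ) * e _ = r * e _
        rw [this]
      simp [this, h2]
    · intro θ _
      have h1 := (hasDerivAt_vecGrad_comp' hF q hv (hasDerivAt_polarPt_right r θ)
        (polarPt_mem hr)).mul (hasDerivAt_exp_mul_I θ)
      have h2 := (Complex.imCLM.hasFDerivAt.comp_hasDerivAt θ h1).const_mul (2 * q)
      exact h2.neg
    · refine Continuous.intervalIntegrable ?_ _ _
      exact cD₂.comp_continuous (by fun_prop) fun θ => ⟨hr, mem_univ _⟩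
  have hi : ∀ h : ℝ × ℝ → ℝ, ContinuousOn h (Ico (0 : ℝ) 1 ×ˢ univ) → ∀ r ∈ Ico (0 : ℝ) 1,
      IntervalIntegrable (fun θ => h (r, θ)) volume (-Real.pi) Real.pi := by
    intro h hh r hr
    refine Continuous.intervalIntegrable ?_ _ _
    exact hh.comp_continuous (by fun_prop) fun θ => ⟨hr, mem_univ _⟩
  calc ∫ r in (0 : ℝ)..R, r * circ (vecLap q F) r
      = ∫ r in (0 : ℝ)..R, ∫ θ in (-Real.pi)..Real.pi, D₁ (r, θ) := by
        refine intervalIntegral.integral_congr fun r hr => ?_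
        rw [uIcc_of_le hR.1] at hr
        have hr' : r ∈ Ico (0 : ℝ) 1 := ⟨hr.1, hr.2.trans_lt hR.2⟩
        simp only [circ]
        rw [← intervalIntegral.integral_const_mul]
        have : ∀ θ, r * vecLap q F (polarPt r θ) = D₁ (r, θ) + D₂ (r, θ) := fun θ => hsum (r, θ)
        simp_rw [this]
        rw [intervalIntegral.integral_add (hi _ cD₁ r hr') (hi _ cD₂ r hr'), hD₂ r hr', add_zero]
    _ = ∫ θ in (-Real.pi)..Real.pi, ∫ r in (0 : ℝ)..R, D₁ (r, θ) := angular_swap cD₁ hR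
    _ = ∫ θ in (-Real.pi)..Real.pi, R * radDeriv q F (R, θ) := by
        congr 1
        ext θ
        rw [intervalIntegral.integral_eq_sub_of_hasDerivAt
          (f := fun r => r * radDeriv q F (r, θ))]
        · simp
        · intro r hr
          rw [uIcc_of_le hR.1] at hr
          have hr' : r ∈ Ico (0 : ℝ) 1 := ⟨hr.1, hr.2.trans_lt hR.2⟩
          have h1 := (hasDerivAt_vecGrad_comp' hF q hv (hasDerivAt_polarPt_left r θ)
            (polarPt_mem hr')).mul_const (e θ)
          have h2 := (Complex.reCLM.hasFDerivAt.comp_hasDerivAt r h1).const_mul (2 * q)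
          have h3 := (hasDerivAt_id r).mul h2
          refine h3.congr_deriv ?_
          simp only [D₁, one_mul, id]
          rfl
        · refine ContinuousOn.intervalIntegrable ?_
          rw [uIcc_of_le hR.1]
          exact cD₁.comp (by fun_prop : ContinuousOn (fun r : ℝ => (r, θ)) _)
            fun r hr => ⟨⟨hr.1, hr.2.trans_lt hR.2⟩, mem_univ _⟩
    _ = _ := intervalIntegral.integral_const_mul _ _

end Green

/-- The `ℝ≥0∞`-valued version of the associated weight `ω*`. -/
def starWeight (w : ℝ → ℝ≥0∞) (s : ℝ) : ℝ≥0∞ :=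
  ∫⁻ r in Ioo s 1, w r * ENNReal.ofReal (r * Real.log (r / s))

lemma measurable_starWeight {w : ℝ → ℝ≥0∞} (hw : Measurable w) : Measurable (starWeight w) := by
  have h1 : starWeight w = fun s => ∫⁻ r, {x : ℝ × ℝ | x.1 < x.2 ∧ x.2 < 1}.indicator
      (fun x => w x.2 * ENNReal.ofReal (x.2 * Real.log (x.2 / x.1))) (s, r) := by
    ext s
    rw [starWeight, ← lintegral_indicator measurableSet_Ioo]
    rfl
  rw [h1]
  refine Measurable.lintegral_prod_right' ?_
  refine Measurable.indicator ?_ ?_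
  · exact (hw.comp measurable_snd).mul (ENNReal.measurable_ofReal.comp (measurable_snd.mul
      (Real.measurable_log.comp (measurable_snd.div measurable_fst))))
  · exact (measurableSet_lt measurable_fst measurable_snd).inter
      (measurableSet_lt measurable_snd measurable_const)

lemma lintegral_triangle_swap {f : ℝ → ℝ → ℝ≥0∞} (hf : Measurable (Function.uncurry f)) (a b : ℝ) :
    ∫⁻ t in Ioo a b, ∫⁻ s in Ioo a t, f s t = ∫⁻ s in Ioo a b, ∫⁻ t in Ioo s b, f s t := by
  have h1 : ∀ t, ∫⁻ s in Ioo a t, f s t = ∫⁻ s, (Ioo a t).indicator (fun s => f s t) s :=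
    fun t => (lintegral_indicator measurableSet_Ioo _).symm
  have h2 : ∀ s, ∫⁻ t in Ioo s b, f s t = ∫⁻ t, (Ioo s b).indicator (fun t => f s t) t :=
    fun t => (lintegral_indicator measurableSet_Ioo _).symm
  simp_rw [h1, h2]
  rw [← lintegral_indicator measurableSet_Ioo, ← lintegral_indicator measurableSet_Ioo]
  let T : Set (ℝ × ℝ) := {x | a < x.1 ∧ x.1 < x.2 ∧ x.2 < b}
  have hT : MeasurableSet T := by
    refine (measurableSet_lt measurable_const measurable_fst).inter
      ((measurableSet_lt measurable_fst measurable_snd).inter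
        (measurableSet_lt measurable_snd measurable_const))
  have e1 : ∀ t, (Ioo a b).indicator (fun t => ∫⁻ s, (Ioo a t).indicator (fun s => f s t) s) t =
      ∫⁻ s, T.indicator (Function.uncurry f) (s, t) := by
    intro t
    by_cases ht : t ∈ Ioo a b
    · rw [indicator_of_mem ht]
      refine lintegral_congr fun s => ?_
      by_cases hs : s ∈ Ioo a t
      · rw [indicator_of_mem hs, indicator_of_mem (show (s, t) ∈ T from ⟨hs.1, hs.2, ht.2⟩)]; rfl
      · rw [indicator_of_notMem hs, indicator_of_notMem fun h : (s, t) ∈ T => hs ⟨h.1, h.2.1⟩]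
    · rw [indicator_of_notMem ht]
      have : ∀ s, T.indicator (Function.uncurry f) (s, t) = 0 := fun s =>
        indicator_of_notMem (fun h : (s, t) ∈ T => ht ⟨h.1.trans h.2.1, h.2.2⟩) _
      simp [this]
  have e2 : ∀ s, (Ioo a b).indicator (fun s => ∫⁻ t, (Ioo s b).indicator (fun t => f s t) t) s =
      ∫⁻ t, T.indicator (Function.uncurry f) (s, t) := by
    intro s
    by_cases hs : s ∈ Ioo a b
    · rw [indicator_of_mem hs]
      refine lintegral_congr fun t => ?_
      by_cases ht : t ∈ Ioo s b
      · rw [indicator_of_mem ht, indicator_of_mem (show (s, t) ∈ T from ⟨hs.1, ht.1, ht.2⟩)]; rfl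
      · rw [indicator_of_notMem ht, indicator_of_notMem fun h : (s, t) ∈ T => ht ⟨h.2.1, h.2.2⟩]
    · rw [indicator_of_notMem hs]
      have : ∀ t, T.indicator (Function.uncurry f) (s, t) = 0 := fun t =>
        indicator_of_notMem (fun h : (s, t) ∈ T => hs ⟨h.1, h.2.1.trans h.2.2⟩) _
      simp [this]
  simp_rw [e1, e2]
  rw [lintegral_lintegral_swap]
  exact ((hf.indicator hT).comp measurable_swap).aemeasurable

lemma lintegral_one_div_Ioo {s r : ℝ} (hs : 0 < s) (hr : s < r) :
    ∫⁻ t in Ioo s r, ENNReal.ofReal (1 / t) = ENNReal.ofReal (Real.log (r / s)) := by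
  rw [← integral_one_div_of_pos hs (hs.trans hr), intervalIntegral.integral_of_le hr.le,
    ofReal_integral_eq_lintegral_ofReal]
  · exact setLIntegral_congr Ioo_ae_eq_Ioc
  · have : IntervalIntegrable (fun t : ℝ => 1 / t) volume s r := by
      refine ContinuousOn.intervalIntegrable ?_
      rw [uIcc_of_le hr.le]
      exact continuousOn_const.div continuousOn_id fun x hx => (hs.trans_le hx.1).ne'
    rwa [intervalIntegrable_iff_integrableOn_Ioc_of_le hr.le] at this
  · filter_upwards [ae_restrict_mem measurableSet_Ioc] with t ht
    have := hs.trans ht.1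
    positivity

lemma lintegral_disc_polar {G : ℂ → ℝ≥0∞} (hG : Measurable (unitDisc.indicator G)) :
    ∫⁻ z in unitDisc, G z =
      ∫⁻ r in Ioo (0 : ℝ) 1, ENNReal.ofReal r *
        ∫⁻ θ in Ioo (-Real.pi) Real.pi, G (polarPt r θ) := by
  rw [← lintegral_indicator measurableSet_unitDisc, ← Complex.lintegral_comp_polarCoord_symm]
  have hp : ∀ p : ℝ × ℝ, Complex.polarCoord.symm p = polarPt p.1 p.2 := fun p => by
    rw [Complex.polarCoord_symm_apply, polarPt, Complex.exp_mul_I]; simp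
  simp_rw [hp]
  have ht : polarCoord.target = Ioi (0 : ℝ) ×ˢ Ioo (-Real.pi) Real.pi := rfl
  rw [ht, Measure.volume_eq_prod, ← Measure.prod_restrict, lintegral_prod]
  · have e1 : Ioo (0 : ℝ) 1 = Ioi 0 ∩ Iio 1 := rfl
    rw [e1, ← Measure.restrict_restrict_of_subset (s := Ioi 0 ∩ Iio 1) (t := Ioi (0 : ℝ))
      inter_subset_left, ← lintegral_indicator (measurableSet_Ioi.inter measurableSet_Iio)]
    refine setLIntegral_congr_fun measurableSet_Ioi fun r hr => ?_
    have hr' : (0 : ℝ) < r := hr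
    by_cases h1 : r < 1
    · rw [indicator_of_mem (show r ∈ Ioi 0 ∩ Iio 1 from ⟨hr, h1⟩), ← lintegral_const_mul']
      · refine lintegral_congr fun θ => ?_
        rw [indicator_of_mem (polarPt_mem ⟨hr'.le, h1⟩)]; rfl
      · exact ENNReal.ofReal_ne_top
    · rw [indicator_of_notMem fun h : r ∈ Ioi 0 ∩ Iio 1 => h1 h.2]
      have : ∀ θ, unitDisc.indicator G (polarPt r θ) = 0 := fun θ =>
        indicator_of_notMem (fun h => h1 (by
          simpa [unitDisc, norm_polarPt, abs_of_pos hr'] using h)) _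
      simp [this]
  · exact ((ENNReal.measurable_ofReal.comp measurable_fst).smul
      (hG.comp continuous_polarPt.measurable)).aemeasurable

lemma measurable_indicator_of_continuousOn {u : ℂ → ℝ} (hu : ContinuousOn u unitDisc) :
    Measurable (unitDisc.indicator fun z => ENNReal.ofReal (u z)) := by
  classical
  rw [← piecewise_eq_indicator]
  exact ContinuousOn.measurable_piecewise
    (ENNReal.continuous_ofReal.comp_continuousOn hu) continuousOn_const measurableSet_unitDisc

lemma ofReal_circ {u : ℂ → ℝ} (hu : ContinuousOn u unitDisc) (h0 : ∀ z ∈ unitDisc, 0 ≤ u z)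
    {r : ℝ} (hr : r ∈ Ico (0 : ℝ) 1) :
    ENNReal.ofReal (circ u r) =
      ∫⁻ θ in Ioo (-Real.pi) Real.pi, ENNReal.ofReal (u (polarPt r θ)) := by
  have hpi := Real.pi_pos
  have hc := continuous_comp_polarPt hu hr
  rw [circ, intervalIntegral.integral_of_le (by linarith), ofReal_integral_eq_lintegral_ofReal]
  · exact (setLIntegral_congr Ioo_ae_eq_Ioc).symm
  · exact (hc.integrableOn_Icc (a := -Real.pi) (b := Real.pi)).mono_set Ioc_subset_Icc_self
  · exact Eventually.of_forall fun θ => h0 _ (polarPt_mem hr)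

lemma lintegral_disc_radial {u : ℂ → ℝ} (hu : ContinuousOn u unitDisc)
    (h0 : ∀ z ∈ unitDisc, 0 ≤ u z) {w : ℝ → ℝ≥0∞} (hw : Measurable w) :
    ∫⁻ z in unitDisc, ENNReal.ofReal (u z) * w ‖z‖ =
      ∫⁻ r in Ioo (0 : ℝ) 1, ENNReal.ofReal (r * circ u r) * w r := by
  rw [lintegral_disc_polar]
  · refine setLIntegral_congr_fun measurableSet_Ioo fun r hr => ?_
    have hr' : r ∈ Ico (0 : ℝ) 1 := ⟨hr.1.le, hr.2⟩
    simp only [norm_polarPt, abs_of_pos hr.1]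
    rw [lintegral_mul_const, ← ofReal_circ hu h0 hr', ENNReal.ofReal_mul hr.1.le, mul_assoc]
    exact (ENNReal.measurable_ofReal.comp (continuous_comp_polarPt hu hr').measurable)
  · have := (measurable_indicator_of_continuousOn hu).mul (hw.comp measurable_norm)
    convert this using 1
    ext z
    by_cases hz : z ∈ unitDisc <;> simp [hz]

section Green

variable {F : ι → ℂ → ℂ} (hF : ∀ i, DifferentiableOn ℂ (F i) unitDisc) {q : ℝ} (hq : 0 < q)
  (hv : ∀ z ∈ unitDisc, 0 < vecSq F z)
include hF hv hq

omit hF in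
lemma circ_vecLap_nonneg {s : ℝ} (hs : s ∈ Ico (0 : ℝ) 1) : 0 ≤ circ (vecLap q F) s := by
  have := Real.pi_pos
  exact intervalIntegral.integral_nonneg (by linarith) fun θ _ =>
    vecLap_nonneg hq F (hv _ (polarPt_mem hs))

lemma ofReal_circ_vecSq {R : ℝ} (hR : R ∈ Ico (0 : ℝ) 1) :
    ENNReal.ofReal (circ (fun z => vecSq F z ^ q) R) =
      ENNReal.ofReal (circ (fun z => vecSq F z ^ q) 0) +
        ∫⁻ t in Ioo 0 R, ENNReal.ofReal (1 / t) *
          ∫⁻ s in Ioo 0 t, ENNReal.ofReal (s * circ (vecLap q F) s) := by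
  set k : ℝ → ℝ := fun t => ∫ θ in (-Real.pi)..Real.pi, radDeriv q F (t, θ) with hk
  have hkc : ContinuousOn k (Ico (0 : ℝ) 1) :=
    continuousOn_angular_integral (continuousOn_radDeriv hF q hv)
  have hLc := continuousOn_circ (continuousOn_vecLap hF q hv)
  have hkt : ∀ t ∈ Ico (0 : ℝ) 1, ENNReal.ofReal (t * k t) =
      ∫⁻ s in Ioo 0 t, ENNReal.ofReal (s * circ (vecLap q F) s) := by
    intro t ht
    rw [← integral_vecLap_circle hF q hv ht, intervalIntegral.integral_of_le ht.1,
      ofReal_integral_eq_lintegral_ofReal]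
    · exact (setLIntegral_congr Ioo_ae_eq_Ioc).symm
    · refine IntegrableOn.mono_set (t := Icc 0 t) ?_ Ioc_subset_Icc_self
      refine ContinuousOn.integrableOn_compact isCompact_Icc ?_
      exact continuousOn_id.mul (hLc.mono (Icc_subset_Ico_right ht.2))
    · filter_upwards [ae_restrict_mem measurableSet_Ioc] with s hs
      exact mul_nonneg hs.1.le (circ_vecLap_nonneg hq hv ⟨hs.1.le, hs.2.trans_lt ht.2⟩)
  have hk0 : ∀ t ∈ Ioo (0 : ℝ) 1, 0 ≤ k t := by
    intro t ht
    have h1 : 0 ≤ t * k t := by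
      rw [← integral_vecLap_circle hF q hv ⟨ht.1.le, ht.2⟩]
      refine intervalIntegral.integral_nonneg ht.1.le fun s hs => ?_
      exact mul_nonneg hs.1 (circ_vecLap_nonneg hq hv ⟨hs.1, hs.2.trans_lt ht.2⟩)
    exact nonneg_of_mul_nonneg_right h1 ht.1
  have hm0 : 0 ≤ circ (fun z => vecSq F z ^ q) 0 := by
    have := Real.pi_pos
    exact intervalIntegral.integral_nonneg (by linarith) fun θ _ =>
      Real.rpow_nonneg (vecSq_nonneg _ _) _
  have hd : circ (fun z => vecSq F z ^ q) R =
      circ (fun z => vecSq F z ^ q) 0 + ∫ r in (0 : ℝ)..R, k r := by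
    rw [← circ_sub_circ_zero hF q hv hR]; ring
  have hI : 0 ≤ ∫ r in (0 : ℝ)..R, k r := by
    rw [intervalIntegral.integral_of_le hR.1, integral_Ioc_eq_integral_Ioo]
    exact setIntegral_nonneg measurableSet_Ioo fun r hr => hk0 r ⟨hr.1, hr.2.trans hR.2⟩
  rw [hd, ENNReal.ofReal_add hm0 hI, intervalIntegral.integral_of_le hR.1,
    integral_Ioc_eq_integral_Ioo, ofReal_integral_eq_lintegral_ofReal]
  · congr 1
    refine setLIntegral_congr_fun measurableSet_Ioo fun t ht => ?_
    rw [← hkt t ⟨ht.1.le, ht.2.trans hR.2⟩, ← ENNReal.ofReal_mul (by have := ht.1; positivity)]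
    congr 1
    have := ht.1.ne'
    field_simp
  · refine IntegrableOn.mono_set (t := Icc 0 R) ?_ Ioo_subset_Icc_self
    exact ContinuousOn.integrableOn_compact isCompact_Icc (hkc.mono (Icc_subset_Ico_right hR.2))
  · filter_upwards [ae_restrict_mem measurableSet_Ioo] with t ht
    exact hk0 t ⟨ht.1, ht.2.trans hR.2⟩

lemma circ_vecSq_mono {r R : ℝ} (hr : 0 ≤ r) (hrR : r ≤ R) (hR : R < 1) :
    circ (fun z => vecSq F z ^ q) r ≤ circ (fun z => vecSq F z ^ q) R := by
  have hm0 : ∀ s, 0 ≤ circ (fun z => vecSq F z ^ q) s := fun s => by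
    have := Real.pi_pos
    exact intervalIntegral.integral_nonneg (by linarith) fun θ _ =>
      Real.rpow_nonneg (vecSq_nonneg _ _) _
  rw [← ENNReal.ofReal_le_ofReal_iff (hm0 R), ofReal_circ_vecSq hF hq hv ⟨hr, hrR.trans_lt hR⟩,
    ofReal_circ_vecSq hF hq hv ⟨hr.trans hrR, hR⟩]
  gcongr

/-- Green's formula for a radial weight. -/
lemma lintegral_vecSq_rpow {w : ℝ → ℝ≥0∞} (hw : Measurable w) :
    ∫⁻ z in unitDisc, ENNReal.ofReal (vecSq F z ^ q) * w ‖z‖ =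
      ENNReal.ofReal (vecSq F 0 ^ q) * (∫⁻ z in unitDisc, w ‖z‖) +
        ∫⁻ z in unitDisc, ENNReal.ofReal (vecLap q F z) * starWeight w ‖z‖ := by
  set m := circ (fun z => vecSq F z ^ q) with hm
  set φ : ℝ → ℝ≥0∞ := (Ioo (0 : ℝ) 1).indicator
    (fun s => ENNReal.ofReal (s * circ (vecLap q F) s)) with hφ
  have hLc := continuousOn_circ (continuousOn_vecLap hF q hv)
  have hφm : Measurable φ := by
    classical
    rw [hφ, ← piecewise_eq_indicator]
    refine ContinuousOn.measurable_piecewise (ENNReal.continuous_ofReal.comp_continuousOn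
      (continuousOn_id.mul (hLc.mono Ioo_subset_Ico_self))) continuousOn_const measurableSet_Ioo
  have hm0 : m 0 = 2 * Real.pi * vecSq F 0 ^ q := by
    rw [hm]
    simp only [circ, polarPt, Complex.ofReal_zero, zero_mul, intervalIntegral.integral_const,
      smul_eq_mul]
    ring
  have hlog : Measurable (Function.uncurry fun s r : ℝ =>
      w r * ENNReal.ofReal (r * Real.log (r / s))) :=
    (hw.comp measurable_snd).mul (ENNReal.measurable_ofReal.comp (measurable_snd.mul
      (Real.measurable_log.comp (measurable_snd.div measurable_fst))))
  have hsm : Measurable (starWeight w) := measurable_starWeight hw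
  rw [lintegral_disc_radial (u := fun z => vecSq F z ^ q) (continuousOn_vecSq_rpow hF q hv)
      (fun z _ => Real.rpow_nonneg (vecSq_nonneg _ _) _) hw,
    lintegral_disc_radial (continuousOn_vecLap hF q hv)
      (fun z hz => vecLap_nonneg hq F (hv z hz)) hsm]
  have h1 := lintegral_disc_radial (u := fun _ => (1 : ℝ)) continuousOn_const (by simp) hw
  have hc1 : circ (fun _ => (1 : ℝ)) = fun _ => 2 * Real.pi := by
    ext
    simp only [circ, intervalIntegral.integral_const, smul_eq_mul]
    ring
  simp only [hc1, ENNReal.ofReal_one, one_mul] at h1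
  rw [h1, ← lintegral_const_mul' _ _ ENNReal.ofReal_ne_top]
  have hinv : Measurable fun t : ℝ => ENNReal.ofReal (1 / t) :=
    ENNReal.measurable_ofReal.comp (measurable_const.div measurable_id)
  -- expand the circle integrals
  have h2 : ∀ r ∈ Ioo (0 : ℝ) 1, ENNReal.ofReal (r * m r) * w r =
      ENNReal.ofReal (vecSq F 0 ^ q) * (ENNReal.ofReal (r * (2 * Real.pi)) * w r) +
        ∫⁻ s in Ioo 0 r, φ s * (w r * ENNReal.ofReal (r * Real.log (r / s))) := by
    intro r hr
    rw [ENNReal.ofReal_mul hr.1.le, ofReal_circ_vecSq hF hq hv ⟨hr.1.le, hr.2⟩, mul_add, add_mul]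
    congr 1
    · rw [← hm, hm0, ENNReal.ofReal_mul (by positivity), ENNReal.ofReal_mul hr.1.le]
      ring
    · have e1 : ∫⁻ t in Ioo 0 r, ENNReal.ofReal (1 / t) *
          ∫⁻ s in Ioo 0 t, ENNReal.ofReal (s * circ (vecLap q F) s) =
          ∫⁻ t in Ioo 0 r, ∫⁻ s in Ioo 0 t, φ s * ENNReal.ofReal (1 / t) := by
        refine setLIntegral_congr_fun measurableSet_Ioo fun t ht => ?_
        rw [← lintegral_const_mul' _ _ ENNReal.ofReal_ne_top]
        refine setLIntegral_congr_fun measurableSet_Ioo fun s hs => ?_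
        simp only [hφ]
        rw [indicator_of_mem (mem_Ioo.2 ⟨hs.1, hs.2.trans (ht.2.trans hr.2)⟩), mul_comm]
      have hmeas : Measurable (Function.uncurry fun s t : ℝ => φ s * ENNReal.ofReal (1 / t)) :=
        (hφm.comp measurable_fst).mul (ENNReal.measurable_ofReal.comp
          (measurable_const.div measurable_snd))
      have e2 : ∫⁻ s in Ioo 0 r, ∫⁻ t in Ioo s r, φ s * ENNReal.ofReal (1 / t) =
          ∫⁻ s in Ioo 0 r, φ s * ENNReal.ofReal (Real.log (r / s)) := by
        refine setLIntegral_congr_fun measurableSet_Ioo fun s hs => ?_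
        rw [lintegral_const_mul _ hinv, lintegral_one_div_Ioo hs.1 hs.2]
      have hφl : Measurable fun s => φ s * ENNReal.ofReal (Real.log (r / s)) :=
        hφm.mul (ENNReal.measurable_ofReal.comp (Real.measurable_log.comp
          (measurable_const.div measurable_id)))
      rw [e1, lintegral_triangle_swap hmeas, e2, mul_comm (ENNReal.ofReal r), mul_assoc,
        ← lintegral_mul_const _ hφl]
      refine lintegral_congr fun s => ?_
      rw [ENNReal.ofReal_mul hr.1.le]
      ring
  have hA : Measurable fun r : ℝ => ENNReal.ofReal (vecSq F 0 ^ q) *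
      (ENNReal.ofReal (r * (2 * Real.pi)) * w r) :=
    measurable_const.mul ((ENNReal.measurable_ofReal.comp
      (measurable_id.mul measurable_const)).mul hw)
  rw [setLIntegral_congr_fun measurableSet_Ioo h2, lintegral_add_left hA]
  congr 1
  rw [lintegral_triangle_swap (f := fun s r => φ s * (w r * ENNReal.ofReal (r * Real.log (r / s))))
    ((hφm.comp measurable_fst).mul hlog)]
  refine setLIntegral_congr_fun measurableSet_Ioo fun s hs => ?_
  simp only [starWeight]
  have hls : Measurable fun r => w r * ENNReal.ofReal (r * Real.log (r / s)) :=
    hlog.comp measurable_prodMk_left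
  rw [lintegral_const_mul _ hls]
  simp only [hφ]
  rw [indicator_of_mem hs]

end Green

end

lemma vecSq_cons_const (f : ℂ → ℂ) (ε : ℝ) (z : ℂ) :
    vecSq ![f, fun _ => (ε : ℂ)] z = ‖f z‖ ^ 2 + ε ^ 2 := by
  simp [vecSq, Fin.sum_univ_two]

lemma sq_rpow_half {x : ℝ} (hx : 0 ≤ x) (p : ℝ) : (x ^ 2) ^ (p / 2) = x ^ p := by
  rw [← Real.rpow_natCast, ← Real.rpow_mul hx]; congr 1; push_cast; ring

lemma continuousOn_norm_rpow {f : ℂ → ℂ} (hf : DifferentiableOn ℂ f unitDisc) {p : ℝ}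
    (hp : 0 < p) : ContinuousOn (fun z => ‖f z‖ ^ p) unitDisc :=
  hf.continuousOn.norm.rpow_const fun _ _ => Or.inr hp.le

/-- The integral means of an analytic function are nondecreasing. -/
lemma circ_norm_rpow_mono {f : ℂ → ℂ} (hf : DifferentiableOn ℂ f unitDisc) {p : ℝ} (hp : 0 < p)
    {r R : ℝ} (hr : 0 ≤ r) (hrR : r ≤ R) (hR : R < 1) :
    circ (fun z => ‖f z‖ ^ p) r ≤ circ (fun z => ‖f z‖ ^ p) R := by
  have key : ∀ s ∈ Ico (0 : ℝ) 1,
      Tendsto (fun ε : ℝ => circ (fun z => (‖f z‖ ^ 2 + ε ^ 2) ^ (p / 2)) s) (𝓝[>] 0)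
        (𝓝 (circ (fun z => ‖f z‖ ^ p) s)) := by
    intro s hs
    have hc : Continuous fun ε : ℝ => circ (fun z => (‖f z‖ ^ 2 + ε ^ 2) ^ (p / 2)) s := by
      refine intervalIntegral.continuous_parametric_intervalIntegral_of_continuous'
        (f := fun ε θ => (‖f (polarPt s θ)‖ ^ 2 + ε ^ 2) ^ (p / 2)) ?_ _ _
      have h1 := continuous_comp_polarPt hf.continuousOn hs
      have h2 : Continuous fun x : ℝ × ℝ => ‖f (polarPt s x.2)‖ ^ 2 + x.1 ^ 2 :=
        ((h1.comp continuous_snd).norm.pow 2).add (continuous_fst.pow 2)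
      exact h2.rpow_const fun _ => Or.inr (by positivity)
    have := hc.tendsto 0
    simp only [ne_eq, OfNat.ofNat_ne_zero, not_false_eq_true, zero_pow, add_zero,
      sq_rpow_half (norm_nonneg _)] at this
    exact this.mono_left nhdsWithin_le_nhds
  refine le_of_tendsto_of_tendsto (key r ⟨hr, hrR.trans_lt hR⟩) (key R ⟨hr.trans hrR, hR⟩) ?_
  filter_upwards [self_mem_nhdsWithin] with ε hε
  have hε : 0 < ε := hε
  have := circ_vecSq_mono (F := ![f, fun _ => (ε : ℂ)]) (q := p / 2) (by
    intro i; fin_cases i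
    · exact hf
    · exact differentiableOn_const _) (by positivity)
    (fun z _ => by rw [vecSq_cons_const]; positivity) hr hrR hR
  simpa only [vecSq_cons_const] using this

lemma circ_zero (u : ℂ → ℝ) : circ u 0 = 2 * Real.pi * u 0 := by
  simp only [circ, polarPt, Complex.ofReal_zero, zero_mul, intervalIntegral.integral_const,
      smul_eq_mul]
  ring

lemma circ_nonneg {u : ℂ → ℝ} (hu : ∀ z, 0 ≤ u z) (r : ℝ) : 0 ≤ circ u r := by
  have := Real.pi_pos
  exact intervalIntegral.integral_nonneg (by linarith) fun θ _ => hu _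

lemma submean_disc {f : ℂ → ℂ} (hf : DifferentiableOn ℂ f unitDisc) {p : ℝ} (hp : 0 < p) :
    ENNReal.ofReal (Real.pi * ‖f 0‖ ^ p) ≤ ∫⁻ z in unitDisc, ENNReal.ofReal (‖f z‖ ^ p) := by
  have h1 := lintegral_disc_radial (continuousOn_norm_rpow hf hp) (fun z _ => by positivity)
    (w := fun _ => 1) measurable_const
  simp only [mul_one] at h1
  rw [h1]
  calc ENNReal.ofReal (Real.pi * ‖f 0‖ ^ p)
      = ∫⁻ r in Ioo (0 : ℝ) 1, ENNReal.ofReal (r * (2 * Real.pi * ‖f 0‖ ^ p)) := by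
        rw [← ofReal_integral_eq_lintegral_ofReal]
        · congr 1
          rw [← integral_Ioc_eq_integral_Ioo, ← intervalIntegral.integral_of_le zero_le_one,
            intervalIntegral.integral_mul_const, integral_id]
          ring
        · exact (Continuous.integrableOn_Icc (by fun_prop)).mono_set Ioo_subset_Icc_self
        · filter_upwards [ae_restrict_mem measurableSet_Ioo] with t ht
          have := ht.1.le
          have := Real.pi_pos
          positivity
    _ ≤ _ := by
        refine setLIntegral_mono' measurableSet_Ioo fun r hr => ?_
        refine ENNReal.ofReal_le_ofReal (mul_le_mul_of_nonneg_left ?_ hr.1.le)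
        have := circ_norm_rpow_mono hf hp le_rfl hr.1.le hr.2
        rwa [circ_zero] at this

lemma lintegral_affine {φ : ℂ → ℝ≥0∞} (a : ℂ) {δ : ℝ} (hδ : 0 < δ) :
    ∫⁻ z in Metric.ball a δ, φ z = ENNReal.ofReal (δ ^ 2) * ∫⁻ z in unitDisc, φ (a + δ * z) := by
  let T : ℂ ≃ₜ ℂ := (Homeomorph.smulOfNeZero δ hδ.ne').trans (Homeomorph.addLeft a)
  have hT : ∀ z, T z = a + δ * z := fun z => by simp [T]
  have hmap : Measure.map T volume = ENNReal.ofReal ((δ ^ 2)⁻¹) • (volume : Measure ℂ) := by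
    have h1 : (T : ℂ → ℂ) = (fun z => a + z) ∘ fun z => δ • z := by ext z; simp [T]
    rw [h1, ← Measure.map_map (by fun_prop) (by fun_prop), Measure.map_addHaar_smul _ hδ.ne',
      Measure.map_smul, map_add_left_eq_self]
    simp [Complex.finrank_real_complex, abs_of_pos hδ]
  have hpre : T ⁻¹' Metric.ball a δ = unitDisc := by
    ext z
    simp only [mem_preimage, hT, Metric.mem_ball, dist_self_add_left, norm_mul, unitDisc,
      mem_ofPred_eq, Complex.norm_real, Real.norm_eq_abs, abs_of_pos hδ]
    constructor
    · intro h; by_contra! h'; nlinarith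
    · intro h; nlinarith
  have h2 : ∫⁻ z in unitDisc, φ (a + δ * z) =
      ∫⁻ z in Metric.ball a δ, φ z ∂(Measure.map T volume) := by
    rw [T.measurableEmbedding.restrict_map, hpre, T.measurableEmbedding.lintegral_map]
    simp only [hT]
  rw [h2, hmap, Measure.restrict_smul, lintegral_smul_measure, smul_eq_mul, ← mul_assoc,
    ← ENNReal.ofReal_mul (by positivity), mul_inv_cancel₀ (by positivity), ENNReal.ofReal_one,
    one_mul]

lemma submean_ball {f : ℂ → ℂ} (hf : DifferentiableOn ℂ f unitDisc) {p : ℝ} (hp : 0 < p)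
    {a : ℂ} {δ : ℝ} (hδ : 0 < δ) (ha : Metric.ball a δ ⊆ unitDisc) :
    ENNReal.ofReal (Real.pi * δ ^ 2 * ‖f a‖ ^ p) ≤
      ∫⁻ z in Metric.ball a δ, ENNReal.ofReal (‖f z‖ ^ p) := by
  have hmaps : MapsTo (fun z : ℂ => a + δ * z) unitDisc unitDisc := by
    intro z hz
    refine ha ?_
    simp only [unitDisc, mem_ofPred_eq] at hz
    simp only [Metric.mem_ball, dist_self_add_left, norm_mul, Complex.norm_real,
      Real.norm_eq_abs, abs_of_pos hδ]
    nlinarith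
  have h1 : DifferentiableOn ℂ (fun z => f (a + δ * z)) unitDisc :=
    hf.comp (by fun_prop) hmaps
  have h2 := submean_disc h1 hp
  rw [lintegral_affine a hδ, show Real.pi * δ ^ 2 * ‖f a‖ ^ p = δ ^ 2 * (Real.pi * ‖f a‖ ^ p) by
    ring, ENNReal.ofReal_mul (by positivity)]
  simp only [mul_zero, add_zero] at h2
  gcongr

lemma norm_rpow_le_circ {f : ℂ → ℂ} (hf : DifferentiableOn ℂ f unitDisc) {p : ℝ} (hp : 0 < p)
    {a : ℂ} (ha : a ∈ unitDisc) {s : ℝ} (hs : (1 + ‖a‖) / 2 ≤ s) (hs1 : s < 1) :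
    Real.pi / 4 * ((1 - ‖a‖) * ‖f a‖ ^ p) ≤ circ (fun z => ‖f z‖ ^ p) s := by
  have ha1 : ‖a‖ < 1 := ha
  have hpi := Real.pi_pos
  have hna := norm_nonneg a
  set d := 1 - ‖a‖ with hd
  have hd0 : 0 < d := by simp only [hd]; linarith
  set u : ℂ → ℝ := fun z => ‖f z‖ ^ p with hu
  have huc := continuousOn_norm_rpow hf hp
  have hu0 : ∀ z, 0 ≤ u z := fun z => by positivity
  have hball : Metric.ball a (d / 2) ⊆ unitDisc := by
    intro z hz
    rw [Metric.mem_ball, dist_eq_norm] at hz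
    have : ‖z‖ ≤ ‖z - a‖ + ‖a‖ := by simpa using norm_add_le (z - a) a
    simp only [unitDisc, mem_ofPred_eq]; linarith
  have h1 := submean_ball hf hp (a := a) (half_pos hd0) hball
  let J : Set ℝ := Ioo (‖a‖ - d / 2) (‖a‖ + d / 2)
  have h2 : ∫⁻ z in Metric.ball a (d / 2), ENNReal.ofReal (‖f z‖ ^ p) ≤
      ∫⁻ z in unitDisc, ENNReal.ofReal (u z) * J.indicator 1 ‖z‖ := by
    rw [← lintegral_indicator measurableSet_unitDisc,
      ← lintegral_indicator Metric.isOpen_ball.measurableSet]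
    refine lintegral_mono fun z => ?_
    by_cases hz : z ∈ Metric.ball a (d / 2)
    · have hJ : ‖z‖ ∈ J := by
        rw [Metric.mem_ball, dist_eq_norm] at hz
        have := abs_le.1 (abs_norm_sub_norm_le z a)
        constructor <;> linarith [this.1, this.2]
      rw [indicator_of_mem hz, indicator_of_mem (hball hz), indicator_of_mem hJ]
      simp [u]
    · rw [indicator_of_notMem hz]; exact zero_le
  rw [lintegral_disc_radial huc (fun z _ => hu0 z)
    (measurable_one.indicator measurableSet_Ioo)] at h2
  have h3 : ∫⁻ r in Ioo (0 : ℝ) 1, ENNReal.ofReal (r * circ u r) * J.indicator 1 r ≤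
      ∫⁻ r, J.indicator (fun _ => ENNReal.ofReal (circ u s)) r := by
    rw [← lintegral_indicator measurableSet_Ioo]
    refine lintegral_mono fun r => ?_
    by_cases hr : r ∈ Ioo (0 : ℝ) 1
    · rw [indicator_of_mem hr]
      by_cases hJ : r ∈ J
      · rw [indicator_of_mem hJ, indicator_of_mem hJ, Pi.one_apply, mul_one]
        refine ENNReal.ofReal_le_ofReal ?_
        have hrs : r ≤ s := by
          have := hJ.2; simp only [hd] at this; linarith
        calc r * circ u r ≤ 1 * circ u r := by
              gcongr
              · exact circ_nonneg hu0 r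
              · exact hr.2.le
          _ ≤ circ u s := by
            rw [one_mul]; exact circ_norm_rpow_mono hf hp hr.1.le hrs hs1
      · rw [indicator_of_notMem hJ, indicator_of_notMem hJ]; simp
    · rw [indicator_of_notMem hr]; exact zero_le
  have h4 : ∫⁻ r, J.indicator (fun _ => ENNReal.ofReal (circ u s)) r =
      ENNReal.ofReal (d * circ u s) := by
    rw [lintegral_indicator measurableSet_Ioo, setLIntegral_const, Real.volume_Ioo,
      ← ENNReal.ofReal_mul (circ_nonneg hu0 s)]
    congr 1; ring
  have h5 := h1.trans (h2.trans (h3.trans h4.le))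
  rw [ENNReal.ofReal_le_ofReal_iff (mul_nonneg hd0.le (circ_nonneg hu0 s))] at h5
  have h6 : d * (Real.pi / 4 * (d * ‖f a‖ ^ p)) ≤ d * circ u s := by
    refine le_trans (le_of_eq ?_) h5; ring
  exact le_of_mul_le_mul_left h6 hd0

/-- Pointwise estimate of an analytic function by its integral against a radial weight. -/
lemma norm_rpow_le_lintegral {f : ℂ → ℂ} (hf : DifferentiableOn ℂ f unitDisc) {p : ℝ} (hp : 0 < p)
    {a : ℂ} (ha : a ∈ unitDisc) {w : ℝ → ℝ≥0∞} (hw : Measurable w) :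
    ENNReal.ofReal (Real.pi / 8 * ((1 - ‖a‖) * ‖f a‖ ^ p)) *
        ∫⁻ r in Ioo ((1 + ‖a‖) / 2) 1, w r ≤
      ∫⁻ z in unitDisc, ENNReal.ofReal (‖f z‖ ^ p) * w ‖z‖ := by
  have hna := norm_nonneg a
  rw [lintegral_disc_radial (continuousOn_norm_rpow hf hp) (fun z _ => by positivity) hw,
    ← lintegral_const_mul _ hw]
  refine le_trans ?_ (lintegral_mono_set
    (Ioo_subset_Ioo_left (show (0 : ℝ) ≤ (1 + ‖a‖) / 2 by positivity)))
  refine setLIntegral_mono' measurableSet_Ioo fun r hr => ?_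
  refine mul_le_mul' (ENNReal.ofReal_le_ofReal ?_) le_rfl
  have h1 := norm_rpow_le_circ hf hp ha hr.1.le hr.2
  have h2 : 1 / 2 ≤ r := by linarith [hr.1]
  have h3 : 0 ≤ circ (fun z => ‖f z‖ ^ p) r := circ_nonneg (fun z => by positivity) r
  have h4 := mul_le_mul_of_nonneg_right h2 h3
  linarith

lemma lintegral_dilate_le {f : ℂ → ℂ} (hf : DifferentiableOn ℂ f unitDisc) {p : ℝ} (hp : 0 < p)
    {ρ : ℝ} (hρ : ρ ∈ Ico (0 : ℝ) 1) {w : ℝ → ℝ≥0∞} (hw : Measurable w) :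
    ∫⁻ z in unitDisc, ENNReal.ofReal (‖f (ρ * z)‖ ^ p) * w ‖z‖ ≤
      ∫⁻ z in unitDisc, ENNReal.ofReal (‖f z‖ ^ p) * w ‖z‖ := by
  have hmaps : MapsTo (fun z : ℂ => ρ * z) unitDisc unitDisc := by
    intro z hz
    simp only [unitDisc, mem_ofPred_eq] at hz
    simp only [unitDisc, mem_ofPred_eq, norm_mul, Complex.norm_real, Real.norm_eq_abs,
      abs_of_nonneg hρ.1]
    nlinarith [hρ.1, hρ.2, norm_nonneg z]
  have hf' : DifferentiableOn ℂ (fun z => f (ρ * z)) unitDisc := hf.comp (by fun_prop) hmaps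
  rw [lintegral_disc_radial (continuousOn_norm_rpow hf hp) (fun z _ => by positivity) hw,
    lintegral_disc_radial (continuousOn_norm_rpow hf' hp) (fun z _ => by positivity) hw]
  refine setLIntegral_mono' measurableSet_Ioo fun r hr => ?_
  have hr0 := hr.1
  gcongr
  have h1 : circ (fun z => ‖f (ρ * z)‖ ^ p) r = circ (fun z => ‖f z‖ ^ p) (ρ * r) := by
    simp only [circ, polarPt, Complex.ofReal_mul, mul_assoc]
  rw [h1]
  exact circ_norm_rpow_mono hf hp (mul_nonneg hρ.1 hr.1.le)
    (by nlinarith [hρ.2, hr.1]) hr.2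

section Weight

variable {ω : ℝ → ℝ}

lemma IsRadialWeight.intervalIntegrable (h : IsRadialWeight ω) {r s : ℝ} (hr : r ∈ Icc (0 : ℝ) 1)
    (hs : s ∈ Icc (0 : ℝ) 1) : IntervalIntegrable ω volume r s := by
  have h1 : IntervalIntegrable ω volume 0 1 :=
    (intervalIntegrable_iff_integrableOn_Ico_of_le zero_le_one).2 h.2
  exact h1.mono_set (by rw [uIcc_of_le zero_le_one]; exact uIcc_subset_Icc hr hs)

lemma IsRadialWeight.wInt_pos (h : IsRadialWeight ω) {r : ℝ} (hr : r ∈ Ico (0 : ℝ) 1) :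
    0 < wInt ω r :=
  intervalIntegral.intervalIntegral_pos_of_pos_on
    (h.intervalIntegrable ⟨hr.1, hr.2.le⟩ ⟨zero_le_one, le_rfl⟩)
    (fun x hx => h.1 x ⟨hr.1.trans hx.1.le, hx.2⟩) hr.2

lemma IsRadialWeight.wInt_eq (h : IsRadialWeight ω) {r : ℝ} (hr : r ∈ Icc (0 : ℝ) 1) :
    wInt ω r = wInt ω 0 - ∫ s in (0 : ℝ)..r, ω s := by
  have := intervalIntegral.integral_add_adjacent_intervals
    (h.intervalIntegrable (r := 0) (s := r) ⟨le_rfl, zero_le_one⟩ hr)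
    (h.intervalIntegrable (r := r) (s := 1) hr ⟨zero_le_one, le_rfl⟩)
  simp only [wInt]; linarith

lemma IsRadialWeight.continuousOn_wInt (h : IsRadialWeight ω) :
    ContinuousOn (wInt ω) (Ico (0 : ℝ) 1) := by
  have h1 : ContinuousOn (fun r => ∫ s in (0 : ℝ)..r, ω s) (Icc (0 : ℝ) 1) := by
    have := intervalIntegral.continuousOn_primitive_interval (a := 0) (b := 1) (f := ω)
      (μ := volume) (by
        rw [uIcc_of_le zero_le_one, integrableOn_Icc_iff_integrableOn_Ico]; exact h.2)
    rwa [uIcc_of_le zero_le_one] at this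
  refine ((continuousOn_const (c := wInt ω 0)).sub (h1.mono Ico_subset_Icc_self)).congr
    fun r hr => h.wInt_eq ⟨hr.1, hr.2.le⟩

lemma IsRadialContinuousWeight.hasDerivAt_wInt (h : IsRadialContinuousWeight ω) {r : ℝ}
    (hr : r ∈ Ioo (0 : ℝ) 1) : HasDerivAt (wInt ω) (-ω r) r := by
  have hn : Ico (0 : ℝ) 1 ∈ 𝓝 r := Ico_mem_nhds hr.1 hr.2
  have hm : StronglyMeasurableAtFilter ω (𝓝 r) volume :=
    ⟨Ico (0 : ℝ) 1, hn, h.1.2.aestronglyMeasurable⟩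
  have h1 : HasDerivAt (fun u => ∫ s in u..1, ω s) (-ω r) r :=
    intervalIntegral.integral_hasDerivAt_left
      (h.1.intervalIntegrable ⟨hr.1.le, hr.2.le⟩ ⟨zero_le_one, le_rfl⟩)
      hm (h.2.continuousAt hn)
  exact h1

lemma exists_mul_le_wInt (hω : IsRegularWeight ω ∨ IsRapidlyIncreasing ω) :
    ∃ κ : ℝ, 0 < κ ∧ ∀ r ∈ Ico (0 : ℝ) 1, (1 - r) * ω r ≤ κ * wInt ω r := by
  rcases hω with ⟨-, c, C, hc, -, h⟩ | ⟨h, ht⟩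
  · refine ⟨1 / c, by positivity, fun r hr => ?_⟩
    have := (h r hr).1
    rw [div_mul_eq_mul_div, one_mul, le_div_iff₀ hc]; linarith
  · have h1 := ht.eventually (eventually_ge_atTop 1)
    obtain ⟨r₀, hr₀, hr₀'⟩ := (mem_nhdsLT_iff_exists_Ioo_subset.1 h1)
    have hr₀ : r₀ < 1 := hr₀
    set s := max 0 r₀ with hs
    have hs1 : s < 1 := max_lt one_pos hr₀
    have hcont : ContinuousOn (fun r => (1 - r) * ω r / wInt ω r) (Icc 0 s) := by
      have hsub : Icc 0 s ⊆ Ico (0 : ℝ) 1 := Icc_subset_Ico_right hs1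
      exact ((continuousOn_const.sub continuousOn_id).mul (h.2.mono hsub)).div
        (h.1.continuousOn_wInt.mono hsub) fun r hr => (h.1.wInt_pos (hsub hr)).ne'
    obtain ⟨B, hB⟩ := (isCompact_Icc.image_of_continuousOn hcont).bddAbove
    refine ⟨max B 1, by positivity, fun r hr => ?_⟩
    have hp := h.1.wInt_pos hr
    rcases le_or_gt r s with hrs | hrs
    · have := hB ⟨r, ⟨hr.1, hrs⟩, rfl⟩
      rw [div_le_iff₀ hp] at this
      exact this.trans (mul_le_mul_of_nonneg_right (le_max_left _ _) hp.le)
    · have h2 : 1 ≤ wInt ω r / (ω r * (1 - r)) := hr₀' ⟨(le_max_right _ _).trans_lt hrs, hr.2⟩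
      have h3 : 0 < ω r * (1 - r) := mul_pos (h.1.1 r hr) (by linarith [hr.2])
      rw [le_div_iff₀ h3] at h2
      calc (1 - r) * ω r ≤ 1 * wInt ω r := by linarith
        _ ≤ _ := mul_le_mul_of_nonneg_right (le_max_right _ _) hp.le

lemma wInt_doubling (h : IsRadialContinuousWeight ω) {κ : ℝ}
    (hκ : ∀ r ∈ Ico (0 : ℝ) 1, (1 - r) * ω r ≤ κ * wInt ω r) {r s : ℝ} (hr : 0 ≤ r)
    (hrs : r ≤ s) (hs : s < 1) : wInt ω r ≤ ((1 - r) / (1 - s)) ^ κ * wInt ω s := by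
  have hmono : MonotoneOn (fun r => wInt ω r * (1 - r) ^ (-κ)) (Ico (0 : ℝ) 1) := by
    have hd : ∀ r ∈ Ioo (0 : ℝ) 1, HasDerivAt (fun r => wInt ω r * (1 - r) ^ (-κ))
        (-ω r * (1 - r) ^ (-κ) + wInt ω r * (-1 * (-κ) * (1 - r) ^ (-κ - 1))) r := by
      intro r hr
      have h1 : HasDerivAt (fun r : ℝ => 1 - r) (-1) r := by
        simpa using (hasDerivAt_id r).const_sub 1
      exact (h.hasDerivAt_wInt hr).mul (h1.rpow_const (Or.inl (by linarith [hr.2])))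
    refine monotoneOn_of_deriv_nonneg (convex_Ico 0 1) ?_ ?_ ?_
    · refine h.1.continuousOn_wInt.mul ?_
      exact (continuousOn_const.sub continuousOn_id).rpow_const fun r hr =>
        Or.inl (sub_pos.2 hr.2).ne'
    · rw [interior_Ico]; exact fun r hr => (hd r hr).differentiableAt.differentiableWithinAt
    · rw [interior_Ico]
      intro r hr
      have hr1 : 0 < 1 - r := by linarith [hr.2]
      rw [(hd r hr).deriv]
      have e : (1 - r) ^ (-κ) = (1 - r) * (1 - r) ^ (-κ - 1) := by
        rw [mul_comm, ← Real.rpow_add_one hr1.ne']; congr 1; ring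
      rw [e]
      have h2 := hκ r ⟨hr.1.le, hr.2⟩
      have h3 : 0 ≤ (1 - r) ^ (-κ - 1) := by positivity
      nlinarith [mul_nonneg h3 (sub_nonneg.2 h2)]
  have h1 := hmono ⟨hr, hrs.trans_lt hs⟩ ⟨hr.trans hrs, hs⟩ hrs
  simp only at h1
  have hr1 : 0 < 1 - r := by linarith
  have hs1 : 0 < 1 - s := by linarith
  rw [Real.rpow_neg hr1.le, Real.rpow_neg hs1.le, ← div_eq_mul_inv, ← div_eq_mul_inv,
    div_le_div_iff₀ (by positivity) (by positivity)] at h1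
  rw [Real.div_rpow hr1.le hs1.le, div_mul_eq_mul_div, le_div_iff₀ (by positivity)]
  linarith

end Weight

/-- The tail integral of a radial weight. -/
def tailInt (w : ℝ → ℝ≥0∞) (s : ℝ) : ℝ≥0∞ := ∫⁻ r in Ioo s 1, w r

/-- Measurable weights on `[0, 1)` whose tail integrals are positive, finite, and doubling. -/
structure DoublingWeight (w : ℝ → ℝ≥0∞) (κ : ℝ) : Prop where
  measurable : Measurable w
  pos : 0 < κ
  tail_pos : ∀ s < 1, 0 < tailInt w s
  tail_lt_top : tailInt w 0 < ∞
  doubling : ∀ r s : ℝ, 0 ≤ r → r ≤ s → s < 1 →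
    tailInt w r ≤ ENNReal.ofReal (((1 - r) / (1 - s)) ^ κ) * tailInt w s

/-- The `ℝ≥0∞`-valued weight on `[0, 1)` associated with `ω`. -/
def extWeight (ω : ℝ → ℝ) : ℝ → ℝ≥0∞ := (Ico (0 : ℝ) 1).indicator fun r => ENNReal.ofReal (ω r)

lemma extWeight_of_mem {ω : ℝ → ℝ} {r : ℝ} (hr : r ∈ Ico (0 : ℝ) 1) :
    extWeight ω r = ENNReal.ofReal (ω r) := indicator_of_mem hr _

lemma IsRadialContinuousWeight.measurable_extWeight {ω : ℝ → ℝ} (h : IsRadialContinuousWeight ω) :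
    Measurable (extWeight ω) := by
  classical
  rw [extWeight, ← piecewise_eq_indicator]
  exact ContinuousOn.measurable_piecewise (ENNReal.continuous_ofReal.comp_continuousOn h.2)
    continuousOn_const measurableSet_Ico

lemma tailInt_extWeight {ω : ℝ → ℝ} (h : IsRadialWeight ω) {r : ℝ} (hr : r ∈ Ico (0 : ℝ) 1) :
    tailInt (extWeight ω) r = ENNReal.ofReal (wInt ω r) := by
  rw [wInt, intervalIntegral.integral_of_le hr.2.le, integral_Ioc_eq_integral_Ioo,
    ofReal_integral_eq_lintegral_ofReal]
  · exact setLIntegral_congr_fun measurableSet_Ioo fun s hs =>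
      extWeight_of_mem ⟨hr.1.trans hs.1.le, hs.2⟩
  · exact h.2.mono_set fun s hs => ⟨hr.1.trans hs.1.le, hs.2⟩
  · filter_upwards [ae_restrict_mem measurableSet_Ioo] with s hs
    exact (h.1 s ⟨hr.1.trans hs.1.le, hs.2⟩).le

lemma tailInt_anti (w : ℝ → ℝ≥0∞) : Antitone (tailInt w) := fun _ _ h =>
  lintegral_mono_set (Ioo_subset_Ioo_left h)

lemma exists_doublingWeight {ω : ℝ → ℝ} (hω : IsRegularWeight ω ∨ IsRapidlyIncreasing ω) :
    ∃ κ, DoublingWeight (extWeight ω) κ := by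
  have h : IsRadialContinuousWeight ω := hω.elim (fun h => h.1) fun h => h.1
  obtain ⟨κ, hκ0, hκ⟩ := exists_mul_le_wInt hω
  refine ⟨κ, h.measurable_extWeight, hκ0, fun s hs => ?_, ?_, fun r s hr hrs hs => ?_⟩
  · refine lt_of_lt_of_le ?_ (tailInt_anti _ (le_max_left s 0))
    rw [tailInt_extWeight h.1 ⟨le_max_right _ _, max_lt hs one_pos⟩, ENNReal.ofReal_pos]
    exact h.1.wInt_pos ⟨le_max_right _ _, max_lt hs one_pos⟩
  · rw [tailInt_extWeight h.1 ⟨le_rfl, one_pos⟩]; exact ENNReal.ofReal_lt_top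
  · rw [tailInt_extWeight h.1 ⟨hr, hrs.trans_lt hs⟩, tailInt_extWeight h.1 ⟨hr.trans hrs, hs⟩,
      ← ENNReal.ofReal_mul (Real.rpow_nonneg (div_nonneg (by linarith) (by linarith)) _)]
    exact ENNReal.ofReal_le_ofReal (wInt_doubling h hκ hr hrs hs)

lemma ofReal_wStar {ω : ℝ → ℝ} (h : IsRadialWeight ω) {z : ℂ} (hz : 0 < ‖z‖) (hz1 : ‖z‖ < 1) :
    ENNReal.ofReal (wStar ω z) = starWeight (extWeight ω) ‖z‖ := by
  set r := ‖z‖ with hr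
  rw [wStar, ← hr, intervalIntegral.integral_of_le hz1.le, integral_Ioc_eq_integral_Ioo,
    ofReal_integral_eq_lintegral_ofReal, starWeight]
  · refine setLIntegral_congr_fun measurableSet_Ioo fun s hs => ?_
    have hs' : s ∈ Ico (0 : ℝ) 1 := ⟨hz.le.trans hs.1.le, hs.2⟩
    rw [extWeight_of_mem hs', ← ENNReal.ofReal_mul (h.1 s hs').le]
    congr 1; ring
  · have h1 : IntegrableOn ω (Icc r 1) := by
      rw [integrableOn_Icc_iff_integrableOn_Ico]
      exact h.2.mono_set (Ico_subset_Ico_left hz.le)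
    have h2 : ContinuousOn (fun s => Real.log (s / r) * s) (Icc r 1) := by
      refine ContinuousOn.mul (ContinuousOn.log (by fun_prop) fun s hs => ?_) continuousOn_id
      exact (div_pos (hz.trans_le hs.1) hz).ne'
    have := (h1.mul_continuousOn h2 isCompact_Icc).mono_set Ioo_subset_Icc_self
    simp only [mul_assoc]
    exact this
  · filter_upwards [ae_restrict_mem measurableSet_Ioo] with s hs
    have hs0 : 0 < s := hz.trans hs.1
    have := h.1 s ⟨hs0.le, hs.2⟩
    have : 0 ≤ Real.log (s / r) := Real.log_nonneg (by rw [le_div_iff₀ hz]; linarith [hs.1])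
    simp only [Pi.zero_apply]
    positivity

/-- The measure on the unit disc with radial density `w`. -/
def radMeasure (w : ℝ → ℝ≥0∞) : Measure ℂ :=
  (volume.restrict unitDisc).withDensity fun z => w ‖z‖

lemma setLIntegral_withDensity_disc {ρ φ : ℂ → ℝ≥0∞} (hρ : Measurable ρ)
    {A : Set ℂ} (hA : MeasurableSet A) (hφ : Measurable ((unitDisc ∩ A).indicator φ)) :
    ∫⁻ z in A, φ z ∂(volume.restrict unitDisc).withDensity ρ = ∫⁻ z in unitDisc ∩ A, φ z * ρ z := by
  have hm := measurableSet_unitDisc.inter hA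
  rw [restrict_withDensity hA, Measure.restrict_restrict hA, inter_comm,
    lintegral_withDensity_eq_lintegral_mul₀ hρ.aemeasurable]
  · simp only [Pi.mul_apply, mul_comm]
  · refine ⟨(unitDisc ∩ A).indicator φ, hφ, ?_⟩
    refine (ae_restrict_iff' hm).2 (Eventually.of_forall fun z hz => ?_)
    rw [indicator_of_mem hz]

lemma measurableSet_CBox (θ h : ℝ) : MeasurableSet (CBox θ h) := by
  have h1 : Measurable fun z : ℂ => |Complex.arg (z * Complex.exp (-(θ : ℂ) * Complex.I))| :=
    (Complex.measurable_arg.comp (measurable_id.mul_const _)).abs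
  exact (measurableSet_le measurable_const measurable_norm).inter
    ((measurableSet_lt measurable_norm measurable_const).inter
      (measurableSet_le h1 measurable_const))

lemma CBox_subset (θ h : ℝ) : CBox θ h ⊆ unitDisc := fun _ hz => hz.2.1

lemma arg_polarPt {r θ : ℝ} (hr : 0 < r) (hθ : θ ∈ Ioo (-Real.pi) Real.pi) :
    Complex.arg (polarPt r θ) = θ := by
  rw [polarPt, Complex.arg_real_mul _ hr, Complex.arg_exp_mul_I, toIocMod_eq_self]
  constructor <;> linarith [hθ.1, hθ.2]

lemma withDensity_apply_CBox {ρ : ℂ → ℝ≥0∞} (θ h : ℝ) :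
    (volume.restrict unitDisc).withDensity ρ (CBox θ h) = ∫⁻ z in CBox θ h, ρ z := by
  rw [withDensity_apply _ (measurableSet_CBox θ h),
    Measure.restrict_restrict (measurableSet_CBox θ h), inter_eq_left.2 (CBox_subset θ h)]

lemma lintegral_CBox_rotate {w : ℝ → ℝ≥0∞} (θ h : ℝ) :
    ∫⁻ z in CBox θ h, w ‖z‖ = ∫⁻ z in CBox 0 h, w ‖z‖ := by
  have hT := (rotation (Circle.exp (-θ))).measurePreserving
  have h1 : rotation (Circle.exp (-θ)) ⁻¹' CBox 0 h = CBox θ h := by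
    ext z
    have hn : ‖Complex.exp ((-θ : ℝ) * Complex.I) * z‖ = ‖z‖ := by
      rw [norm_mul, Complex.norm_exp_ofReal_mul_I, one_mul]
    simp only [CBox, mem_preimage, mem_ofPred_eq, rotation_apply, Circle.coe_exp, hn]
    simp only [Complex.ofReal_neg, Complex.ofReal_zero, neg_zero, zero_mul, Complex.exp_zero,
      mul_one, mul_comm z]
  have h2 := hT.setLIntegral_comp_preimage_emb
    (rotation (Circle.exp (-θ))).toHomeomorph.measurableEmbedding (fun z => w ‖z‖) (CBox 0 h)
  rw [h1] at h2
  simpa only [LinearIsometryEquiv.norm_map] using h2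

lemma measurable_ofReal_mul {w : ℝ → ℝ≥0∞} (hw : Measurable w) :
    Measurable fun r => ENNReal.ofReal r * w r := ENNReal.measurable_ofReal.mul hw

lemma radMeasure_CBox {w : ℝ → ℝ≥0∞} (hw : Measurable w) (θ : ℝ) {h : ℝ}
    (h1 : h ≤ 2 * Real.pi) : radMeasure w (CBox θ h) =
      ENNReal.ofReal h * ∫⁻ r in Ioo (0 : ℝ) 1, (Ici (1 - h)).indicator
        (fun r => ENNReal.ofReal r * w r) r := by
  have hpi := Real.pi_pos
  rw [radMeasure, withDensity_apply_CBox, lintegral_CBox_rotate]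
  have e1 : ∫⁻ z in CBox 0 h, w ‖z‖ =
      ∫⁻ z in unitDisc, (CBox 0 h).indicator (fun z => w ‖z‖) z := by
    rw [lintegral_indicator (measurableSet_CBox 0 h),
      Measure.restrict_restrict (measurableSet_CBox 0 h), inter_eq_left.2 (CBox_subset 0 h)]
  have hwn : Measurable fun z : ℂ => w ‖z‖ := hw.comp measurable_norm
  rw [e1, lintegral_disc_polar ((hwn.indicator
    (measurableSet_CBox 0 h)).indicator measurableSet_unitDisc),
    ← lintegral_const_mul _ ((measurable_ofReal_mul hw).indicator measurableSet_Ici)]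
  refine setLIntegral_congr_fun measurableSet_Ioo fun r hr => ?_
  have hb : ∀ θ ∈ Ioo (-Real.pi) Real.pi, (CBox 0 h).indicator (fun z => w ‖z‖) (polarPt r θ) =
      (Ici (1 - h)).indicator w r * (Icc (-(h / 2)) (h / 2)).indicator 1 θ := by
    intro θ hθ
    have hmem : polarPt r θ ∈ CBox 0 h ↔ r ∈ Ici (1 - h) ∧ θ ∈ Icc (-(h / 2)) (h / 2) := by
      simp only [CBox, mem_ofPred_eq, norm_polarPt, abs_of_pos hr.1, Complex.ofReal_zero, neg_zero,
        zero_mul, Complex.exp_zero, mul_one, arg_polarPt hr.1 hθ, abs_le, mem_Icc, mem_Ici, hr.2,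
        true_and]
    by_cases hr' : r ∈ Ici (1 - h)
    · by_cases hθ' : θ ∈ Icc (-(h / 2)) (h / 2)
      · rw [indicator_of_mem (hmem.2 ⟨hr', hθ'⟩), indicator_of_mem hr', indicator_of_mem hθ',
          norm_polarPt, abs_of_pos hr.1]
        simp
      · rw [indicator_of_notMem fun h => hθ' (hmem.1 h).2, indicator_of_notMem hθ']
        simp
    · rw [indicator_of_notMem fun h => hr' (hmem.1 h).1, indicator_of_notMem hr']
      simp
  rw [setLIntegral_congr_fun measurableSet_Ioo hb, lintegral_const_mul _
    (measurable_one.indicator measurableSet_Icc), lintegral_indicator measurableSet_Icc,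
    Measure.restrict_restrict measurableSet_Icc]
  have e2 : ∫⁻ a in Icc (-(h / 2)) (h / 2) ∩ Ioo (-Real.pi) Real.pi, (1 : ℝ → ℝ≥0∞) a =
      ENNReal.ofReal h := by
    have : (Icc (-(h / 2)) (h / 2) ∩ Ioo (-Real.pi) Real.pi : Set ℝ) =ᵐ[volume]
        Ioo (-(h / 2)) (h / 2) := by
      have h2 : (Icc (-(h / 2)) (h / 2) ∩ Ioo (-Real.pi) Real.pi : Set ℝ) =ᵐ[volume]
        (Ioo (-(h / 2)) (h / 2) ∩ Ioo (-Real.pi) Real.pi : Set ℝ) :=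
        Ioo_ae_eq_Icc.symm.inter (ae_eq_refl _)
      rwa [inter_eq_left.2 (Ioo_subset_Ioo (by linarith) (by linarith))] at h2
    rw [setLIntegral_congr this]
    simp only [Pi.one_apply, lintegral_const, Measure.restrict_apply_univ, Real.volume_Ioo, one_mul]
    congr 1; ring
  rw [e2]
  by_cases hr' : r ∈ Ici (1 - h)
  · simp only [indicator_of_mem hr']; ring
  · simp only [indicator_of_notMem hr']; simp

/-- The size of the `w`-measure of a Carleson square of side `h`. -/
def boxSize (w : ℝ → ℝ≥0∞) (h : ℝ) : ℝ≥0∞ := ENNReal.ofReal h * tailInt w (max 0 (1 - h))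

lemma radMeasure_CBox_le {w : ℝ → ℝ≥0∞} (hw : Measurable w) (θ : ℝ) {h : ℝ}
    (h1 : h ≤ 2 * Real.pi) : radMeasure w (CBox θ h) ≤ boxSize w h := by
  have e : tailInt w (max 0 (1 - h)) = ∫⁻ r in Ico (max 0 (1 - h)) 1, w r :=
    setLIntegral_congr Ioo_ae_eq_Ico
  rw [radMeasure_CBox hw θ h1, boxSize, e,
    ← lintegral_indicator measurableSet_Ioo, ← lintegral_indicator measurableSet_Ico]
  gcongr with r
  by_cases hr : r ∈ Ioo (0 : ℝ) 1
  · rw [indicator_of_mem hr]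
    by_cases hr' : r ∈ Ici (1 - h)
    · rw [indicator_of_mem hr', indicator_of_mem (mem_Ico.2 ⟨max_le hr.1.le hr', hr.2⟩)]
      exact mul_le_of_le_one_left' (ENNReal.ofReal_le_one.2 hr.2.le)
    · rw [indicator_of_notMem hr']; exact zero_le
  · rw [indicator_of_notMem hr]; exact zero_le

namespace DoublingWeight

variable {w : ℝ → ℝ≥0∞} {κ : ℝ} (hw : DoublingWeight w κ)
include hw

lemma boxSize_le (θ : ℝ) {h : ℝ} (h0 : 0 < h) (h1 : h ≤ 2 * Real.pi) :
    boxSize w h ≤ ENNReal.ofReal (2 ^ (κ + 1)) * radMeasure w (CBox θ h) := by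
  set m := max (1 / 2) (1 - h) with hm
  have hm1 : m < 1 := max_lt (by norm_num) (by linarith)
  have e1 : ENNReal.ofReal (1 / 2) * tailInt w m ≤
      ∫⁻ r in Ioo (0 : ℝ) 1, (Ici (1 - h)).indicator (fun r => ENNReal.ofReal r * w r) r := by
    rw [tailInt, ← lintegral_const_mul _ hw.measurable]
    refine le_trans ?_ (lintegral_mono_set (Ioo_subset_Ioo_left (show (0 : ℝ) ≤ m by positivity)))
    refine setLIntegral_mono' measurableSet_Ioo fun r hr => ?_
    rw [indicator_of_mem (show r ∈ Ici (1 - h) from (le_max_right _ _).trans hr.1.le)]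
    gcongr
    exact (le_max_left _ _).trans hr.1.le
  have e2 : tailInt w (max 0 (1 - h)) ≤ ENNReal.ofReal (2 ^ κ) * tailInt w m := by
    refine (hw.doubling (max 0 (1 - h)) m (le_max_left _ _)
      (max_le_max (by norm_num) le_rfl) hm1).trans ?_
    gcongr ENNReal.ofReal ?_ * _
    have h2 : 0 < 1 - m := by linarith
    have h3 : 0 ≤ 1 - max 0 (1 - h) := by
      rw [sub_nonneg]; exact max_le zero_le_one (by linarith)
    refine Real.rpow_le_rpow (by positivity) ?_ hw.pos.le
    rw [div_le_iff₀ h2]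
    rcases le_total (1 / 2) (1 - h) with h4 | h4
    · rw [hm, max_eq_right h4, max_eq_right (by linarith)]; linarith
    · rw [hm, max_eq_left h4]
      have := le_max_left 0 (1 - h)
      linarith
  rw [radMeasure_CBox hw.measurable θ h1, boxSize]
  calc ENNReal.ofReal h * tailInt w (max 0 (1 - h))
      ≤ ENNReal.ofReal h * (ENNReal.ofReal (2 ^ κ) * tailInt w m) := by gcongr
    _ = ENNReal.ofReal (2 ^ (κ + 1)) *
        (ENNReal.ofReal h * (ENNReal.ofReal (1 / 2) * tailInt w m)) := by
      have : ENNReal.ofReal (2 ^ κ) = ENNReal.ofReal (2 ^ (κ + 1)) * ENNReal.ofReal (1 / 2) := by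
        rw [← ENNReal.ofReal_mul (by positivity), Real.rpow_add_one (by norm_num)]
        congr 1; ring
      rw [this]; ring
    _ ≤ _ := by gcongr

lemma boxSize_growth {h h' : ℝ} (h0 : 0 < h) (hh : h ≤ h') :
    boxSize w h' ≤ ENNReal.ofReal ((h' / h) ^ (κ + 1)) * boxSize w h := by
  have h0' := h0.trans_le hh
  have e2 : tailInt w (max 0 (1 - h')) ≤
      ENNReal.ofReal ((h' / h) ^ κ) * tailInt w (max 0 (1 - h)) := by
    have hm1 : max 0 (1 - h) < 1 := max_lt one_pos (by linarith)
    refine (hw.doubling (max 0 (1 - h')) (max 0 (1 - h)) (le_max_left _ _)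
      (max_le_max le_rfl (by linarith)) hm1).trans ?_
    gcongr ENNReal.ofReal ?_ * _
    have h2 : 0 < 1 - max 0 (1 - h) := by linarith
    have h3 : 0 ≤ 1 - max 0 (1 - h') := by
      rw [sub_nonneg]; exact max_le zero_le_one (by linarith)
    refine Real.rpow_le_rpow (by positivity) ?_ hw.pos.le
    rw [div_le_div_iff₀ h2 h0]
    rcases le_total 0 (1 - h) with h4 | h4
    · rw [max_eq_right h4]
      have := le_max_right 0 (1 - h')
      nlinarith
    · rw [max_eq_left h4, max_eq_left (by linarith)]; linarith
  calc boxSize w h' ≤ ENNReal.ofReal h' *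
        (ENNReal.ofReal ((h' / h) ^ κ) * tailInt w (max 0 (1 - h))) := by
        unfold boxSize; gcongr
    _ = _ := by
      have : ENNReal.ofReal h' = ENNReal.ofReal (h' / h) * ENNReal.ofReal h := by
        rw [← ENNReal.ofReal_mul (by positivity), div_mul_cancel₀ _ h0.ne']
      rw [boxSize, this, Real.rpow_add_one (by positivity), ENNReal.ofReal_mul (by positivity)]
      ring

end DoublingWeight

lemma sub_norm_eq (u : ℂ) : u - ‖u‖ = ‖u‖ * (Complex.exp (u.arg * Complex.I) - 1) := by
  have e := Complex.norm_mul_exp_arg_mul_I u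
  rw [mul_sub, e, mul_one]

lemma norm_sub_norm_eq (u : ℂ) : ‖u - ‖u‖‖ = ‖u‖ * ‖Complex.exp (u.arg * Complex.I) - 1‖ := by
  have h := congrArg norm (sub_norm_eq u)
  rwa [norm_mul, Complex.norm_real, norm_norm] at h

lemma norm_sub_norm_le_mul_abs_arg (u : ℂ) : ‖u - ‖u‖‖ ≤ ‖u‖ * |u.arg| := by
  have h : ‖Complex.exp (u.arg * Complex.I) - 1‖ ≤ |u.arg| := by
    have := Real.norm_exp_I_mul_ofReal_sub_one_le (x := u.arg)
    rwa [mul_comm, Real.norm_eq_abs] at this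
  rw [norm_sub_norm_eq]
  gcongr

lemma norm_mul_abs_arg_le (u : ℂ) : ‖u‖ * |u.arg| ≤ Real.pi / 2 * ‖u - ‖u‖‖ := by
  have h := Complex.angle_le_mul_norm_sub (x := Complex.exp (u.arg * Complex.I)) (y := 1)
    (Complex.norm_exp_ofReal_mul_I _) norm_one
  have h1 : InnerProductGeometry.angle (Complex.exp (u.arg * Complex.I)) 1 = |u.arg| := by
    rw [Complex.angle_one_right (Complex.exp_ne_zero _), Complex.arg_exp_mul_I,
      (toIocMod_eq_self Real.two_pi_pos).2]
    have := Complex.arg_mem_Ioc u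
    constructor <;> linarith [this.1, this.2]
  rw [h1] at h
  rw [norm_sub_norm_eq]
  nlinarith [norm_nonneg u]

lemma norm_rotate (z : ℂ) (θ : ℝ) : ‖z * Complex.exp (-(θ : ℂ) * Complex.I)‖ = ‖z‖ := by
  rw [norm_mul, ← Complex.ofReal_neg, Complex.norm_exp_ofReal_mul_I, mul_one]

lemma norm_rotate_sub (z a : ℂ) :
    ‖z * Complex.exp (-(a.arg : ℂ) * Complex.I) - ‖a‖‖ = ‖z - a‖ := by
  have h : (‖a‖ : ℂ) = a * Complex.exp (-(a.arg : ℂ) * Complex.I) := by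
    have e := Complex.norm_mul_exp_arg_mul_I a
    calc (‖a‖ : ℂ) = ‖a‖ * Complex.exp (a.arg * Complex.I) *
          Complex.exp (-(a.arg : ℂ) * Complex.I) := by
          rw [mul_assoc, ← Complex.exp_add]; simp
      _ = _ := by rw [e]
  rw [h, ← sub_mul, norm_rotate]

lemma CBox_subset_ball {a : ℂ} (ha : ‖a‖ < 1) {R h : ℝ} (hR : 2 * (1 - ‖a‖) ≤ R)
    (hh : h ≤ R / 3) : CBox a.arg h ⊆ Metric.ball a R := by
  rintro z ⟨h1, h2, h3⟩
  rw [Metric.mem_ball, dist_eq_norm, ← norm_rotate_sub]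
  set u := z * Complex.exp (-(a.arg : ℂ) * Complex.I) with hu
  have hnu : ‖u‖ = ‖z‖ := norm_rotate _ _
  have e1 : ‖u - ‖a‖‖ ≤ ‖u - ‖u‖‖ + |‖u‖ - ‖a‖| := by
    have := norm_add_le (u - ‖u‖) ((‖u‖ : ℂ) - ‖a‖)
    rwa [sub_add_sub_cancel, ← Complex.ofReal_sub, Complex.norm_real, Real.norm_eq_abs] at this
  have e2 := norm_sub_norm_le_mul_abs_arg u
  have e3 : ‖u‖ * |u.arg| ≤ 1 * (h / 2) := by
    gcongr
    rw [hnu]; exact h2.le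
  have e4 : |‖u‖ - ‖a‖| ≤ R / 2 := by
    rw [hnu, abs_le]; constructor <;> linarith
  linarith

lemma ball_subset_CBox {a : ℂ} (ha : ‖a‖ < 1) {R : ℝ} (hR : 2 * (1 - ‖a‖) ≤ R)
    (hR2 : 32 * R ≤ 2 * Real.pi) : Metric.ball a R ∩ unitDisc ⊆ CBox a.arg (32 * R) := by
  rintro z ⟨hz, hz1⟩
  have hz1 : ‖z‖ < 1 := hz1
  rw [Metric.mem_ball, dist_eq_norm, ← norm_rotate_sub] at hz
  have hpi := Real.pi_lt_d2
  set u := z * Complex.exp (-(a.arg : ℂ) * Complex.I) with hu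
  have hnu : ‖u‖ = ‖z‖ := norm_rotate _ _
  have e0 : |‖u‖ - ‖a‖| ≤ ‖u - ‖a‖‖ := by
    have := abs_norm_sub_norm_le u (‖a‖ : ℂ)
    rwa [Complex.norm_real, norm_norm] at this
  have e1 : ‖u - ‖u‖‖ ≤ ‖u - ‖a‖‖ + |‖u‖ - ‖a‖| := by
    have := norm_add_le (u - ‖a‖) ((‖a‖ : ℂ) - ‖u‖)
    rwa [sub_add_sub_cancel, ← Complex.ofReal_sub, Complex.norm_real, Real.norm_eq_abs,
      abs_sub_comm ‖a‖] at this
  have e2 := norm_mul_abs_arg_le u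
  have e3 := (abs_le.1 e0).1
  have hR0 : 0 < R := by linarith
  have hu1 : 1 / 2 ≤ ‖u‖ := by linarith
  refine ⟨by rw [← hnu]; linarith, hz1, ?_⟩
  have e4 : Real.pi / 2 * ‖u - ‖u‖‖ ≤ 3.15 / 2 * (2 * R) := by
    gcongr
    linarith
  have e5 : 1 / 2 * |u.arg| ≤ ‖u‖ * |u.arg| := by gcongr
  linarith

lemma CBox_two_pi (θ : ℝ) : CBox θ (2 * Real.pi) = unitDisc := by
  refine Subset.antisymm (CBox_subset _ _) fun z hz => ⟨?_, hz, ?_⟩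
  · linarith [Real.pi_gt_three, norm_nonneg z]
  · rw [mul_div_cancel_left₀ _ two_ne_zero]; exact Complex.abs_arg_le_pi _

lemma unitDisc_subset_ball {a : ℂ} (ha : ‖a‖ < 1) {R : ℝ} (hR : 2 ≤ R) :
    unitDisc ⊆ Metric.ball a R := by
  intro z hz
  have hz : ‖z‖ < 1 := hz
  rw [Metric.mem_ball, dist_eq_norm]
  linarith [norm_sub_le z a]

lemma boxSize_mono (w : ℝ → ℝ≥0∞) : Monotone (boxSize w) := by
  intro h h' hh
  unfold boxSize
  gcongr
  exact tailInt_anti w (max_le_max le_rfl (by linarith))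

lemma radMeasure_compl (w : ℝ → ℝ≥0∞) : radMeasure w unitDiscᶜ = 0 := by
  rw [radMeasure]
  refine withDensity_absolutelyContinuous _ _ ?_
  rw [Measure.restrict_apply measurableSet_unitDisc.compl, compl_inter_self, measure_empty]

lemma measure_le_inter_disc {μ : Measure ℂ} (hμ : μ unitDiscᶜ = 0) (A : Set ℂ) :
    μ A ≤ μ (A ∩ unitDisc) := by
  calc μ A ≤ μ ((A ∩ unitDisc) ∪ unitDiscᶜ) := measure_mono fun z hz => by
        by_cases h : z ∈ unitDisc
        · exact Or.inl ⟨hz, h⟩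
        · exact Or.inr h
    _ ≤ _ := (measure_union_le _ _).trans (by rw [hμ, add_zero])

namespace DoublingWeight

variable {w : ℝ → ℝ≥0∞} {κ : ℝ} (hw : DoublingWeight w κ)
include hw

lemma measure_ball_le {μ : Measure ℂ} (hμ : μ unitDiscᶜ = 0) {M : ℝ≥0∞}
    (hM : ∀ θ h, 0 < h → h ≤ 2 * Real.pi → μ (CBox θ h) ≤ M * boxSize w h)
    {a : ℂ} (ha : ‖a‖ < 1) {R : ℝ} (hR : 2 * (1 - ‖a‖) ≤ R) :
    μ (Metric.ball a R) ≤ M * (ENNReal.ofReal (32 ^ (κ + 1)) * boxSize w R) := by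
  have hR0 : 0 < R := by linarith
  have hpi := Real.pi_pos
  have hg : boxSize w (32 * R) ≤ ENNReal.ofReal (32 ^ (κ + 1)) * boxSize w R := by
    have := hw.boxSize_growth hR0 (show R ≤ 32 * R by linarith)
    rwa [mul_div_cancel_right₀ _ hR0.ne'] at this
  refine (measure_le_inter_disc hμ _).trans ?_
  rcases le_or_gt (32 * R) (2 * Real.pi) with h | h
  · calc _ ≤ μ (CBox a.arg (32 * R)) := measure_mono (ball_subset_CBox ha hR h)
      _ ≤ M * boxSize w (32 * R) := hM _ _ (by linarith) h
      _ ≤ _ := by gcongr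
  · calc _ ≤ μ (CBox 0 (2 * Real.pi)) :=
          measure_mono (by rw [CBox_two_pi]; exact inter_subset_right)
      _ ≤ M * boxSize w (2 * Real.pi) := hM _ _ (by linarith) le_rfl
      _ ≤ M * boxSize w (32 * R) := by gcongr; exact boxSize_mono w h.le
      _ ≤ _ := by gcongr

lemma boxSize_le_ball {a : ℂ} (ha : ‖a‖ < 1) {R : ℝ} (hR : 2 * (1 - ‖a‖) ≤ R) (hR2 : R ≤ 2) :
    boxSize w R ≤ ENNReal.ofReal (6 ^ (κ + 1)) * radMeasure w (Metric.ball a R) := by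
  have hR0 : 0 < R := by linarith
  have h1 : boxSize w R ≤ ENNReal.ofReal (3 ^ (κ + 1)) * boxSize w (R / 3) := by
    have := hw.boxSize_growth (show 0 < R / 3 by positivity) (show R / 3 ≤ R by linarith)
    rwa [div_div_cancel₀ hR0.ne'] at this
  refine h1.trans ?_
  have h2 := hw.boxSize_le a.arg (h := R / 3) (by positivity) (by linarith [Real.pi_gt_three])
  have h3 : radMeasure w (CBox a.arg (R / 3)) ≤ radMeasure w (Metric.ball a R) :=
    measure_mono (CBox_subset_ball ha hR le_rfl)
  calc _ ≤ ENNReal.ofReal (3 ^ (κ + 1)) * (ENNReal.ofReal (2 ^ (κ + 1)) *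
        radMeasure w (Metric.ball a R)) := by gcongr; exact h2.trans (by gcongr)
    _ = _ := by
      rw [← mul_assoc, ← ENNReal.ofReal_mul (by positivity),
        ← Real.mul_rpow (by norm_num) (by norm_num)]
      norm_num

/-- Growth of the measure of balls. -/
lemma ball_growth {a : ℂ} (ha : ‖a‖ < 1) {R R' : ℝ} (hR : 2 * (1 - ‖a‖) ≤ R) (hR2 : R ≤ 2)
    (hRR : R ≤ R') : radMeasure w (Metric.ball a R') ≤
      ENNReal.ofReal (192 ^ (κ + 1) * (R' / R) ^ (κ + 1)) * radMeasure w (Metric.ball a R) := by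
  have hR0 : 0 < R := by linarith
  have h1 := hw.measure_ball_le (radMeasure_compl w) (M := 1) (fun θ h h0 h1 => by
    rw [one_mul]; exact radMeasure_CBox_le hw.measurable θ h1) ha (hR.trans hRR)
  rw [one_mul] at h1
  calc _ ≤ ENNReal.ofReal (32 ^ (κ + 1)) * boxSize w R' := h1
    _ ≤ ENNReal.ofReal (32 ^ (κ + 1)) * (ENNReal.ofReal ((R' / R) ^ (κ + 1)) *
        (ENNReal.ofReal (6 ^ (κ + 1)) * radMeasure w (Metric.ball a R))) := by
      gcongr
      exact (hw.boxSize_growth hR0 hRR).trans (by gcongr; exact hw.boxSize_le_ball ha hR hR2)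
    _ = _ := by
      have hq : 0 ≤ R' / R := div_nonneg (hR0.le.trans hRR) hR0.le
      have : (192 : ℝ) ^ (κ + 1) = 32 ^ (κ + 1) * 6 ^ (κ + 1) := by
        rw [← Real.mul_rpow (by norm_num) (by norm_num)]; norm_num
      rw [this, ENNReal.ofReal_mul (by positivity), ENNReal.ofReal_mul (by positivity)]
      ring

lemma carleson_ball {μ : Measure ℂ} (hμ : μ unitDiscᶜ = 0) {M : ℝ≥0∞}
    (hM : ∀ θ h, 0 < h → h ≤ 2 * Real.pi → μ (CBox θ h) ≤ M * radMeasure w (CBox θ h))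
    {a : ℂ} (ha : ‖a‖ < 1) {R : ℝ} (hR : 2 * (1 - ‖a‖) ≤ R) :
    μ (Metric.ball a R) ≤ M * ENNReal.ofReal (192 ^ (κ + 1)) * radMeasure w (Metric.ball a R) := by
  have main : ∀ R, 2 * (1 - ‖a‖) ≤ R → R ≤ 2 → μ (Metric.ball a R) ≤
      M * ENNReal.ofReal (192 ^ (κ + 1)) * radMeasure w (Metric.ball a R) := by
    intro R hR hR2
    refine (hw.measure_ball_le hμ (fun θ h h0 h1 => (hM θ h h0 h1).trans (by
      gcongr; exact radMeasure_CBox_le hw.measurable θ h1)) ha hR).trans ?_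
    rw [mul_assoc]
    refine mul_le_mul' le_rfl ?_
    have : (192 : ℝ) ^ (κ + 1) = 32 ^ (κ + 1) * 6 ^ (κ + 1) := by
      rw [← Real.mul_rpow (by norm_num) (by norm_num)]; norm_num
    rw [this, ENNReal.ofReal_mul (by positivity), mul_assoc]
    gcongr
    exact hw.boxSize_le_ball ha hR hR2
  rcases le_total R 2 with h | h
  · exact main R hR h
  · calc μ (Metric.ball a R) ≤ μ (Metric.ball a R ∩ unitDisc) := measure_le_inter_disc hμ _
      _ ≤ μ (Metric.ball a 2) :=
        measure_mono (inter_subset_right.trans (unitDisc_subset_ball ha le_rfl))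
      _ ≤ _ := main 2 (by linarith [norm_nonneg a]) le_rfl
      _ ≤ _ := by gcongr

end DoublingWeight

/-- The kernel `ζ ↦ (1 - |a|²) / (1 - ā ζ)`. -/
def diskKer (a ζ : ℂ) : ℂ := (1 - (‖a‖ : ℂ) ^ 2) / (1 - conj a * ζ)

lemma one_sub_conj_mul_ne_zero {a ζ : ℂ} (ha : ‖a‖ < 1) (hζ : ζ ∈ unitDisc) :
    1 - conj a * ζ ≠ 0 := by
  have hζ : ‖ζ‖ < 1 := hζ
  intro h
  have h1 : ‖conj a * ζ‖ = 1 := by rw [← sub_eq_zero.1 h, norm_one]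
  rw [norm_mul, Complex.norm_conj] at h1
  nlinarith [norm_nonneg a, norm_nonneg ζ]

lemma differentiableOn_diskKer {a : ℂ} (ha : ‖a‖ < 1) :
    DifferentiableOn ℂ (diskKer a) unitDisc := by
  unfold diskKer
  refine DifferentiableOn.div (by fun_prop) (by fun_prop) fun z hz => one_sub_conj_mul_ne_zero ha hz

lemma diskKer_numerator_norm {a : ℂ} (ha : ‖a‖ < 1) :
    ‖(1 : ℂ) - (‖a‖ : ℂ) ^ 2‖ = 1 - ‖a‖ ^ 2 := by
  have : (1 : ℂ) - (‖a‖ : ℂ) ^ 2 = ((1 - ‖a‖ ^ 2 : ℝ) : ℂ) := by push_cast; rfl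
  rw [this, Complex.norm_real, Real.norm_of_nonneg]
  nlinarith [norm_nonneg a]

lemma norm_diskKer {a : ℂ} (ha : ‖a‖ < 1) (ζ : ℂ) :
    ‖diskKer a ζ‖ = (1 - ‖a‖ ^ 2) / ‖1 - conj a * ζ‖ := by
  rw [diskKer, norm_div, diskKer_numerator_norm ha]

lemma norm_diskKer_pos {a ζ : ℂ} (ha : ‖a‖ < 1) (hζ : ζ ∈ unitDisc) : 0 < ‖diskKer a ζ‖ := by
  rw [norm_diskKer ha]
  have := norm_pos_iff.2 (one_sub_conj_mul_ne_zero ha hζ)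
  have : 0 < 1 - ‖a‖ ^ 2 := by nlinarith [norm_nonneg a]
  positivity

lemma diskKer_self {a : ℂ} (ha : ‖a‖ < 1) : diskKer a a = 1 := by
  have h : conj a * a = (‖a‖ : ℂ) ^ 2 := by
    rw [mul_comm, Complex.mul_conj, Complex.normSq_eq_norm_sq]; push_cast; rfl
  have := one_sub_conj_mul_ne_zero ha ha
  rw [diskKer, ← h]
  exact div_self this

lemma norm_diskKer_le_two {a ζ : ℂ} (ha : ‖a‖ < 1) (hζ : ζ ∈ unitDisc) : ‖diskKer a ζ‖ ≤ 2 := by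
  have h0 := norm_pos_iff.2 (one_sub_conj_mul_ne_zero ha hζ)
  have hζ : ‖ζ‖ < 1 := hζ
  rw [norm_diskKer ha, div_le_iff₀ h0]
  have h1 : 1 - ‖a‖ * ‖ζ‖ ≤ ‖1 - conj a * ζ‖ := by
    have := norm_sub_norm_le (1 : ℂ) (conj a * ζ)
    rwa [norm_one, norm_mul, Complex.norm_conj] at this
  nlinarith [norm_nonneg a, norm_nonneg ζ]

lemma norm_diskKer_mul_le {a ζ : ℂ} (ha : ‖a‖ < 1) (hζ : ζ ∈ unitDisc) :
    ‖diskKer a ζ‖ * ‖ζ - a‖ ≤ 2 * (1 - ‖a‖) := by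
  have h0 := norm_pos_iff.2 (one_sub_conj_mul_ne_zero ha hζ)
  have hζ : ‖ζ‖ < 1 := hζ
  have h1 : ‖ζ - a‖ ≤ ‖1 - conj a * ζ‖ := by
    refine abs_le_of_sq_le_sq' ?_ (norm_nonneg _) |>.2
    have e : ‖1 - conj a * ζ‖ ^ 2 = ‖ζ - a‖ ^ 2 + (1 - ‖a‖ ^ 2) * (1 - ‖ζ‖ ^ 2) := by
      simp only [← Complex.normSq_eq_norm_sq, Complex.normSq_apply]
      simp
      ring
    rw [e]
    have : 0 ≤ (1 - ‖a‖ ^ 2) * (1 - ‖ζ‖ ^ 2) :=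
      mul_nonneg (by nlinarith [norm_nonneg a]) (by nlinarith [norm_nonneg ζ])
    linarith
  have h2 : 0 ≤ 1 - ‖a‖ ^ 2 := by nlinarith [norm_nonneg a]
  rw [norm_diskKer ha, div_mul_eq_mul_div, div_le_iff₀ h0]
  calc (1 - ‖a‖ ^ 2) * ‖ζ - a‖ ≤ (1 - ‖a‖ ^ 2) * ‖1 - conj a * ζ‖ := by gcongr
    _ ≤ _ := by gcongr; nlinarith [norm_nonneg a]

/-- Dyadic majorant of powers of the kernel. -/
lemma norm_diskKer_rpow_le {a ζ : ℂ} (ha : ‖a‖ < 1) (hζ : ζ ∈ unitDisc) {γ : ℝ} (hγ : 0 ≤ γ) :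
    ENNReal.ofReal (‖diskKer a ζ‖ ^ γ) ≤
      ∑' j : ℕ, (Metric.ball a (2 ^ j * (2 * (1 - ‖a‖)))).indicator
        (fun _ => ENNReal.ofReal ((2 * (1 / 2) ^ j) ^ γ)) ζ := by
  have hd : 0 < 1 - ‖a‖ := by linarith
  have hex : ∃ j : ℕ, ζ ∈ Metric.ball a (2 ^ j * (2 * (1 - ‖a‖))) := by
    obtain ⟨j, hj⟩ := pow_unbounded_of_one_lt (‖ζ - a‖ / (2 * (1 - ‖a‖))) one_lt_two
    refine ⟨j, ?_⟩
    rw [Metric.mem_ball, dist_eq_norm]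
    exact (div_lt_iff₀ (by positivity)).1 hj
  classical
  have hmem := Nat.find_spec hex
  have hmin : ∀ m < Nat.find hex, _ := fun m hm => Nat.find_min hex hm
  set j := Nat.find hex
  refine le_trans ?_ (ENNReal.le_tsum j)
  rw [indicator_of_mem hmem]
  refine ENNReal.ofReal_le_ofReal (Real.rpow_le_rpow (norm_nonneg _) ?_ hγ)
  rcases Nat.eq_zero_or_pos j with h | h
  · rw [h]; simpa using norm_diskKer_le_two ha hζ
  · have h1 := hmin (j - 1) (by omega)
    rw [Metric.mem_ball, dist_eq_norm, not_lt] at h1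
    have h2 := norm_diskKer_mul_le ha hζ
    obtain ⟨i, hi⟩ : ∃ i, j = i + 1 := ⟨j - 1, by omega⟩
    rw [hi, Nat.add_sub_cancel] at h1
    rw [hi, pow_succ]
    have h3 : ‖diskKer a ζ‖ * (2 ^ i * (2 * (1 - ‖a‖))) ≤ 2 * (1 - ‖a‖) :=
      (mul_le_mul_of_nonneg_left h1 (norm_nonneg _)).trans h2
    have h4 : ‖diskKer a ζ‖ * 2 ^ i ≤ 1 := by
      rw [← mul_assoc] at h3
      exact le_of_mul_le_mul_right (by linarith) (show 0 < 2 * (1 - ‖a‖) by positivity)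
    have h5 : (1 / 2 : ℝ) ^ i * 2 ^ i = 1 := by rw [← mul_pow]; norm_num
    have h6 : (0 : ℝ) < (1 / 2) ^ i := by positivity
    calc ‖diskKer a ζ‖ = (‖diskKer a ζ‖ * 2 ^ i) * (1 / 2) ^ i := by
          rw [mul_assoc, mul_comm (2 ^ i), h5, mul_one]
      _ ≤ 1 * (1 / 2) ^ i := by gcongr
      _ = _ := by ring

lemma ae_mem_unitDisc (w : ℝ → ℝ≥0∞) : ∀ᵐ z ∂radMeasure w, z ∈ unitDisc :=
  radMeasure_compl w

namespace DoublingWeight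

variable {w : ℝ → ℝ≥0∞} {κ : ℝ} (hw : DoublingWeight w κ)
include hw

lemma radMeasure_univ_lt_top : radMeasure w univ < ∞ := by
  have h1 : radMeasure w univ ≤ radMeasure w (CBox 0 (2 * Real.pi)) := by
    rw [CBox_two_pi]; simpa using measure_le_inter_disc (radMeasure_compl w) univ
  refine (h1.trans (radMeasure_CBox_le hw.measurable 0 le_rfl)).trans_lt ?_
  rw [boxSize, max_eq_left (by linarith [Real.pi_gt_three])]
  exact ENNReal.mul_lt_top ENNReal.ofReal_lt_top hw.tail_lt_top

lemma lintegral_mul_diskKer_le {φ : ℂ → ℝ≥0∞} (hφ : Measurable φ) {a : ℂ} (ha : ‖a‖ < 1)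
    {N : ℝ≥0∞} (hN : ∀ R, 2 * (1 - ‖a‖) ≤ R → R ≤ 2 →
      ∫⁻ z in Metric.ball a R, φ z ∂radMeasure w ≤ N * radMeasure w (Metric.ball a R))
    {γ : ℝ} (hγ : κ + 2 ≤ γ) :
    ∫⁻ z, φ z * ENNReal.ofReal (‖diskKer a z‖ ^ γ) ∂radMeasure w ≤
      ENNReal.ofReal (2 ^ γ * 192 ^ (κ + 1) * 2) * N *
        radMeasure w (Metric.ball a (2 * (1 - ‖a‖))) := by
  have hκ := hw.pos
  have hd : 0 < 1 - ‖a‖ := by linarith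
  have hd2 : 2 * (1 - ‖a‖) ≤ 2 := by linarith [norm_nonneg a]
  set ν := radMeasure w
  have hN' : ∀ R, 2 * (1 - ‖a‖) ≤ R →
      ∫⁻ z in Metric.ball a R, φ z ∂ν ≤ N * ν (Metric.ball a R) := by
    intro R hR
    rcases le_total R 2 with h | h
    · exact hN R hR h
    · have : ν.restrict (Metric.ball a R) = ν.restrict (Metric.ball a 2) := by
        refine Measure.restrict_congr_set ?_
        filter_upwards [ae_mem_unitDisc w] with z hz
        exact propext ⟨fun _ => unitDisc_subset_ball ha le_rfl hz,
          fun _ => unitDisc_subset_ball ha h hz⟩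
      rw [this]
      refine (hN 2 hd2 le_rfl).trans ?_
      gcongr
  calc ∫⁻ z, φ z * ENNReal.ofReal (‖diskKer a z‖ ^ γ) ∂ν
      ≤ ∫⁻ z, ∑' j : ℕ, φ z * (Metric.ball a (2 ^ j * (2 * (1 - ‖a‖)))).indicator
        (fun _ => ENNReal.ofReal ((2 * (1 / 2) ^ j) ^ γ)) z ∂ν := by
        refine lintegral_mono_ae ?_
        filter_upwards [ae_mem_unitDisc w] with z hz
        rw [ENNReal.tsum_mul_left]
        exact mul_le_mul' le_rfl (norm_diskKer_rpow_le ha hz (by linarith))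
    _ = ∑' j : ℕ, ∫⁻ z, φ z * (Metric.ball a (2 ^ j * (2 * (1 - ‖a‖)))).indicator
        (fun _ => ENNReal.ofReal ((2 * (1 / 2) ^ j) ^ γ)) z ∂ν := by
        refine lintegral_tsum fun j => (hφ.mul ?_).aemeasurable
        exact measurable_const.indicator Metric.isOpen_ball.measurableSet
    _ ≤ ∑' j : ℕ, ENNReal.ofReal (2 ^ γ * 192 ^ (κ + 1)) * N *
        ν (Metric.ball a (2 * (1 - ‖a‖))) * 2⁻¹ ^ j := by
        refine ENNReal.tsum_le_tsum fun j => ?_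
        have hj : (1 : ℝ) ≤ 2 ^ j := one_le_pow₀ one_le_two
        have hRj : 2 * (1 - ‖a‖) ≤ 2 ^ j * (2 * (1 - ‖a‖)) := by nlinarith
        have e1 : ∫⁻ z, φ z * (Metric.ball a (2 ^ j * (2 * (1 - ‖a‖)))).indicator
            (fun _ => ENNReal.ofReal ((2 * (1 / 2) ^ j) ^ γ)) z ∂ν =
            ENNReal.ofReal ((2 * (1 / 2) ^ j) ^ γ) *
              ∫⁻ z in Metric.ball a (2 ^ j * (2 * (1 - ‖a‖))), φ z ∂ν := by
          rw [← lintegral_indicator Metric.isOpen_ball.measurableSet,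
            ← lintegral_const_mul _ (hφ.indicator Metric.isOpen_ball.measurableSet)]
          refine lintegral_congr fun z => ?_
          by_cases hz : z ∈ Metric.ball a (2 ^ j * (2 * (1 - ‖a‖)))
          · simp only [indicator_of_mem hz]; ring
          · simp only [indicator_of_notMem hz, mul_zero]
        have e2 := hw.ball_growth ha le_rfl hd2 hRj
        rw [mul_div_cancel_right₀ _ (by positivity)] at e2
        have e3 : (2 * (1 / 2 : ℝ) ^ j) ^ γ * (192 ^ (κ + 1) * (2 ^ j) ^ (κ + 1)) ≤
            2 ^ γ * 192 ^ (κ + 1) * (1 / 2) ^ j := by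
          rw [Real.mul_rpow (by norm_num) (by positivity)]
          have h1 : ((1 / 2 : ℝ) ^ j) ^ γ ≤ ((1 / 2 : ℝ) ^ j) ^ (κ + 2) :=
            Real.rpow_le_rpow_of_exponent_ge (by positivity)
              (pow_le_one₀ (by norm_num) (by norm_num)) hγ
          have h2 : ((1 / 2 : ℝ) ^ j) ^ (κ + 2) * (2 ^ j) ^ (κ + 1) = (1 / 2) ^ j := by
            rw [show κ + 2 = (κ + 1) + 1 by ring, Real.rpow_add (by positivity), Real.rpow_one,
              mul_right_comm, ← Real.mul_rpow (by positivity) (by positivity), ← mul_pow]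
            norm_num
          calc _ ≤ 2 ^ γ * ((1 / 2 : ℝ) ^ j) ^ (κ + 2) * (192 ^ (κ + 1) * (2 ^ j) ^ (κ + 1)) := by
                gcongr
            _ = 2 ^ γ * 192 ^ (κ + 1) * (((1 / 2 : ℝ) ^ j) ^ (κ + 2) * (2 ^ j) ^ (κ + 1)) := by ring
            _ = _ := by rw [h2]
        have e4 : (2⁻¹ : ℝ≥0∞) ^ j = ENNReal.ofReal ((1 / 2) ^ j) := by
          rw [ENNReal.ofReal_pow (by norm_num), one_div, ENNReal.ofReal_inv_of_pos two_pos]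
          norm_num
        rw [e1, e4]
        calc _ ≤ ENNReal.ofReal ((2 * (1 / 2) ^ j) ^ γ) * (N *
              (ENNReal.ofReal (192 ^ (κ + 1) * (2 ^ j) ^ (κ + 1)) *
                ν (Metric.ball a (2 * (1 - ‖a‖))))) :=
              mul_le_mul' le_rfl ((hN' _ hRj).trans (mul_le_mul' le_rfl e2))
          _ = ENNReal.ofReal ((2 * (1 / 2 : ℝ) ^ j) ^ γ * (192 ^ (κ + 1) * (2 ^ j) ^ (κ + 1))) *
              (N * ν (Metric.ball a (2 * (1 - ‖a‖)))) := by
              rw [ENNReal.ofReal_mul (p := (2 * (1 / 2 : ℝ) ^ j) ^ γ) (by positivity)]; ring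
          _ ≤ ENNReal.ofReal (2 ^ γ * 192 ^ (κ + 1) * (1 / 2) ^ j) *
              (N * ν (Metric.ball a (2 * (1 - ‖a‖)))) := by gcongr
          _ = _ := by rw [ENNReal.ofReal_mul (by positivity)]; ring
    _ = _ := by
        rw [ENNReal.tsum_mul_left, ENNReal.tsum_geometric, ENNReal.one_sub_inv_two, inv_inv,
          ENNReal.ofReal_mul (p := 2 ^ γ * 192 ^ (κ + 1)) (by positivity)]
        norm_num
        ring

end DoublingWeight

/-- The function `|f|^α`, extended by zero outside of the disc. -/
def absPow (f : ℂ → ℂ) (α : ℝ) : ℂ → ℝ≥0∞ :=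
  unitDisc.indicator fun z => ENNReal.ofReal (‖f z‖ ^ α)

lemma measurable_absPow {f : ℂ → ℂ} (hf : DifferentiableOn ℂ f unitDisc) {α : ℝ} (hα : 0 < α) :
    Measurable (absPow f α) :=
  measurable_indicator_of_continuousOn (continuousOn_norm_rpow hf hα)

lemma lintegral_absPow_eq {w : ℝ → ℝ≥0∞} (hw : Measurable w) {φ : ℂ → ℝ≥0∞}
    (hφ : Measurable (unitDisc.indicator φ)) :
    ∫⁻ z in unitDisc, φ z * w ‖z‖ = ∫⁻ z, unitDisc.indicator φ z ∂radMeasure w := by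
  have h := setLIntegral_withDensity_disc (A := univ) (φ := unitDisc.indicator φ)
    (hw.comp measurable_norm) MeasurableSet.univ
    (by rw [inter_univ, indicator_indicator, inter_self]; exact hφ)
  rw [setLIntegral_univ, inter_univ] at h
  refine Eq.trans ?_ h.symm
  refine setLIntegral_congr_fun measurableSet_unitDisc fun z hz => ?_
  simp only [indicator_of_mem hz, Function.comp]

lemma continuousOn_ofReal_indicator {u : ℂ → ℝ} (hu : ContinuousOn u unitDisc) :
    Measurable (unitDisc.indicator u) := by
  classical
  rw [← piecewise_eq_indicator]
  exact ContinuousOn.measurable_piecewise hu continuousOn_const measurableSet_unitDisc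

namespace DoublingWeight

variable {w : ℝ → ℝ≥0∞} {κ : ℝ} (hw : DoublingWeight w κ)
include hw

lemma boxSize_le_tailInt {d : ℝ} (hd : 0 < d) (hd1 : d ≤ 1) :
    boxSize w (2 * d) ≤
      ENNReal.ofReal (4 ^ (κ + 1)) * (ENNReal.ofReal (d / 2) * tailInt w (1 - d / 2)) := by
  have h := hw.boxSize_growth (show 0 < d / 2 by positivity) (show d / 2 ≤ 2 * d by linarith)
  have e : 2 * d / (d / 2) = 4 := by field_simp; norm_num
  rw [e] at h
  rwa [boxSize, boxSize, max_eq_right (show (0 : ℝ) ≤ 1 - d / 2 by linarith)] at h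

lemma tailInt_lt_top {s : ℝ} (hs : 0 ≤ s) : tailInt w s < ∞ :=
  (tailInt_anti w hs).trans_lt hw.tail_lt_top

/-- A function whose `α`-averages over large balls around `a` are bounded is bounded at `a`. -/
lemma exists_norm_rpow_le_of_averages {α : ℝ} (hα : 0 < α) :
    ∃ C : ℝ, 0 < C ∧ ∀ f : ℂ → ℂ, DifferentiableOn ℂ f unitDisc → ∀ a, ‖a‖ < 1 → ∀ N : ℝ≥0∞,
      (∀ R, 2 * (1 - ‖a‖) ≤ R → R ≤ 2 →
        ∫⁻ z in Metric.ball a R, absPow f α z ∂radMeasure w ≤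
          N * radMeasure w (Metric.ball a R)) →
      ENNReal.ofReal (‖f a‖ ^ α) ≤ ENNReal.ofReal C * N := by
  have hκ := hw.pos
  have hpi := Real.pi_pos
  obtain ⟨m, hm⟩ := exists_nat_ge ((κ + 2) / α)
  have hγ : κ + 2 ≤ m * α := (div_le_iff₀ hα).1 hm
  set A : ℝ := 2 ^ (m * α) * 192 ^ (κ + 1) * 2 with hA
  refine ⟨8 / Real.pi * (A * 32 ^ (κ + 1) * 4 ^ (κ + 1) * (1 / 2)), by positivity,
    fun f hf a ha N hN => ?_⟩
  have hd : 0 < 1 - ‖a‖ := by linarith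
  have hd1 : 1 - ‖a‖ ≤ 1 := by linarith [norm_nonneg a]
  have hF : DifferentiableOn ℂ (fun z => f z * diskKer a z ^ m) unitDisc :=
    hf.mul ((differentiableOn_diskKer ha).pow m)
  have h1 := norm_rpow_le_lintegral hF hα (a := a) ha hw.measurable
  rw [diskKer_self ha, one_pow, mul_one] at h1
  have h2 := hw.lintegral_mul_diskKer_le (measurable_absPow hf hα) ha hN hγ
  rw [lintegral_absPow_eq hw.measurable
    (measurable_indicator_of_continuousOn (continuousOn_norm_rpow hF hα))] at h1
  have h3 : ∫⁻ z, unitDisc.indicator (fun z => ENNReal.ofReal (‖f z * diskKer a z ^ m‖ ^ α)) z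
      ∂radMeasure w = ∫⁻ z, absPow f α z * ENNReal.ofReal (‖diskKer a z‖ ^ (m * α))
      ∂radMeasure w := by
    refine lintegral_congr fun z => ?_
    by_cases hz : z ∈ unitDisc
    · rw [absPow, indicator_of_mem hz, indicator_of_mem hz, ← ENNReal.ofReal_mul (by positivity),
        norm_mul, norm_pow, Real.mul_rpow (by positivity) (by positivity), Real.rpow_mul
        (by positivity), Real.rpow_natCast]
    · rw [absPow, indicator_of_notMem hz, indicator_of_notMem hz, zero_mul]
  rw [h3] at h1
  have h4 := hw.measure_ball_le (radMeasure_compl w) (M := 1) (fun θ h h0 h1 => by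
    rw [one_mul]; exact radMeasure_CBox_le hw.measurable θ h1) ha le_rfl
  rw [one_mul] at h4
  have h5 := hw.boxSize_le_tailInt hd hd1
  have e6 : 1 - (1 - ‖a‖) / 2 = (1 + ‖a‖) / 2 := by ring
  rw [e6] at h5
  have hT0 := hw.tail_pos ((1 + ‖a‖) / 2) (by linarith)
  have hT1 := hw.tailInt_lt_top (s := (1 + ‖a‖) / 2) (by linarith)
  set T := tailInt w ((1 + ‖a‖) / 2) with hT
  have h7 : ENNReal.ofReal (Real.pi / 8 * ((1 - ‖a‖) * ‖f a‖ ^ α)) * T ≤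
      ENNReal.ofReal A * N * (ENNReal.ofReal (32 ^ (κ + 1)) *
        (ENNReal.ofReal (4 ^ (κ + 1)) * (ENNReal.ofReal ((1 - ‖a‖) / 2) * T))) :=
    h1.trans (h2.trans (mul_le_mul' le_rfl (h4.trans (mul_le_mul' le_rfl h5))))
  have h8 : (ENNReal.ofReal (Real.pi / 8 * (1 - ‖a‖)) * T) * ENNReal.ofReal (‖f a‖ ^ α) ≤
      (ENNReal.ofReal (Real.pi / 8 * (1 - ‖a‖)) * T) *
        (ENNReal.ofReal (8 / Real.pi * (A * 32 ^ (κ + 1) * 4 ^ (κ + 1) * (1 / 2))) * N) := by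
    calc _ = ENNReal.ofReal (Real.pi / 8 * ((1 - ‖a‖) * ‖f a‖ ^ α)) * T := by
          rw [mul_right_comm, ← ENNReal.ofReal_mul (by positivity), mul_assoc (Real.pi / 8)]
      _ ≤ _ := h7
      _ = ENNReal.ofReal (A * 32 ^ (κ + 1) * 4 ^ (κ + 1) * ((1 - ‖a‖) / 2)) * (T * N) := by
          rw [ENNReal.ofReal_mul (p := A * 32 ^ (κ + 1) * 4 ^ (κ + 1)) (by positivity),
            ENNReal.ofReal_mul (p := A * 32 ^ (κ + 1)) (by positivity),
            ENNReal.ofReal_mul (p := A) (by positivity)]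
          ring
      _ = ENNReal.ofReal (Real.pi / 8 * (1 - ‖a‖) * (8 / Real.pi * (A * 32 ^ (κ + 1) *
            4 ^ (κ + 1) * (1 / 2)))) * (T * N) := by
          congr 2
          field_simp
      _ = _ := by rw [ENNReal.ofReal_mul (by positivity)]; ring
  refine (ENNReal.mul_le_mul_iff_right ?_ ?_).1 h8
  · refine mul_ne_zero ?_ hT0.ne'
    exact (ENNReal.ofReal_pos.2 (by positivity)).ne'
  · exact ENNReal.mul_ne_top ENNReal.ofReal_ne_top hT1.ne

/-- Weak-type estimate for measures satisfying the Carleson condition on balls. -/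
lemma exists_weak_type {μ : Measure ℂ} {M : ℝ}
    (hμ : ∀ a : ℂ, ‖a‖ < 1 → ∀ R, 2 * (1 - ‖a‖) ≤ R → μ (Metric.ball a R) ≤
      ENNReal.ofReal M * radMeasure w (Metric.ball a R)) {α : ℝ} (hα : 0 < α) :
    ∃ C K : ℝ, 0 < C ∧ 0 < K ∧ ∀ f : ℂ → ℂ, DifferentiableOn ℂ f unitDisc → ∀ t : ℝ, 0 < t →
      ENNReal.ofReal t * μ {z | z ∈ unitDisc ∧ C * t < ‖f z‖ ^ α} ≤ ENNReal.ofReal K *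
        ∫⁻ z in {z | ENNReal.ofReal t < absPow f α z}, absPow f α z ∂radMeasure w := by
  have hκ := hw.pos
  obtain ⟨C, hC, hCf⟩ := hw.exists_norm_rpow_le_of_averages hα
  have : IsFiniteMeasure (radMeasure w) := ⟨hw.radMeasure_univ_lt_top⟩
  refine ⟨C * 2, (max M 1) * (192 ^ (κ + 1) * 5 ^ (κ + 1)), by positivity, by positivity,
    fun f hf t ht => ?_⟩
  have hφ := measurable_absPow hf hα
  set φ := absPow f α
  set ν := radMeasure w
  set E : Set ℂ := {z | ENNReal.ofReal t < φ z}
  have hE : MeasurableSet E := measurableSet_lt measurable_const hφ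
  set A : Set ℂ := {z | z ∈ unitDisc ∧ C * 2 * t < ‖f z‖ ^ α} with hA
  have hex : ∀ a ∈ A, ∃ R, 2 * (1 - ‖a‖) ≤ R ∧ R ≤ 2 ∧
      ENNReal.ofReal (2 * t) * ν (Metric.ball a R) < ∫⁻ z in Metric.ball a R, φ z ∂ν := by
    rintro a ⟨ha, hat⟩
    by_contra! hcon
    have := hCf f hf a ha (ENNReal.ofReal (2 * t)) hcon
    rw [← ENNReal.ofReal_mul hC.le, ENNReal.ofReal_le_ofReal_iff (by positivity)] at this
    linarith
  have hex' : ∀ a : ℂ, ∃ R, a ∈ A → 2 * (1 - ‖a‖) ≤ R ∧ R ≤ 2 ∧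
      ENNReal.ofReal (2 * t) * ν (Metric.ball a R) < ∫⁻ z in Metric.ball a R, φ z ∂ν := by
    intro a
    by_cases ha : a ∈ A
    · obtain ⟨R, h⟩ := hex a ha; exact ⟨R, fun _ => h⟩
    · exact ⟨0, fun h => absurd h ha⟩
  choose R hR using hex'
  have hball : ∀ a ∈ A, ENNReal.ofReal t * ν (Metric.ball a (R a)) ≤
      ∫⁻ z in Metric.ball a (R a) ∩ E, φ z ∂ν := by
    intro a ha
    have h1 := (hR a ha).2.2.le
    have h2 : ∫⁻ z in Metric.ball a (R a), φ z ∂ν ≤ (∫⁻ z in Metric.ball a (R a) ∩ E, φ z ∂ν) +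
        ENNReal.ofReal t * ν (Metric.ball a (R a)) := by
      rw [← lintegral_inter_add_sdiff φ (Metric.ball a (R a)) hE]
      gcongr
      calc ∫⁻ z in Metric.ball a (R a) \ E, φ z ∂ν
          ≤ ∫⁻ z in Metric.ball a (R a) \ E, ENNReal.ofReal t ∂ν :=
            setLIntegral_mono measurable_const fun z hz => not_lt.1 hz.2
        _ = ENNReal.ofReal t * ν (Metric.ball a (R a) \ E) := setLIntegral_const _ _
        _ ≤ _ := by gcongr; exact sdiff_subset
    have h3 : ENNReal.ofReal t * ν (Metric.ball a (R a)) +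
        ENNReal.ofReal t * ν (Metric.ball a (R a)) ≤ (∫⁻ z in Metric.ball a (R a) ∩ E, φ z ∂ν) +
        ENNReal.ofReal t * ν (Metric.ball a (R a)) := by
      rw [← add_mul, ← ENNReal.ofReal_add ht.le ht.le, ← two_mul]
      exact h1.trans h2
    exact (ENNReal.add_le_add_iff_right
      (ENNReal.mul_ne_top ENNReal.ofReal_ne_top (measure_ne_top _ _))).1 h3
  obtain ⟨u, huA, hudisj, hucov⟩ := Vitali.exists_disjoint_subfamily_covering_enlargement_ball A
    (fun a => a) R 2 (fun a ha => (hR a ha).2.1) 5 (by norm_num)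
  have hRpos : ∀ a ∈ A, 0 < R a := fun a ha => by
    have h1 := (hR a ha).1
    have h2 : ‖a‖ < 1 := ha.1
    linarith
  have hucount : u.Countable := hudisj.countable_of_isOpen (fun a _ => Metric.isOpen_ball)
    fun a ha => ⟨a, Metric.mem_ball_self (hRpos a (huA ha))⟩
  have : Countable u := hucount.to_subtype
  have hcov : A ⊆ ⋃ b : u, Metric.ball (b : ℂ) (5 * R b) := by
    intro a ha
    obtain ⟨b, hb, hab⟩ := hucov a ha
    exact mem_iUnion.2 ⟨⟨b, hb⟩, hab (Metric.mem_ball_self (hRpos a ha))⟩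
  have hμb : ∀ b : u, ENNReal.ofReal t * μ (Metric.ball (b : ℂ) (5 * R b)) ≤
      ENNReal.ofReal (max M 1 * (192 ^ (κ + 1) * 5 ^ (κ + 1))) *
        ∫⁻ z in Metric.ball (b : ℂ) (R b) ∩ E, φ z ∂ν := by
    intro b
    have hbA := huA b.2
    have hb := hR b hbA
    have hb1 : ‖(b : ℂ)‖ < 1 := hbA.1
    have hp := hRpos b hbA
    have h1 := hμ b hb1 (5 * R b) (by linarith [hb.1])
    have h2 := hw.ball_growth hb1 hb.1 hb.2.1 (show R b ≤ 5 * R b by linarith)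
    rw [mul_div_cancel_right₀ _ hp.ne'] at h2
    calc _ ≤ ENNReal.ofReal t * (ENNReal.ofReal (max M 1) * (ENNReal.ofReal
          (192 ^ (κ + 1) * 5 ^ (κ + 1)) * ν (Metric.ball (b : ℂ) (R b)))) := by
          refine mul_le_mul' le_rfl (h1.trans (mul_le_mul' ?_ h2))
          exact ENNReal.ofReal_le_ofReal (le_max_left _ _)
      _ = ENNReal.ofReal (max M 1 * (192 ^ (κ + 1) * 5 ^ (κ + 1))) *
          (ENNReal.ofReal t * ν (Metric.ball (b : ℂ) (R b))) := by
          rw [ENNReal.ofReal_mul (p := max M 1) (by positivity)]; ring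
      _ ≤ _ := mul_le_mul' le_rfl (hball b hbA)
  calc ENNReal.ofReal t * μ A
      ≤ ENNReal.ofReal t * ∑' b : u, μ (Metric.ball (b : ℂ) (5 * R b)) :=
        mul_le_mul' le_rfl ((measure_mono hcov).trans (measure_iUnion_le _))
    _ = ∑' b : u, ENNReal.ofReal t * μ (Metric.ball (b : ℂ) (5 * R b)) := by
        rw [ENNReal.tsum_mul_left]
    _ ≤ ∑' b : u, ENNReal.ofReal (max M 1 * (192 ^ (κ + 1) * 5 ^ (κ + 1))) *
        ∫⁻ z in Metric.ball (b : ℂ) (R b) ∩ E, φ z ∂ν := ENNReal.tsum_le_tsum hμb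
    _ = ENNReal.ofReal (max M 1 * (192 ^ (κ + 1) * 5 ^ (κ + 1))) *
        ∫⁻ z in ⋃ b : u, Metric.ball (b : ℂ) (R b) ∩ E, φ z ∂ν := by
        rw [ENNReal.tsum_mul_left, lintegral_iUnion
          (fun b => Metric.isOpen_ball.measurableSet.inter hE)]
        intro b b' hbb
        exact (hudisj b.2 b'.2 fun h => hbb (Subtype.ext h)).mono inter_subset_left
          inter_subset_left
    _ ≤ _ := mul_le_mul' le_rfl (lintegral_mono_set
        (iUnion_subset fun b => inter_subset_right))

/-- Carleson embedding theorem. -/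
theorem exists_carleson_embedding {μ : Measure ℂ} (hμ0 : μ unitDiscᶜ = 0) {M : ℝ}
    (hM : ∀ θ h, 0 < h → h ≤ 2 * Real.pi →
      μ (CBox θ h) ≤ ENNReal.ofReal M * radMeasure w (CBox θ h)) {p : ℝ} (hp : 0 < p) :
    ∃ C : ℝ, 0 < C ∧ ∀ f : ℂ → ℂ, DifferentiableOn ℂ f unitDisc →
      ∫⁻ z, absPow f p z ∂μ ≤ ENNReal.ofReal C * ∫⁻ z, absPow f p z ∂radMeasure w := by
  have hκ := hw.pos
  obtain ⟨C, K, hC, hK, hweak⟩ := hw.exists_weak_type (μ := μ) (M := max M 0 * 192 ^ (κ + 1))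
    (fun a ha R hR => by
      rw [ENNReal.ofReal_mul (by positivity)]
      exact hw.carleson_ball hμ0 (fun θ h h0 h1 => (hM θ h h0 h1).trans (by
        gcongr; exact le_max_left _ _)) ha hR) (half_pos hp)
  refine ⟨2 * C ^ 2 * K, by positivity, fun f hf => ?_⟩
  set ν := radMeasure w
  set ψ : ℂ → ℝ := unitDisc.indicator fun z => ‖f z‖ ^ (p / 2) with hψ
  have hψm : Measurable ψ := continuousOn_ofReal_indicator (continuousOn_norm_rpow hf (half_pos hp))
  have hψ0 : ∀ z, 0 ≤ ψ z := indicator_nonneg fun z _ => by positivity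
  have hφψ : ∀ z, absPow f (p / 2) z = ENNReal.ofReal (ψ z) := by
    intro z
    by_cases hz : z ∈ unitDisc
    · rw [absPow, hψ, indicator_of_mem hz, indicator_of_mem hz]
    · rw [absPow, hψ, indicator_of_notMem hz, indicator_of_notMem hz, ENNReal.ofReal_zero]
  have hsq : ∀ z, absPow f p z = ENNReal.ofReal (ψ z ^ (2 : ℝ)) := by
    intro z
    by_cases hz : z ∈ unitDisc
    · rw [absPow, hψ, indicator_of_mem hz, indicator_of_mem hz, ← Real.rpow_mul (norm_nonneg _)]
      congr 2
      ring
    · rw [absPow, hψ, indicator_of_notMem hz, indicator_of_notMem hz]; simp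
  simp only [hsq]
  rw [lintegral_rpow_eq_lintegral_meas_lt_mul μ (Eventually.of_forall hψ0) hψm.aemeasurable
    two_pos]
  have hφm : Measurable fun z => ENNReal.ofReal (ψ z) := ENNReal.measurable_ofReal.comp hψm
  have key : ∀ t ∈ Ioi (0 : ℝ), μ {z | t < ψ z} * ENNReal.ofReal (t ^ ((2 : ℝ) - 1)) ≤
      ENNReal.ofReal (C * K) *
        (ν.withDensity fun z => ENNReal.ofReal (ψ z)) {z | t < C * ψ z} := by
    intro t ht
    have ht : 0 < t := ht
    have h := hweak f hf (t / C) (by positivity)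
    rw [mul_div_cancel₀ t hC.ne'] at h
    have hset : {z | t < ψ z} ⊆ {z | z ∈ unitDisc ∧ t < ‖f z‖ ^ (p / 2)} := by
      intro z hz
      have hz : t < ψ z := hz
      by_cases hzd : z ∈ unitDisc
      · rw [hψ, indicator_of_mem hzd] at hz
        exact ⟨hzd, hz⟩
      · rw [hψ, indicator_of_notMem hzd] at hz
        linarith
    have hset2 : {z | ENNReal.ofReal (t / C) < absPow f (p / 2) z} = {z | t < C * ψ z} := by
      ext z
      have : ENNReal.ofReal (t / C) < absPow f (p / 2) z ↔ t < C * ψ z := by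
        rw [hφψ, ENNReal.ofReal_lt_ofReal_iff_of_nonneg (by positivity), div_lt_iff₀' hC]
      exact this
    rw [hset2] at h
    simp only [hφψ] at h
    rw [withDensity_apply _ (measurableSet_lt measurable_const (hψm.const_mul C))]
    have e : (2 : ℝ) - 1 = 1 := by norm_num
    rw [e, Real.rpow_one]
    calc _ ≤ μ {z | z ∈ unitDisc ∧ t < ‖f z‖ ^ (p / 2)} * ENNReal.ofReal t := by
          gcongr
      _ = ENNReal.ofReal C * (ENNReal.ofReal (t / C) *
          μ {z | z ∈ unitDisc ∧ t < ‖f z‖ ^ (p / 2)}) := by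
          rw [← mul_assoc, ← ENNReal.ofReal_mul hC.le, mul_div_cancel₀ t hC.ne', mul_comm]
      _ ≤ ENNReal.ofReal C * _ := mul_le_mul' le_rfl h
      _ = _ := by rw [ENNReal.ofReal_mul hC.le]; ring
  calc _ ≤ ENNReal.ofReal 2 * ∫⁻ t in Ioi (0 : ℝ), ENNReal.ofReal (C * K) *
        (ν.withDensity fun z => ENNReal.ofReal (ψ z)) {z | t < C * ψ z} :=
        mul_le_mul' le_rfl (setLIntegral_mono' measurableSet_Ioi key)
    _ = ENNReal.ofReal 2 * (ENNReal.ofReal (C * K) *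
        ∫⁻ z, ENNReal.ofReal (C * ψ z) ∂(ν.withDensity fun z => ENNReal.ofReal (ψ z))) := by
        rw [lintegral_const_mul' _ _ ENNReal.ofReal_ne_top, lintegral_eq_lintegral_meas_lt _
          (Eventually.of_forall fun z => mul_nonneg hC.le (hψ0 z)) (hψm.const_mul C).aemeasurable]
    _ = ENNReal.ofReal 2 * (ENNReal.ofReal (C * K) *
        ∫⁻ z, ENNReal.ofReal C * ENNReal.ofReal (ψ z ^ (2 : ℝ)) ∂ν) := by
        have hm : Measurable fun z => ENNReal.ofReal (C * ψ z) :=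
          ENNReal.measurable_ofReal.comp (hψm.const_mul C)
        rw [lintegral_withDensity_eq_lintegral_mul _ hφm hm]
        congr 2
        refine lintegral_congr fun z => ?_
        simp only [Pi.mul_apply]
        rw [← ENNReal.ofReal_mul (hψ0 z), ← ENNReal.ofReal_mul hC.le]
        congr 1
        rw [Real.rpow_two]; ring
    _ = _ := by
        rw [lintegral_const_mul' _ _ ENNReal.ofReal_ne_top, ← mul_assoc, ← mul_assoc,
          ← ENNReal.ofReal_mul (by norm_num), ← ENNReal.ofReal_mul (by positivity)]
        congr 2
        ring

end DoublingWeight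

lemma smul_mem_unitDisc {t : ℝ} (ht : t ∈ Icc (0 : ℝ) 1) {z : ℂ} (hz : z ∈ unitDisc) :
    (t : ℂ) * z ∈ unitDisc := by
  have hz : ‖z‖ < 1 := hz
  have : ‖(t : ℂ) * z‖ = t * ‖z‖ := by
    rw [norm_mul, Complex.norm_real, Real.norm_of_nonneg ht.1]
  have h : ‖(t : ℂ) * z‖ < 1 := by rw [this]; nlinarith [ht.1, ht.2, norm_nonneg z]
  exact h

section Operator

variable {g f : ℂ → ℂ} (hg : DifferentiableOn ℂ g unitDisc) (hf : DifferentiableOn ℂ f unitDisc)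
include hg hf

/-- `T_g f` is a primitive of `f g'` vanishing at the origin. -/
lemma exists_primitive_Tg : ∃ H : ℂ → ℂ, H 0 = 0 ∧
    (∀ z ∈ unitDisc, HasDerivAt H (f z * deriv g z) z) ∧ EqOn (Tg g f) H unitDisc := by
  have hh : DifferentiableOn ℂ (fun z => f z * deriv g z) unitDisc :=
    hf.mul (hg.deriv isOpen_unitDisc)
  have hh' := hh
  rw [unitDisc_eq_ball] at hh'
  obtain ⟨H, hH0, hH⟩ := hh'.isExactOn_ball.with_val_at 0 0
  rw [← unitDisc_eq_ball] at hH
  refine ⟨H, hH0, hH, fun z hz => ?_⟩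
  have hd : ∀ t ∈ uIcc (0 : ℝ) 1, HasDerivAt (fun t : ℝ => H ((t : ℂ) * z))
      ((f ((t : ℂ) * z) * deriv g ((t : ℂ) * z)) * z) t := by
    intro t ht
    rw [uIcc_of_le zero_le_one] at ht
    have h1 := hH _ (smul_mem_unitDisc ht hz)
    have h2 : HasDerivAt (fun t : ℝ => (t : ℂ) * z) z t := by
      simpa using (Complex.ofRealCLM.hasDerivAt (x := t)).mul_const z
    exact h1.comp t h2
  have hc : ContinuousOn (fun t : ℝ => (f ((t : ℂ) * z) * deriv g ((t : ℂ) * z)) * z)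
      (uIcc 0 1) := by
    rw [uIcc_of_le zero_le_one]
    refine ContinuousOn.mul (hh.continuousOn.comp (by fun_prop) fun t ht =>
      smul_mem_unitDisc ht hz) continuousOn_const
  have := intervalIntegral.integral_eq_sub_of_hasDerivAt hd hc.intervalIntegrable
  rw [Tg, this]
  simp [hH0]

lemma hasDerivAt_Tg {z : ℂ} (hz : z ∈ unitDisc) :
    HasDerivAt (Tg g f) (f z * deriv g z) z := by
  obtain ⟨H, -, hH, he⟩ := exists_primitive_Tg hg hf
  exact (hH z hz).congr_of_eventuallyEq (he.eventuallyEq_of_mem (isOpen_unitDisc.mem_nhds hz))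

lemma deriv_Tg {z : ℂ} (hz : z ∈ unitDisc) : deriv (Tg g f) z = f z * deriv g z :=
  (hasDerivAt_Tg hg hf hz).deriv

lemma differentiableOn_Tg : DifferentiableOn ℂ (Tg g f) unitDisc := fun _ hz =>
  (hasDerivAt_Tg hg hf hz).differentiableAt.differentiableWithinAt

end Operator

lemma Tg_zero (g f : ℂ → ℂ) : Tg g f 0 = 0 := by simp [Tg]

lemma differentiableOn_dilate {f : ℂ → ℂ} (hf : DifferentiableOn ℂ f unitDisc) {ρ : ℝ}
    (hρ : ρ ∈ Icc (0 : ℝ) 1) : DifferentiableOn ℂ (fun z => f (ρ * z)) unitDisc :=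
  hf.comp (by fun_prop) fun _ hz => smul_mem_unitDisc hρ hz

lemma closedBall_subset_unitDisc {z : ℂ} (hz : z ∈ unitDisc) :
    Metric.closedBall (0 : ℂ) ‖z‖ ⊆ unitDisc := by
  intro x hx
  rw [mem_closedBall_zero_iff] at hx
  exact lt_of_le_of_lt hx hz

lemma tendsto_Tg_dilate {g f : ℂ → ℂ} (hg : DifferentiableOn ℂ g unitDisc)
    (hf : DifferentiableOn ℂ f unitDisc) {ρ : ℕ → ℝ} (hρ : ∀ n, ρ n ∈ Icc (0 : ℝ) 1)
    (hlim : Tendsto ρ atTop (𝓝 1)) {z : ℂ} (hz : z ∈ unitDisc) :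
    Tendsto (fun n => Tg g (fun ζ => f (ρ n * ζ)) z) atTop (𝓝 (Tg g f z)) := by
  have hg' := (hg.deriv isOpen_unitDisc).continuousOn
  have hK : IsCompact (Metric.closedBall (0 : ℂ) ‖z‖) := isCompact_closedBall _ _
  obtain ⟨B₁, hB₁⟩ := hK.exists_bound_of_continuousOn
    (hf.continuousOn.mono (closedBall_subset_unitDisc hz))
  obtain ⟨B₂, hB₂⟩ := hK.exists_bound_of_continuousOn (hg'.mono (closedBall_subset_unitDisc hz))
  have hmem : ∀ t ∈ Icc (0 : ℝ) 1, ∀ x ∈ Metric.closedBall (0 : ℂ) ‖z‖,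
      (t : ℂ) * x ∈ Metric.closedBall (0 : ℂ) ‖z‖ := by
    intro t ht x hx
    rw [mem_closedBall_zero_iff] at hx ⊢
    rw [norm_mul, Complex.norm_real, Real.norm_of_nonneg ht.1]
    nlinarith [ht.1, ht.2, norm_nonneg x]
  have hz' : z ∈ Metric.closedBall (0 : ℂ) ‖z‖ := by simp
  unfold Tg
  refine intervalIntegral.tendsto_integral_filter_of_dominated_convergence
    (fun _ => B₁ * B₂ * ‖z‖) (Eventually.of_forall fun n => ?_)
    (Eventually.of_forall fun n => Eventually.of_forall fun t ht => ?_)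
    intervalIntegrable_const (Eventually.of_forall fun t ht => ?_)
  · rw [uIoc_of_le zero_le_one]
    refine ContinuousOn.aestronglyMeasurable ?_ measurableSet_Ioc
    refine ContinuousOn.mono ?_ Ioc_subset_Icc_self
    refine ContinuousOn.mul (ContinuousOn.mul ?_ ?_) continuousOn_const
    · exact (differentiableOn_dilate hf (hρ n)).continuousOn.comp (by fun_prop)
        fun t ht => smul_mem_unitDisc ht hz
    · exact hg'.comp (by fun_prop) fun t ht => smul_mem_unitDisc ht hz
  · rw [uIoc_of_le zero_le_one] at ht
    have ht := Ioc_subset_Icc_self ht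
    have h1 := hmem t ht z hz'
    rw [norm_mul, norm_mul]
    have := hB₁ _ (hmem _ (hρ n) _ h1)
    have h2 := hB₂ _ h1
    gcongr
    exact (norm_nonneg _).trans this
  · rw [uIoc_of_le zero_le_one] at ht
    have h1 := smul_mem_unitDisc (Ioc_subset_Icc_self ht) hz
    have hc : ContinuousAt f ((t : ℂ) * z) := (hf.differentiableAt
      (isOpen_unitDisc.mem_nhds h1)).continuousAt
    have h2 : Tendsto (fun n => (ρ n : ℂ) * ((t : ℂ) * z)) atTop (𝓝 ((t : ℂ) * z)) := by
      have := ((Complex.continuous_ofReal.tendsto 1).comp hlim).mul_const ((t : ℂ) * z)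
      simpa using this
    exact ((hc.tendsto.comp h2).mul_const _).mul_const _

lemma add_rpow_le {x y s : ℝ} (hx : 0 ≤ x) (hy : 0 ≤ y) (hs : 0 < s) :
    (x + y) ^ s ≤ 2 ^ s * (x ^ s + y ^ s) := by
  have h1 : x + y ≤ 2 * max x y := by
    linarith [le_max_left x y, le_max_right x y]
  have h2 : (max x y) ^ s ≤ x ^ s + y ^ s := by
    have hx' := Real.rpow_nonneg hx s
    have hy' := Real.rpow_nonneg hy s
    rcases max_choice x y with h | h <;> rw [h] <;> linarith
  have h0 : 0 ≤ max x y := le_max_of_le_left hx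
  calc (x + y) ^ s ≤ (2 * max x y) ^ s := by gcongr
    _ = 2 ^ s * (max x y) ^ s := Real.mul_rpow (by norm_num) h0
    _ ≤ _ := by gcongr

lemma le_of_forall_le_add_rpow {X A K : ℝ≥0∞} {p : ℝ} (hp : 0 < p) (hK : K ≠ ∞)
    (h : ∀ ε : ℝ, 0 < ε → X ≤ A + K * ENNReal.ofReal (ε ^ p)) : X ≤ A := by
  have h1 : Tendsto (fun ε : ℝ => ENNReal.ofReal (ε ^ p)) (𝓝[>] 0) (𝓝 0) := by
    have hc : Continuous fun ε : ℝ => ENNReal.ofReal (ε ^ p) :=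
      ENNReal.continuous_ofReal.comp (Real.continuous_rpow_const hp.le)
    have := (hc.tendsto 0).mono_left (nhdsWithin_le_nhds (s := Ioi 0))
    simpa [Real.zero_rpow hp.ne'] using this
  have h2 : Tendsto (fun ε : ℝ => A + K * ENNReal.ofReal (ε ^ p)) (𝓝[>] 0) (𝓝 A) := by
    have := (ENNReal.Tendsto.const_mul h1 (Or.inr hK)).const_add A
    simpa using this
  exact ge_of_tendsto h2 (eventually_mem_nhdsWithin.mono fun ε hε => h ε hε)

section GreenBounds

variable {ι : Type*} [Fintype ι] {F : ι → ℂ → ℂ} (hF : ∀ i, DifferentiableOn ℂ (F i) unitDisc)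
  {q : ℝ} (hq : 0 < q) (hv : ∀ z ∈ unitDisc, 0 < vecSq F z) {w : ℝ → ℝ≥0∞} (hw : Measurable w)
include hF hq hv hw

lemma lintegral_vecSq_rpow_le :
    ∫⁻ z in unitDisc, ENNReal.ofReal (vecSq F z ^ q) * w ‖z‖ ≤
      ENNReal.ofReal (vecSq F 0 ^ q) * (∫⁻ z in unitDisc, w ‖z‖) +
        ENNReal.ofReal (4 * q * max 1 q) * ∫⁻ z in unitDisc,
          ENNReal.ofReal (vecSq F z ^ (q - 1) * vecDerivSq F z) * starWeight w ‖z‖ := by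
  rw [lintegral_vecSq_rpow hF hq hv hw,
    ← lintegral_const_mul' (ENNReal.ofReal (4 * q * max 1 q)) _ ENNReal.ofReal_ne_top]
  refine add_le_add le_rfl (setLIntegral_mono' measurableSet_unitDisc fun z hz => ?_)
  rw [← mul_assoc, ← ENNReal.ofReal_mul (by positivity)]
  exact mul_le_mul' (ENNReal.ofReal_le_ofReal (vecLap_bounds hq F (hv z hz)).2) le_rfl

lemma le_lintegral_vecSq_rpow :
    ENNReal.ofReal (4 * q * min 1 q) * ∫⁻ z in unitDisc,
        ENNReal.ofReal (vecSq F z ^ (q - 1) * vecDerivSq F z) * starWeight w ‖z‖ ≤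
      ∫⁻ z in unitDisc, ENNReal.ofReal (vecSq F z ^ q) * w ‖z‖ := by
  rw [lintegral_vecSq_rpow hF hq hv hw,
    ← lintegral_const_mul' (ENNReal.ofReal (4 * q * min 1 q)) _ ENNReal.ofReal_ne_top]
  refine le_trans (setLIntegral_mono' measurableSet_unitDisc fun z hz => ?_) le_add_self
  rw [← mul_assoc, ← ENNReal.ofReal_mul (by positivity)]
  exact mul_le_mul' (ENNReal.ofReal_le_ofReal (vecLap_bounds hq F (hv z hz)).1) le_rfl

lemma ofReal_vecSq_zero_rpow_mul_le :
    ENNReal.ofReal (vecSq F 0 ^ q) * (∫⁻ z in unitDisc, w ‖z‖) ≤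
      ∫⁻ z in unitDisc, ENNReal.ofReal (vecSq F z ^ q) * w ‖z‖ := by
  rw [lintegral_vecSq_rpow hF hq hv hw]
  exact le_self_add

end GreenBounds

/-- The density `|g'|² ω*` of the measure attached to the symbol `g`. -/
def symDens (g : ℂ → ℂ) (w : ℝ → ℝ≥0∞) (z : ℂ) : ℝ≥0∞ :=
  ENNReal.ofReal (‖deriv g z‖ ^ 2) * starWeight w ‖z‖

lemma measurable_symDens (g : ℂ → ℂ) {w : ℝ → ℝ≥0∞} (hw : Measurable w) :
    Measurable (symDens g w) :=
  (ENNReal.measurable_ofReal.comp ((measurable_deriv g).norm.pow_const 2)).mul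
    ((measurable_starWeight hw).comp measurable_norm)

lemma lintegral_symDens {g : ℂ → ℂ} {w : ℝ → ℝ≥0∞} (hw : Measurable w) {φ : ℂ → ℝ≥0∞}
    (hφ : Measurable (unitDisc.indicator φ)) :
    ∫⁻ z in unitDisc, φ z * symDens g w z =
      ∫⁻ z, unitDisc.indicator φ z ∂(volume.restrict unitDisc).withDensity (symDens g w) := by
  have h := setLIntegral_withDensity_disc (A := univ) (φ := unitDisc.indicator φ)
    (measurable_symDens g hw) MeasurableSet.univ
    (by rw [inter_univ, indicator_indicator, inter_self]; exact hφ)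
  rw [setLIntegral_univ, inter_univ] at h
  refine Eq.trans ?_ h.symm
  refine setLIntegral_congr_fun measurableSet_unitDisc fun z hz => ?_
  simp only [indicator_of_mem hz]

/-- `CarlesonSymbol g w M` states that `|g'|² ω* dA` is a Carleson measure. -/
def CarlesonSymbol (g : ℂ → ℂ) (w : ℝ → ℝ≥0∞) (M : ℝ) : Prop :=
  ∀ θ h : ℝ, 0 < h → h ≤ 2 * Real.pi →
    ∫⁻ z in CBox θ h, symDens g w z ≤ ENNReal.ofReal M * ∫⁻ z in CBox θ h, w ‖z‖

lemma DoublingWeight.exists_embedding {w : ℝ → ℝ≥0∞} {κ : ℝ} (hw : DoublingWeight w κ)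
    {g : ℂ → ℂ} {M : ℝ} (hM : CarlesonSymbol g w M) {p : ℝ} (hp : 0 < p) :
    ∃ C : ℝ, 0 < C ∧ ∀ f : ℂ → ℂ, DifferentiableOn ℂ f unitDisc →
      ∫⁻ z in unitDisc, ENNReal.ofReal (‖f z‖ ^ p) * symDens g w z ≤
        ENNReal.ofReal C * ∫⁻ z in unitDisc, ENNReal.ofReal (‖f z‖ ^ p) * w ‖z‖ := by
  set μ := (volume.restrict unitDisc).withDensity (symDens g w) with hμ
  have hμ0 : μ unitDiscᶜ = 0 := by
    refine withDensity_absolutelyContinuous _ _ ?_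
    rw [Measure.restrict_apply measurableSet_unitDisc.compl, compl_inter_self, measure_empty]
  obtain ⟨C, hC, h⟩ := hw.exists_carleson_embedding hμ0 (M := M) (fun θ h h0 h1 => by
    rw [hμ, withDensity_apply_CBox, radMeasure, withDensity_apply_CBox]
    exact hM θ h h0 h1) hp
  refine ⟨C, hC, fun f hf => ?_⟩
  rw [lintegral_symDens hw.measurable (measurable_absPow hf hp),
    lintegral_absPow_eq hw.measurable (measurable_absPow hf hp)]
  exact h f hf

/-- The `p`-th power of the norm of `f` in the Bergman space with radial weight `w`. -/
def bergInt (w : ℝ → ℝ≥0∞) (p : ℝ) (f : ℂ → ℂ) : ℝ≥0∞ :=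
  ∫⁻ z in unitDisc, ENNReal.ofReal (‖f z‖ ^ p) * w ‖z‖

lemma ENNReal.le_ofReal_one_div_mul {c : ℝ} (hc : 0 < c) {I V : ℝ≥0∞}
    (h : ENNReal.ofReal c * I ≤ V) : I ≤ ENNReal.ofReal (1 / c) * V := by
  calc I = ENNReal.ofReal (1 / c) * (ENNReal.ofReal c * I) := by
        rw [← mul_assoc, ← ENNReal.ofReal_mul (by positivity), one_div_mul_cancel hc.ne',
          ENNReal.ofReal_one, one_mul]
    _ ≤ _ := mul_le_mul' le_rfl h

lemma lintegral_sq_add_sq_rpow_le {ρ : ℂ → ℝ≥0∞} (hρ : Measurable ρ) (f : ℂ → ℂ) {ε s : ℝ}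
    (hε : 0 < ε) (hs : 0 < s) :
    ∫⁻ z in unitDisc, ENNReal.ofReal ((‖f z‖ ^ 2 + ε ^ 2) ^ (s / 2)) * ρ z ≤
      ENNReal.ofReal (2 ^ (s / 2)) * ((∫⁻ z in unitDisc, ENNReal.ofReal (‖f z‖ ^ s) * ρ z) +
        (∫⁻ z in unitDisc, ρ z) * ENNReal.ofReal (ε ^ s)) := by
  rw [mul_comm (∫⁻ z in unitDisc, ρ z), ← lintegral_const_mul _ hρ,
    ← lintegral_add_right _ (hρ.const_mul _), ← lintegral_const_mul' _ _ ENNReal.ofReal_ne_top]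
  refine lintegral_mono fun z => ?_
  have h := add_rpow_le (x := ‖f z‖ ^ 2) (y := ε ^ 2) (by positivity) (by positivity) (half_pos hs)
  rw [sq_rpow_half (norm_nonneg _), sq_rpow_half hε.le] at h
  rw [← add_mul, ← ENNReal.ofReal_add (by positivity) (by positivity), ← mul_assoc,
    ← ENNReal.ofReal_mul (by positivity)]
  gcongr

lemma vecSq_three (F f : ℂ → ℂ) (ε : ℝ) (z : ℂ) :
    vecSq ![F, f, fun _ => (ε : ℂ)] z = ‖F z‖ ^ 2 + ‖f z‖ ^ 2 + ε ^ 2 := by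
  simp [vecSq, Fin.sum_univ_three]

lemma vecDerivSq_three (F f : ℂ → ℂ) (ε : ℝ) (z : ℂ) :
    vecDerivSq ![F, f, fun _ => (ε : ℂ)] z = ‖deriv F z‖ ^ 2 + ‖deriv f z‖ ^ 2 := by
  simp [vecDerivSq, Fin.sum_univ_three]

lemma vecDerivSq_cons_const (f : ℂ → ℂ) (ε : ℝ) (z : ℂ) :
    vecDerivSq ![f, fun _ => (ε : ℂ)] z = ‖deriv f z‖ ^ 2 := by
  simp [vecDerivSq, Fin.sum_univ_two]

namespace DoublingWeight

variable {w : ℝ → ℝ≥0∞} {κ : ℝ} (hw : DoublingWeight w κ) {g : ℂ → ℂ}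
  (hg : DifferentiableOn ℂ g unitDisc) {M : ℝ} (hM : CarlesonSymbol g w M)

include hw in
lemma lintegral_weight_lt_top : ∫⁻ z in unitDisc, w ‖z‖ < ∞ := by
  have := hw.radMeasure_univ_lt_top
  rwa [radMeasure, withDensity_apply _ MeasurableSet.univ, Measure.restrict_univ] at this

include hw hg hM in
lemma exists_bergInt_Tg_le_of_le_two {p : ℝ} (hp : 0 < p) (hp2 : p ≤ 2) :
    ∃ C : ℝ, 0 < C ∧ ∀ f : ℂ → ℂ, DifferentiableOn ℂ f unitDisc →
      bergInt w p (Tg g f) ≤ ENNReal.ofReal C * bergInt w p f := by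
  obtain ⟨C, hC, hemb⟩ := hw.exists_embedding hM hp
  set q := p / 2 with hqdef
  have hq : 0 < q := half_pos hp
  have hq1 : q ≤ 1 := by rw [hqdef]; linarith
  set c₁ : ℝ := 4 * q * max 1 q with hc₁
  set c₂ : ℝ := 4 * q * min 1 q with hc₂
  have hc₁0 : 0 < c₁ := by positivity
  have hc₂0 : 0 < c₂ := by positivity
  set K : ℝ := (1 + c₁ * (1 / c₂)) * 2 ^ q with hK
  refine ⟨K + c₁ * C, by positivity, fun f hf => ?_⟩
  have hS := (measurable_starWeight hw.measurable).comp (measurable_norm (α := ℂ))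
  set F := Tg g f with hFdef
  have hFd : DifferentiableOn ℂ F unitDisc := differentiableOn_Tg hg hf
  have hWt := hw.lintegral_weight_lt_top
  set W := ∫⁻ z in unitDisc, w ‖z‖
  refine le_of_forall_le_add_rpow (K := ENNReal.ofReal K * W) hp
    (ENNReal.mul_ne_top ENNReal.ofReal_ne_top hWt.ne) fun ε hε => ?_
  have hdiff : ∀ i, DifferentiableOn ℂ (![F, f, fun _ => (ε : ℂ)] i) unitDisc := by
    intro i; fin_cases i
    · exact hFd
    · exact hf
    · exact differentiableOn_const _
  have hdiff₂ : ∀ i, DifferentiableOn ℂ (![f, fun _ => (ε : ℂ)] i) unitDisc := by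
    intro i; fin_cases i
    · exact hf
    · exact differentiableOn_const _
  have hv : ∀ z ∈ unitDisc, 0 < vecSq ![F, f, fun _ => (ε : ℂ)] z := fun z _ => by
    rw [vecSq_three]; positivity
  have hv₂ : ∀ z ∈ unitDisc, 0 < vecSq ![f, fun _ => (ε : ℂ)] z := fun z _ => by
    rw [vecSq_cons_const]; positivity
  have g1 := lintegral_vecSq_rpow_le hdiff hq hv hw.measurable
  have g2 := le_lintegral_vecSq_rpow hdiff₂ hq hv₂ hw.measurable
  have g3 := ofReal_vecSq_zero_rpow_mul_le hdiff₂ hq hv₂ hw.measurable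
  have g4 := lintegral_sq_add_sq_rpow_le (ρ := fun z => w ‖z‖)
    (hw.measurable.comp measurable_norm) f hε hp
  simp only [vecSq_three, vecSq_cons_const, vecDerivSq_three, vecDerivSq_cons_const] at g1 g2 g3
  rw [hFdef, Tg_zero, ← hFdef] at g1
  simp only [norm_zero, ne_eq, OfNat.ofNat_ne_zero, not_false_eq_true, zero_pow, zero_add] at g1
  rw [← hqdef] at g4
  set V := ∫⁻ z in unitDisc, ENNReal.ofReal ((‖f z‖ ^ 2 + ε ^ 2) ^ q) * w ‖z‖
  have g2' := ENNReal.le_ofReal_one_div_mul hc₂0 g2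
  set I := ∫⁻ z in unitDisc, ENNReal.ofReal ((‖f z‖ ^ 2 + ε ^ 2) ^ (q - 1) * ‖deriv f z‖ ^ 2) *
    starWeight w ‖z‖
  have h5 : ∫⁻ z in unitDisc, ENNReal.ofReal ((‖F z‖ ^ 2 + ‖f z‖ ^ 2 + ε ^ 2) ^ (q - 1) *
      (‖deriv F z‖ ^ 2 + ‖deriv f z‖ ^ 2)) * starWeight w ‖z‖ ≤
      (∫⁻ z in unitDisc, ENNReal.ofReal (‖f z‖ ^ p) * symDens g w z) + I := by
    have hm : AEMeasurable (fun z => ENNReal.ofReal (‖f z‖ ^ p) * symDens g w z)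
        (volume.restrict unitDisc) := by
      refine AEMeasurable.mul ?_ (measurable_symDens g hw.measurable).aemeasurable
      exact ENNReal.measurable_ofReal.comp_aemeasurable
        ((continuousOn_norm_rpow hf hp).aemeasurable measurableSet_unitDisc)
    rw [← lintegral_add_left' hm]
    refine setLIntegral_mono' measurableSet_unitDisc fun z hz => ?_
    have hd : deriv F z = f z * deriv g z := deriv_Tg hg hf hz
    rw [symDens, ← mul_assoc, ← ENNReal.ofReal_mul (by positivity), ← add_mul,
      ← ENNReal.ofReal_add (by positivity) (by positivity), hd, norm_mul, mul_pow]
    refine mul_le_mul' (ENNReal.ofReal_le_ofReal ?_) le_rfl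
    have hmono : (‖F z‖ ^ 2 + ‖f z‖ ^ 2 + ε ^ 2) ^ (q - 1) ≤ (‖f z‖ ^ 2 + ε ^ 2) ^ (q - 1) :=
      Real.rpow_le_rpow_of_nonpos (by positivity) (by linarith [sq_nonneg ‖F z‖]) (by linarith)
    have hmono₂ : (‖f z‖ ^ 2 + ε ^ 2) ^ (q - 1) * ‖f z‖ ^ 2 ≤ ‖f z‖ ^ p := by
      rcases eq_or_ne (f z) 0 with h0 | h0
      · rw [h0, norm_zero]
        simp [Real.zero_rpow hp.ne']
      · have hpos : 0 < ‖f z‖ ^ 2 := by positivity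
        calc _ ≤ (‖f z‖ ^ 2) ^ (q - 1) * ‖f z‖ ^ 2 := by
              refine mul_le_mul_of_nonneg_right ?_ hpos.le
              exact Real.rpow_le_rpow_of_nonpos hpos (by linarith [sq_nonneg ε]) (by linarith)
          _ = (‖f z‖ ^ 2) ^ q := by
              rw [← Real.rpow_add_one hpos.ne']; congr 1; ring
          _ = _ := sq_rpow_half (norm_nonneg _) p
    calc _ ≤ (‖f z‖ ^ 2 + ε ^ 2) ^ (q - 1) * (‖f z‖ ^ 2 * ‖deriv g z‖ ^ 2 + ‖deriv f z‖ ^ 2) := by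
          gcongr
      _ = (‖f z‖ ^ 2 + ε ^ 2) ^ (q - 1) * ‖f z‖ ^ 2 * ‖deriv g z‖ ^ 2 +
          (‖f z‖ ^ 2 + ε ^ 2) ^ (q - 1) * ‖deriv f z‖ ^ 2 := by ring
      _ ≤ _ := by gcongr
  have h6 : bergInt w p F ≤ ∫⁻ z in unitDisc,
      ENNReal.ofReal ((‖F z‖ ^ 2 + ‖f z‖ ^ 2 + ε ^ 2) ^ q) * w ‖z‖ := by
    refine lintegral_mono fun z => mul_le_mul' (ENNReal.ofReal_le_ofReal ?_) le_rfl
    rw [← sq_rpow_half (norm_nonneg (F z)) p]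
    exact Real.rpow_le_rpow (by positivity) (by linarith [sq_nonneg ‖f z‖, sq_nonneg ε]) hq.le
  have h7 := hemb f hf
  change _ ≤ ENNReal.ofReal C * bergInt w p f at h7
  change _ ≤ ENNReal.ofReal (2 ^ q) * (bergInt w p f + W * ENNReal.ofReal (ε ^ p)) at g4
  set A := bergInt w p f
  calc bergInt w p F
      ≤ V + ENNReal.ofReal c₁ * (ENNReal.ofReal C * A + ENNReal.ofReal (1 / c₂) * V) :=
        h6.trans (g1.trans (add_le_add g3 (mul_le_mul' le_rfl (h5.trans (add_le_add h7 g2')))))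
    _ = ENNReal.ofReal (1 + c₁ * (1 / c₂)) * V + ENNReal.ofReal (c₁ * C) * A := by
        rw [ENNReal.ofReal_add (by positivity) (by positivity), ENNReal.ofReal_one,
          ENNReal.ofReal_mul hc₁0.le, ENNReal.ofReal_mul hc₁0.le]
        ring
    _ ≤ ENNReal.ofReal (1 + c₁ * (1 / c₂)) * (ENNReal.ofReal (2 ^ q) *
        (A + W * ENNReal.ofReal (ε ^ p))) + ENNReal.ofReal (c₁ * C) * A := by gcongr
    _ = _ := by
        rw [ENNReal.ofReal_add (p := K) (by positivity) (by positivity), hK,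
          ENNReal.ofReal_mul (p := 1 + c₁ * (1 / c₂)) (by positivity)]
        ring

include hw hM in
lemma exists_lintegral_symDens_le :
    ∃ C : ℝ, 0 < C ∧ ∫⁻ z in unitDisc, symDens g w z ≤
      ENNReal.ofReal C * ∫⁻ z in unitDisc, w ‖z‖ := by
  obtain ⟨C, hC, h⟩ := hw.exists_embedding hM one_pos
  refine ⟨C, hC, ?_⟩
  simpa using h (fun _ => 1) (differentiableOn_const _)

include hw hg in
/-- Energy estimate for exponents at least two. -/
lemma lintegral_Tg_rpow_le {q : ℝ} (hq : 1 ≤ q) {f : ℂ → ℂ} (hf : DifferentiableOn ℂ f unitDisc)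
    {ε : ℝ} (hε : 0 < ε) :
    ∫⁻ z in unitDisc, ENNReal.ofReal ((‖Tg g f z‖ ^ 2 + ε ^ 2) ^ q) * w ‖z‖ ≤
      ENNReal.ofReal (ε ^ (2 * q)) * (∫⁻ z in unitDisc, w ‖z‖) +
        ENNReal.ofReal (4 * q * q) * ∫⁻ z in unitDisc,
          ENNReal.ofReal ((‖Tg g f z‖ ^ 2 + ε ^ 2) ^ (q - 1) * ‖f z‖ ^ 2) * symDens g w z := by
  have hdiff : ∀ i, DifferentiableOn ℂ (![Tg g f, fun _ => (ε : ℂ)] i) unitDisc := by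
    intro i; fin_cases i
    · exact differentiableOn_Tg hg hf
    · exact differentiableOn_const _
  have hv : ∀ z ∈ unitDisc, 0 < vecSq ![Tg g f, fun _ => (ε : ℂ)] z := fun z _ => by
    rw [vecSq_cons_const]; positivity
  have g1 := lintegral_vecSq_rpow_le hdiff (by linarith : 0 < q) hv hw.measurable
  simp only [vecSq_cons_const, vecDerivSq_cons_const] at g1
  rw [Tg_zero, max_eq_right hq] at g1
  have e : (‖(0 : ℂ)‖ ^ 2 + ε ^ 2) ^ q = ε ^ (2 * q) := by
    rw [Real.rpow_mul hε.le, Real.rpow_two]; simp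
  rw [e] at g1
  refine g1.trans (add_le_add le_rfl (mul_le_mul' le_rfl (le_of_eq ?_)))
  refine setLIntegral_congr_fun measurableSet_unitDisc fun z hz => ?_
  simp only [symDens]
  rw [deriv_Tg hg hf hz, norm_mul, mul_pow, ← mul_assoc, ← mul_assoc,
    ← ENNReal.ofReal_mul (by positivity)]

include hw hg hM in
lemma bergInt_Tg_lt_top_of_bounded {f : ℂ → ℂ} (hf : DifferentiableOn ℂ f unitDisc) {B : ℝ}
    (hB : ∀ z ∈ unitDisc, ‖f z‖ ≤ B) (n : ℕ) :
    ∀ p : ℝ, 0 < p → p ≤ 2 * (n + 1) → bergInt w p (Tg g f) < ∞ := by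
  have hWt := hw.lintegral_weight_lt_top
  have hB0 : 0 ≤ B := (norm_nonneg _).trans (hB 0 (by simp [unitDisc]))
  induction n with
  | zero =>
    intro p hp hp2
    obtain ⟨C, hC, h⟩ := hw.exists_bergInt_Tg_le_of_le_two hg hM hp (by simpa using hp2)
    refine (h f hf).trans_lt (ENNReal.mul_lt_top ENNReal.ofReal_lt_top ?_)
    calc bergInt w p f ≤ ∫⁻ z in unitDisc, ENNReal.ofReal (B ^ p) * w ‖z‖ := by
          refine setLIntegral_mono' measurableSet_unitDisc fun z hz => ?_
          gcongr
          exact hB z hz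
      _ = ENNReal.ofReal (B ^ p) * ∫⁻ z in unitDisc, w ‖z‖ :=
          lintegral_const_mul' _ _ ENNReal.ofReal_ne_top
      _ < ∞ := ENNReal.mul_lt_top ENNReal.ofReal_lt_top hWt
  | succ n ih =>
    intro p hp hpn
    push_cast at hpn
    rcases le_or_gt p 2 with h2 | h2
    · exact ih p hp (by nlinarith [(Nat.cast_nonneg n : (0 : ℝ) ≤ n)])
    have hs : 0 < p - 2 := by linarith
    have ih' := ih (p - 2) hs (by linarith)
    obtain ⟨C, hC, hemb⟩ := hw.exists_embedding hM hs
    obtain ⟨C', hC', hsym⟩ := hw.exists_lintegral_symDens_le hM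
    have h1 := hw.lintegral_Tg_rpow_le hg (q := p / 2) (by linarith) hf one_pos
    have h3 : bergInt w p (Tg g f) ≤ ∫⁻ z in unitDisc,
        ENNReal.ofReal ((‖Tg g f z‖ ^ 2 + 1 ^ 2) ^ (p / 2)) * w ‖z‖ := by
      refine lintegral_mono fun z => mul_le_mul' (ENNReal.ofReal_le_ofReal ?_) le_rfl
      rw [← sq_rpow_half (norm_nonneg (Tg g f z)) p]
      exact Real.rpow_le_rpow (by positivity) (by linarith) (by linarith)
    refine (h3.trans h1).trans_lt (ENNReal.add_lt_top.2
      ⟨ENNReal.mul_lt_top ENNReal.ofReal_lt_top hWt,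
        ENNReal.mul_lt_top ENNReal.ofReal_lt_top ?_⟩)
    have h4 := lintegral_sq_add_sq_rpow_le (measurable_symDens g hw.measurable) (Tg g f)
      one_pos hs
    have h5 := hemb _ (differentiableOn_Tg hg hf)
    calc _ ≤ ∫⁻ z in unitDisc, ENNReal.ofReal (B ^ 2) *
          (ENNReal.ofReal ((‖Tg g f z‖ ^ 2 + 1 ^ 2) ^ ((p - 2) / 2)) * symDens g w z) := by
          refine setLIntegral_mono' measurableSet_unitDisc fun z hz => ?_
          rw [← mul_assoc, ← ENNReal.ofReal_mul (by positivity), mul_comm (B ^ 2),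
            show (p - 2) / 2 = p / 2 - 1 by ring]
          have := hB z hz
          gcongr
      _ = ENNReal.ofReal (B ^ 2) * ∫⁻ z in unitDisc,
          ENNReal.ofReal ((‖Tg g f z‖ ^ 2 + 1 ^ 2) ^ ((p - 2) / 2)) * symDens g w z :=
          lintegral_const_mul' _ _ ENNReal.ofReal_ne_top
      _ < ∞ := by
          refine ENNReal.mul_lt_top ENNReal.ofReal_lt_top (h4.trans_lt ?_)
          refine ENNReal.mul_lt_top ENNReal.ofReal_lt_top (ENNReal.add_lt_top.2 ⟨?_, ?_⟩)
          · exact h5.trans_lt (ENNReal.mul_lt_top ENNReal.ofReal_lt_top ih')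
          · exact ENNReal.mul_lt_top (hsym.trans_lt
              (ENNReal.mul_lt_top ENNReal.ofReal_lt_top hWt)) ENNReal.ofReal_lt_top

end DoublingWeight

lemma ENNReal.le_two_mul_of_le_add_half {X A : ℝ≥0∞} (hX : X ≠ ∞)
    (h : X ≤ A + ENNReal.ofReal (1 / 2) * X) : X ≤ 2 * A := by
  rcases eq_or_ne A ∞ with rfl | hA
  · simp
  lift X to NNReal using hX
  lift A to NNReal using hA
  have e : ENNReal.ofReal (1 / 2) = ((1 / 2 : NNReal) : ℝ≥0∞) := by
    rw [ENNReal.ofReal, Real.toNNReal_div (by norm_num)]; simp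
  rw [e] at h
  norm_cast at h ⊢
  have h' : (X : ℝ) ≤ A + 1 / 2 * X := by exact_mod_cast h
  have : (X : ℝ) ≤ 2 * A := by linarith
  exact_mod_cast this

lemma rpow_sub_one_mul_le {u x δ q : ℝ} (hu : 0 < u) (hx : 0 ≤ x) (hδ : 0 < δ) (hq : 1 ≤ q) :
    u ^ (q - 1) * x ≤ δ * u ^ q + (1 / δ) ^ (q - 1) * x ^ q := by
  have hp1 : 0 ≤ (1 / δ) ^ (q - 1) * x ^ q := by positivity
  have hp2 : 0 ≤ δ * u ^ q := by positivity
  rcases le_or_gt x (δ * u) with h | h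
  · calc u ^ (q - 1) * x ≤ u ^ (q - 1) * (δ * u) := by gcongr
      _ = δ * (u ^ (q - 1) * u) := by ring
      _ = δ * u ^ q := by rw [← Real.rpow_add_one hu.ne', sub_add_cancel]
      _ ≤ _ := by linarith
  · have hx0 : 0 < x := lt_trans (by positivity) h
    have hux : u ≤ 1 / δ * x := by
      rw [one_div, inv_mul_eq_div, le_div_iff₀ hδ]; linarith
    calc u ^ (q - 1) * x ≤ (1 / δ * x) ^ (q - 1) * x := by
          refine mul_le_mul_of_nonneg_right ?_ hx
          exact Real.rpow_le_rpow hu.le hux (by linarith)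
      _ = (1 / δ) ^ (q - 1) * (x ^ (q - 1) * x) := by
          rw [Real.mul_rpow (by positivity) hx]; ring
      _ = (1 / δ) ^ (q - 1) * x ^ q := by rw [← Real.rpow_add_one hx0.ne', sub_add_cancel]
      _ ≤ _ := by linarith

namespace DoublingWeight

variable {w : ℝ → ℝ≥0∞} {κ : ℝ} (hw : DoublingWeight w κ) {g : ℂ → ℂ}
  (hg : DifferentiableOn ℂ g unitDisc) {M : ℝ} (hM : CarlesonSymbol g w M)
include hw hg hM

lemma exists_bergInt_Tg_le_of_bounded {p : ℝ} (hp2 : 2 ≤ p) :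
    ∃ C : ℝ, 0 < C ∧ ∀ f : ℂ → ℂ, DifferentiableOn ℂ f unitDisc →
      (∃ B : ℝ, ∀ z ∈ unitDisc, ‖f z‖ ≤ B) →
      bergInt w p (Tg g f) ≤ ENNReal.ofReal C * bergInt w p f := by
  have hp : 0 < p := by linarith
  obtain ⟨C, hC, hemb⟩ := hw.exists_embedding hM hp
  obtain ⟨C', hC', hsym⟩ := hw.exists_lintegral_symDens_le hM
  set q := p / 2 with hqdef
  have hq1 : 1 ≤ q := by rw [hqdef]; linarith
  have hq : 0 < q := by linarith
  set K : ℝ := 4 * q * q with hK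
  have hK0 : 0 < K := by positivity
  set E : ℝ := 2 ^ q * (C + C') with hE
  have hE0 : 0 < E := by positivity
  set δ : ℝ := 1 / (2 * K * E) with hδ
  have hδ0 : 0 < δ := by positivity
  set D : ℝ := (1 / δ) ^ (q - 1) with hD
  have hD0 : 0 < D := by positivity
  refine ⟨2 * (K * (D * C)), by positivity, fun f hf ⟨B, hB⟩ => ?_⟩
  have hFd : DifferentiableOn ℂ (Tg g f) unitDisc := differentiableOn_Tg hg hf
  have hWt := hw.lintegral_weight_lt_top
  obtain ⟨n, hn⟩ := exists_nat_ge p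
  have hfin : bergInt w p (Tg g f) < ∞ :=
    hw.bergInt_Tg_lt_top_of_bounded hg hM hf hB n p hp
      (by linarith [(Nat.cast_nonneg n : (0 : ℝ) ≤ n)])
  have hS := measurable_symDens g hw.measurable
  refine le_of_forall_le_add_rpow (K := 2 * ∫⁻ z in unitDisc, w ‖z‖) hp
    (ENNReal.mul_ne_top (by simp) hWt.ne) fun ε hε => ?_
  have g1 := hw.lintegral_Tg_rpow_le hg hq1 hf hε
  have g2 := lintegral_sq_add_sq_rpow_le hS (Tg g f) hε hp
  have g3 := lintegral_sq_add_sq_rpow_le (ρ := fun z => w ‖z‖)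
    (hw.measurable.comp measurable_norm) (Tg g f) hε hp
  have h1 := hemb f hf
  have h2 := hemb _ hFd
  change _ ≤ ENNReal.ofReal C * bergInt w p f at h1
  change _ ≤ ENNReal.ofReal C * bergInt w p (Tg g f) at h2
  change _ ≤ _ * (bergInt w p (Tg g f) + _) at g3
  rw [← hqdef] at g2 g3
  have h3 : bergInt w p (Tg g f) ≤ ∫⁻ z in unitDisc,
      ENNReal.ofReal ((‖Tg g f z‖ ^ 2 + ε ^ 2) ^ q) * w ‖z‖ := by
    refine lintegral_mono fun z => mul_le_mul' (ENNReal.ofReal_le_ofReal ?_) le_rfl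
    rw [← sq_rpow_half (norm_nonneg (Tg g f z)) p]
    exact Real.rpow_le_rpow (by positivity) (by linarith [sq_nonneg ε]) hq.le
  have h4 : (∫⁻ z in unitDisc, w ‖z‖) * ENNReal.ofReal (ε ^ p) ≤ ∫⁻ z in unitDisc,
      ENNReal.ofReal ((‖Tg g f z‖ ^ 2 + ε ^ 2) ^ q) * w ‖z‖ := by
    rw [mul_comm, ← lintegral_const_mul' _ _ ENNReal.ofReal_ne_top]
    refine lintegral_mono fun z => mul_le_mul' (ENNReal.ofReal_le_ofReal ?_) le_rfl
    rw [← sq_rpow_half hε.le p]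
    exact Real.rpow_le_rpow (by positivity) (by linarith [sq_nonneg ‖Tg g f z‖]) hq.le
  rw [show 2 * q = p by rw [hqdef]; ring] at g1
  set X := ∫⁻ z in unitDisc, ENNReal.ofReal ((‖Tg g f z‖ ^ 2 + ε ^ 2) ^ q) * w ‖z‖
  have hX : X ≠ ∞ := by
    refine ne_top_of_le_ne_top ?_ g3
    exact ENNReal.mul_ne_top ENNReal.ofReal_ne_top (ENNReal.add_ne_top.2 ⟨hfin.ne,
      ENNReal.mul_ne_top hWt.ne ENNReal.ofReal_ne_top⟩)
  have g4 : ∫⁻ z in unitDisc, ENNReal.ofReal ((‖Tg g f z‖ ^ 2 + ε ^ 2) ^ (q - 1) * ‖f z‖ ^ 2) *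
      symDens g w z ≤ ENNReal.ofReal δ * (∫⁻ z in unitDisc,
        ENNReal.ofReal ((‖Tg g f z‖ ^ 2 + ε ^ 2) ^ q) * symDens g w z) +
      ENNReal.ofReal D * ∫⁻ z in unitDisc, ENNReal.ofReal (‖f z‖ ^ p) * symDens g w z := by
    have hm : AEMeasurable (fun z => ENNReal.ofReal D *
        (ENNReal.ofReal (‖f z‖ ^ p) * symDens g w z)) (volume.restrict unitDisc) := by
      refine AEMeasurable.const_mul (AEMeasurable.mul ?_ hS.aemeasurable) _
      exact ENNReal.measurable_ofReal.comp_aemeasurable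
        ((continuousOn_norm_rpow hf hp).aemeasurable measurableSet_unitDisc)
    rw [← lintegral_const_mul' (ENNReal.ofReal δ) _ ENNReal.ofReal_ne_top,
      ← lintegral_const_mul' (ENNReal.ofReal D) _ ENNReal.ofReal_ne_top,
      ← lintegral_add_right' _ hm]
    refine lintegral_mono fun z => ?_
    rw [← mul_assoc, ← mul_assoc, ← add_mul, ← ENNReal.ofReal_mul hδ0.le,
      ← ENNReal.ofReal_mul hD0.le, ← ENNReal.ofReal_add (by positivity) (by positivity)]
    refine mul_le_mul' (ENNReal.ofReal_le_ofReal ?_) le_rfl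
    have := rpow_sub_one_mul_le (u := ‖Tg g f z‖ ^ 2 + ε ^ 2) (x := ‖f z‖ ^ 2) (by positivity)
      (by positivity) hδ0 hq1
    rwa [hqdef, sq_rpow_half (norm_nonneg (f z)), ← hqdef] at this
  have g5 : ∫⁻ z in unitDisc, ENNReal.ofReal ((‖Tg g f z‖ ^ 2 + ε ^ 2) ^ q) * symDens g w z ≤
      ENNReal.ofReal E * X := by
    calc _ ≤ ENNReal.ofReal (2 ^ q) * (ENNReal.ofReal C * X + ENNReal.ofReal C' * X) := by
          refine g2.trans (mul_le_mul' le_rfl (add_le_add (h2.trans (mul_le_mul' le_rfl h3)) ?_))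
          calc _ ≤ (ENNReal.ofReal C' * ∫⁻ z in unitDisc, w ‖z‖) * ENNReal.ofReal (ε ^ p) :=
                mul_le_mul' hsym le_rfl
            _ = ENNReal.ofReal C' * ((∫⁻ z in unitDisc, w ‖z‖) * ENNReal.ofReal (ε ^ p)) := by
                ring
            _ ≤ _ := mul_le_mul' le_rfl h4
      _ = _ := by
          rw [hE, ENNReal.ofReal_mul (by positivity), ENNReal.ofReal_add hC.le hC'.le]; ring
  have key : X ≤ (ENNReal.ofReal (ε ^ p) * (∫⁻ z in unitDisc, w ‖z‖) +
      ENNReal.ofReal (K * (D * C)) * bergInt w p f) + ENNReal.ofReal (1 / 2) * X := by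
    calc X ≤ ENNReal.ofReal (ε ^ p) * (∫⁻ z in unitDisc, w ‖z‖) + ENNReal.ofReal K *
          (ENNReal.ofReal δ * (ENNReal.ofReal E * X) +
            ENNReal.ofReal D * (ENNReal.ofReal C * bergInt w p f)) :=
          g1.trans (add_le_add le_rfl (mul_le_mul' le_rfl (g4.trans (add_le_add
            (mul_le_mul' le_rfl g5) (mul_le_mul' le_rfl h1)))))
      _ = _ := by
          have e : (1 / 2 : ℝ) = K * (δ * E) := by rw [hδ]; field_simp
          rw [e, ENNReal.ofReal_mul (p := K) (q := D * C) hK0.le,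
            ENNReal.ofReal_mul (p := K) (q := δ * E) hK0.le, ENNReal.ofReal_mul hδ0.le,
            ENNReal.ofReal_mul hD0.le]
          ring
  calc bergInt w p (Tg g f) ≤ X := h3
    _ ≤ _ := ENNReal.le_two_mul_of_le_add_half hX key
    _ = _ := by
        rw [ENNReal.ofReal_mul (p := 2) (by norm_num), ENNReal.ofReal_ofNat]
        ring

/-- Boundedness of the integral operator for a symbol satisfying the Carleson condition. -/
theorem exists_bergInt_Tg_le {p : ℝ} (hp : 0 < p) :
    ∃ C : ℝ, 0 < C ∧ ∀ f : ℂ → ℂ, DifferentiableOn ℂ f unitDisc →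
      bergInt w p (Tg g f) ≤ ENNReal.ofReal C * bergInt w p f := by
  rcases le_total p 2 with h2 | h2
  · exact hw.exists_bergInt_Tg_le_of_le_two hg hM hp h2
  obtain ⟨C, hC, h⟩ := hw.exists_bergInt_Tg_le_of_bounded hg hM h2
  refine ⟨C, hC, fun f hf => ?_⟩
  set ρ : ℕ → ℝ := fun n => 1 - 1 / ((n : ℝ) + 1) with hρdef
  have hρ : ∀ n, ρ n ∈ Ico (0 : ℝ) 1 := fun n => by
    have h1 : 0 < 1 / ((n : ℝ) + 1) := Nat.one_div_pos_of_nat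
    have h2 : 1 / ((n : ℝ) + 1) ≤ 1 := by
      rw [div_le_one (by positivity)]; linarith [(Nat.cast_nonneg n : (0 : ℝ) ≤ n)]
    exact ⟨by simp only [hρdef]; linarith, by simp only [hρdef]; linarith⟩
  have hρ' : ∀ n, ρ n ∈ Icc (0 : ℝ) 1 := fun n => Ico_subset_Icc_self (hρ n)
  have hlim : Tendsto ρ atTop (𝓝 1) := by
    simpa only [sub_zero] using (tendsto_one_div_add_atTop_nhds_zero_nat (𝕜 := ℝ)).const_sub 1
  have hbd : ∀ n, bergInt w p (Tg g fun ζ => f (ρ n * ζ)) ≤ ENNReal.ofReal C * bergInt w p f := by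
    intro n
    refine (h _ (differentiableOn_dilate hf (hρ' n)) ?_).trans
      (mul_le_mul' le_rfl (lintegral_dilate_le hf hp (hρ n) hw.measurable))
    have hmem : (ρ n : ℂ) ∈ unitDisc := by
      change ‖(ρ n : ℂ)‖ < 1
      rw [Complex.norm_real, Real.norm_of_nonneg (hρ n).1]; exact (hρ n).2
    obtain ⟨B, hB⟩ := (isCompact_closedBall (0 : ℂ) ‖(ρ n : ℂ)‖).exists_bound_of_continuousOn
      (hf.continuousOn.mono (closedBall_subset_unitDisc hmem))
    refine ⟨B, fun z hz => hB _ ?_⟩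
    rw [mem_closedBall_zero_iff, norm_mul]
    exact mul_le_of_le_one_right (norm_nonneg _) (le_of_lt hz)
  have hm : ∀ n, AEMeasurable (fun z => ENNReal.ofReal (‖Tg g (fun ζ => f (ρ n * ζ)) z‖ ^ p) *
      w ‖z‖) (volume.restrict unitDisc) := fun n => by
    refine AEMeasurable.mul ?_ (hw.measurable.comp measurable_norm).aemeasurable
    exact ENNReal.measurable_ofReal.comp_aemeasurable ((continuousOn_norm_rpow
      (differentiableOn_Tg hg (differentiableOn_dilate hf (hρ' n))) hp).aemeasurable
        measurableSet_unitDisc)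
  calc bergInt w p (Tg g f) ≤ ∫⁻ z in unitDisc, liminf (fun n =>
        ENNReal.ofReal (‖Tg g (fun ζ => f (ρ n * ζ)) z‖ ^ p) * w ‖z‖) atTop := by
        refine setLIntegral_mono' measurableSet_unitDisc fun z hz => ?_
        have ht := tendsto_Tg_dilate hg hf hρ' hlim hz
        have ht' : Tendsto (fun n => ENNReal.ofReal (‖Tg g (fun ζ => f (ρ n * ζ)) z‖ ^ p)) atTop
            (𝓝 (ENNReal.ofReal (‖Tg g f z‖ ^ p))) :=
          ENNReal.tendsto_ofReal (ht.norm.rpow_const (Or.inr hp.le))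
        rcases eq_or_ne (w ‖z‖) ∞ with htop | htop
        · rcases eq_or_ne (Tg g f z) 0 with h0 | h0
          · simp [h0, Real.zero_rpow hp.ne']
          · refine (ENNReal.Tendsto.mul_const ht' (Or.inl ?_)).liminf_eq.ge
            exact (ENNReal.ofReal_pos.2 (by positivity)).ne'
        · exact (ENNReal.Tendsto.mul_const ht' (Or.inr htop)).liminf_eq.ge
    _ ≤ liminf (fun n => bergInt w p (Tg g fun ζ => f (ρ n * ζ))) atTop :=
        lintegral_liminf_le' hm
    _ ≤ _ := by
        refine liminf_le_of_frequently_le' (Frequently.of_forall hbd)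

end DoublingWeight

/-- The iterates of `ε • T_g` applied to `k`. -/
def iterTg (g : ℂ → ℂ) (ε : ℝ) (k : ℂ → ℂ) : ℕ → ℂ → ℂ
  | 0 => k
  | n + 1 => fun z => ε * Tg g (iterTg g ε k n) z

lemma differentiableOn_iterTg {g k : ℂ → ℂ} (hg : DifferentiableOn ℂ g unitDisc)
    (hk : DifferentiableOn ℂ k unitDisc) (ε : ℝ) :
    ∀ n, DifferentiableOn ℂ (iterTg g ε k n) unitDisc
  | 0 => hk
  | n + 1 => (differentiableOn_Tg hg (differentiableOn_iterTg hg hk ε n)).const_mul _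

lemma deriv_iterTg {g k : ℂ → ℂ} (hg : DifferentiableOn ℂ g unitDisc)
    (hk : DifferentiableOn ℂ k unitDisc) (ε : ℝ) (n : ℕ) {z : ℂ} (hz : z ∈ unitDisc) :
    deriv (iterTg g ε k (n + 1)) z = ε * (iterTg g ε k n z * deriv g z) :=
  ((hasDerivAt_Tg hg (differentiableOn_iterTg hg hk ε n) hz).const_mul (ε : ℂ)).deriv

lemma sum_rpow_le {x : ℕ → ℝ} (hx : ∀ n, 0 ≤ x n) {q : ℝ} (hq : 0 < q) (hq1 : q ≤ 1) (N : ℕ) :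
    (∑ i ∈ Finset.range N, x i) ^ q ≤ ∑ i ∈ Finset.range N, x i ^ q := by
  induction N with
  | zero => simp [Real.zero_rpow hq.ne']
  | succ N ih =>
    rw [Finset.sum_range_succ, Finset.sum_range_succ]
    exact (Real.rpow_add_le_add_rpow (Finset.sum_nonneg fun i _ => hx i) (hx N) hq.le hq1).trans
      (by gcongr)

lemma aemeasurable_norm_rpow {f : ℂ → ℂ} (hf : DifferentiableOn ℂ f unitDisc) {p : ℝ}
    (hp : 0 < p) {ρ : ℂ → ℝ≥0∞} (hρ : Measurable ρ) :
    AEMeasurable (fun z => ENNReal.ofReal (‖f z‖ ^ p) * ρ z) (volume.restrict unitDisc) :=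
  (ENNReal.measurable_ofReal.comp_aemeasurable
    ((continuousOn_norm_rpow hf hp).aemeasurable measurableSet_unitDisc)).mul hρ.aemeasurable

lemma bergInt_const_mul {w : ℝ → ℝ≥0∞} {p ε : ℝ} (hε : 0 ≤ ε) (f : ℂ → ℂ) :
    bergInt w p (fun z => ε * f z) = ENNReal.ofReal (ε ^ p) * bergInt w p f := by
  rw [bergInt, bergInt, ← lintegral_const_mul' _ _ ENNReal.ofReal_ne_top]
  refine lintegral_congr fun z => ?_
  rw [norm_mul, Complex.norm_real, Real.norm_of_nonneg hε, Real.mul_rpow hε (norm_nonneg _),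
    ENNReal.ofReal_mul (by positivity), mul_assoc]

section Necessity

variable {w : ℝ → ℝ≥0∞} (hw : Measurable w) {g : ℂ → ℂ}
  (hg : DifferentiableOn ℂ g unitDisc) {p : ℝ} {C : ℝ} (hC : 0 < C)
  (hT : ∀ f : ℂ → ℂ, DifferentiableOn ℂ f unitDisc →
    bergInt w p (Tg g f) ≤ ENNReal.ofReal C * bergInt w p f)
include hw hg hC hT

lemma exists_lintegral_symDens_le_of_two_le (hp : 2 ≤ p) :
    ∃ D : ℝ, 0 < D ∧ ∀ k : ℂ → ℂ, DifferentiableOn ℂ k unitDisc → (∀ z ∈ unitDisc, k z ≠ 0) →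
      ∫⁻ z in unitDisc, ENNReal.ofReal (‖k z‖ ^ p) * symDens g w z ≤
        ENNReal.ofReal D * bergInt w p k := by
  set q := p / 2 with hqdef
  have hq1 : 1 ≤ q := by rw [hqdef]; linarith
  have hq : 0 < q := by linarith
  set c : ℝ := 4 * q * min 1 q with hc
  have hc0 : 0 < c := by positivity
  refine ⟨1 / c * (2 ^ q * (C + 1)), by positivity, fun k hk hk0 => ?_⟩
  have hFd := differentiableOn_Tg hg hk
  have e : ∀ z, vecSq ![Tg g k, k] z = ‖Tg g k z‖ ^ 2 + ‖k z‖ ^ 2 := fun z => by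
    simp [vecSq, Fin.sum_univ_two]
  have e' : ∀ z, vecDerivSq ![Tg g k, k] z = ‖deriv (Tg g k) z‖ ^ 2 + ‖deriv k z‖ ^ 2 := fun z => by
    simp [vecDerivSq, Fin.sum_univ_two]
  have hdiff : ∀ i, DifferentiableOn ℂ (![Tg g k, k] i) unitDisc := by
    intro i; fin_cases i
    · exact hFd
    · exact hk
  have g1 := le_lintegral_vecSq_rpow hdiff hq (fun z hz => by
    rw [e]; have := norm_pos_iff.2 (hk0 z hz); positivity) hw
  simp only [e, e'] at g1
  have g2 := ENNReal.le_ofReal_one_div_mul hc0 g1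
  have g3 : ∫⁻ z in unitDisc, ENNReal.ofReal (‖k z‖ ^ p) * symDens g w z ≤
      ∫⁻ z in unitDisc, ENNReal.ofReal ((‖Tg g k z‖ ^ 2 + ‖k z‖ ^ 2) ^ (q - 1) *
        (‖deriv (Tg g k) z‖ ^ 2 + ‖deriv k z‖ ^ 2)) * starWeight w ‖z‖ := by
    refine setLIntegral_mono' measurableSet_unitDisc fun z hz => ?_
    have hpos := norm_pos_iff.2 (hk0 z hz)
    rw [symDens, ← mul_assoc, ← ENNReal.ofReal_mul (by positivity), deriv_Tg hg hk hz, norm_mul,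
      mul_pow]
    refine mul_le_mul' (ENNReal.ofReal_le_ofReal ?_) le_rfl
    have h1 : ‖k z‖ ^ p = (‖k z‖ ^ 2) ^ (q - 1) * ‖k z‖ ^ 2 := by
      rw [← Real.rpow_add_one (by positivity), sub_add_cancel, hqdef, sq_rpow_half hpos.le]
    rw [h1, mul_assoc]
    have h2 : (‖k z‖ ^ 2) ^ (q - 1) ≤ (‖Tg g k z‖ ^ 2 + ‖k z‖ ^ 2) ^ (q - 1) :=
      Real.rpow_le_rpow (by positivity) (by linarith [sq_nonneg ‖Tg g k z‖]) (by linarith)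
    gcongr
    linarith [sq_nonneg ‖deriv k z‖]
  have g4 : ∫⁻ z in unitDisc, ENNReal.ofReal ((‖Tg g k z‖ ^ 2 + ‖k z‖ ^ 2) ^ q) * w ‖z‖ ≤
      ENNReal.ofReal (2 ^ q) * (bergInt w p (Tg g k) + bergInt w p k) := by
    rw [bergInt, bergInt, ← lintegral_add_left' (aemeasurable_norm_rpow (p := p)
      (ρ := fun z => w ‖z‖) hFd (by linarith) (hw.comp measurable_norm)),
      ← lintegral_const_mul' _ _ ENNReal.ofReal_ne_top]
    refine lintegral_mono fun z => ?_
    have h := add_rpow_le (x := ‖Tg g k z‖ ^ 2) (y := ‖k z‖ ^ 2) (by positivity) (by positivity) hq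
    rw [hqdef, sq_rpow_half (norm_nonneg _), sq_rpow_half (norm_nonneg _), ← hqdef] at h
    rw [← add_mul, ← ENNReal.ofReal_add (by positivity) (by positivity), ← mul_assoc,
      ← ENNReal.ofReal_mul (by positivity)]
    gcongr
  calc _ ≤ ENNReal.ofReal (1 / c) * (ENNReal.ofReal (2 ^ q) *
        (ENNReal.ofReal C * bergInt w p k + bergInt w p k)) :=
        g3.trans (g2.trans (mul_le_mul' le_rfl (g4.trans (mul_le_mul' le_rfl
          (add_le_add (hT k hk) le_rfl)))))
    _ = _ := by
        rw [ENNReal.ofReal_mul (by positivity), ENNReal.ofReal_mul (by positivity),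
          ENNReal.ofReal_add hC.le zero_le_one, ENNReal.ofReal_one]
        ring

lemma exists_lintegral_symDens_le_of_le_two (hw0 : ∀ r ∈ Ico (0 : ℝ) 1, w r ≠ 0) (hp : 0 < p)
    (hp2 : p ≤ 2) :
    ∃ D : ℝ, 0 < D ∧ ∀ k : ℂ → ℂ, DifferentiableOn ℂ k unitDisc → (∀ z ∈ unitDisc, k z ≠ 0) →
      ∫⁻ z in unitDisc, ENNReal.ofReal (‖k z‖ ^ p) * symDens g w z ≤
        ENNReal.ofReal D * bergInt w p k := by
  set q := p / 2 with hqdef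
  have hq : 0 < q := by positivity
  have hq1 : q ≤ 1 := by rw [hqdef]; linarith
  set c : ℝ := 4 * q * min 1 q with hc
  have hc0 : 0 < c := by positivity
  set ε : ℝ := (1 / (2 * C)) ^ (1 / p) with hε
  have hε0 : 0 < ε := by positivity
  have hεp : ε ^ p = 1 / (2 * C) := by
    rw [hε, ← Real.rpow_mul (by positivity), one_div_mul_cancel hp.ne', Real.rpow_one]
  set b : ℝ := ε ^ 2 * 2 ^ (q - 1) with hb
  have hb0 : 0 < b := by positivity
  refine ⟨1 / (c * b) * 2, by positivity, fun k hk hk0 => ?_⟩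
  rcases eq_or_ne (bergInt w p k) ∞ with htop | hfin
  · rw [htop, ENNReal.mul_top (ENNReal.ofReal_pos.2 (by positivity)).ne']; exact le_top
  set F := iterTg g ε k with hF
  have hFd : ∀ n, DifferentiableOn ℂ (F n) unitDisc := differentiableOn_iterTg hg hk ε
  have hnorm : ∀ n, bergInt w p (F n) ≤ 2⁻¹ ^ n * bergInt w p k := by
    intro n
    induction n with
    | zero => simp [hF, iterTg]
    | succ n ih =>
      calc bergInt w p (F (n + 1)) = ENNReal.ofReal (ε ^ p) * bergInt w p (Tg g (F n)) :=
            bergInt_const_mul hε0.le _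
        _ ≤ ENNReal.ofReal (ε ^ p) * (ENNReal.ofReal C * (2⁻¹ ^ n * bergInt w p k)) :=
            mul_le_mul' le_rfl ((hT _ (hFd n)).trans (mul_le_mul' le_rfl ih))
        _ = _ := by
            have : ENNReal.ofReal (ε ^ p) * ENNReal.ofReal C = 2⁻¹ := by
              rw [← ENNReal.ofReal_mul (by positivity), hεp,
                show 1 / (2 * C) * C = 2⁻¹ by field_simp, ENNReal.ofReal_inv_of_pos (by norm_num)]
              simp
            rw [← mul_assoc, this, pow_succ]
            ring
  have htsum : ∑' n, bergInt w p (F n) ≤ 2 * bergInt w p k := by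
    calc _ ≤ ∑' n, 2⁻¹ ^ n * bergInt w p k := ENNReal.tsum_le_tsum hnorm
      _ = _ := by rw [ENNReal.tsum_mul_right, ENNReal.tsum_geometric_two]
  set S : ℕ → ℂ → ℝ := fun N z => ∑ i ∈ Finset.range N, ‖F i z‖ ^ 2 with hS
  have hSk : ∀ N z, ‖k z‖ ^ 2 ≤ S (N + 1) z := fun N z => by
    have := Finset.single_le_sum (f := fun i => ‖F i z‖ ^ 2) (s := Finset.range (N + 1))
      (fun i _ => by positivity) (Finset.mem_range.2 N.succ_pos)
    exact this
  have hS0 : ∀ N z, 0 ≤ S N z := fun N z => Finset.sum_nonneg fun i _ => by positivity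
  have hSpos : ∀ N, ∀ z ∈ unitDisc, 0 < S (N + 1) z := fun N z hz =>
    (pow_pos (norm_pos_iff.2 (hk0 z hz)) 2).trans_le (hSk N z)
  have hSc : ∀ N, ContinuousOn (S N) unitDisc := fun N =>
    continuousOn_finsetSum _ fun i _ => (hFd i).continuousOn.norm.pow 2
  have hbound : ∀ N, ∫⁻ z in unitDisc, ENNReal.ofReal (S (N + 1) z ^ (q - 1) * S N z) *
      symDens g w z ≤ ENNReal.ofReal (1 / (c * ε ^ 2)) * (2 * bergInt w p k) := by
    intro N
    have e : ∀ z, vecSq (fun i : Fin (N + 1) => F i) z = S (N + 1) z := fun z =>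
      Fin.sum_univ_eq_sum_range (fun i => ‖F i z‖ ^ 2) (N + 1)
    have e' : ∀ z, vecDerivSq (fun i : Fin (N + 1) => F i) z =
        ∑ i ∈ Finset.range (N + 1), ‖deriv (F i) z‖ ^ 2 := fun z =>
      Fin.sum_univ_eq_sum_range (fun i => ‖deriv (F i) z‖ ^ 2) (N + 1)
    have g1 := le_lintegral_vecSq_rpow (F := fun i : Fin (N + 1) => F i) (fun i => hFd i) hq
      (fun z hz => by rw [e]; exact hSpos N z hz) hw
    simp only [e, e'] at g1
    refine ENNReal.le_ofReal_one_div_mul (by positivity) ?_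
    have g2 : ∫⁻ z in unitDisc, ENNReal.ofReal (S (N + 1) z ^ q) * w ‖z‖ ≤
        2 * bergInt w p k := by
      refine le_trans ?_ ((ENNReal.sum_le_tsum (Finset.range (N + 1))).trans htsum)
      simp only [bergInt]
      rw [← lintegral_finsetSum' _ fun i _ => aemeasurable_norm_rpow (ρ := fun z => w ‖z‖)
        (hFd i) hp (hw.comp measurable_norm)]
      refine lintegral_mono fun z => ?_
      rw [← Finset.sum_mul, ← ENNReal.ofReal_sum_of_nonneg fun i _ => by positivity]
      refine mul_le_mul' (ENNReal.ofReal_le_ofReal ?_) le_rfl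
      have := sum_rpow_le (x := fun i => ‖F i z‖ ^ 2) (fun i => by positivity) hq hq1 (N + 1)
      simpa only [hqdef, sq_rpow_half (norm_nonneg _)] using this
    refine le_trans ?_ (g1.trans g2)
    rw [ENNReal.ofReal_mul hc0.le, mul_assoc]
    refine mul_le_mul' le_rfl ?_
    rw [← lintegral_const_mul' _ _ ENNReal.ofReal_ne_top]
    refine setLIntegral_mono' measurableSet_unitDisc fun z hz => ?_
    have := hS0 N z
    have := hS0 (N + 1) z
    rw [symDens, ← mul_assoc, ← mul_assoc, ← ENNReal.ofReal_mul (by positivity),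
      ← ENNReal.ofReal_mul (by positivity)]
    refine mul_le_mul' (ENNReal.ofReal_le_ofReal ?_) le_rfl
    rw [show ε ^ 2 * (S (N + 1) z ^ (q - 1) * S N z) * ‖deriv g z‖ ^ 2 =
      S (N + 1) z ^ (q - 1) * (ε ^ 2 * S N z * ‖deriv g z‖ ^ 2) by ring]
    refine mul_le_mul_of_nonneg_left ?_ (by positivity)
    rw [Finset.sum_range_succ', hS]
    refine le_add_of_le_of_nonneg (le_of_eq ?_) (by positivity)
    rw [Finset.mul_sum, Finset.sum_mul]
    refine Finset.sum_congr rfl fun i _ => ?_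
    rw [hF, deriv_iterTg hg hk ε i hz, norm_mul, norm_mul, Complex.norm_real,
      Real.norm_of_nonneg hε0.le]
    ring
  have hae : ∀ᵐ z ∂volume.restrict unitDisc, ∀ᶠ n in atTop, ‖F n z‖ ≤ ‖k z‖ := by
    have hm : ∀ n, AEMeasurable (fun z => ENNReal.ofReal (‖F n z‖ ^ p) * w ‖z‖)
        (volume.restrict unitDisc) := fun n =>
      aemeasurable_norm_rpow (hFd n) hp (hw.comp measurable_norm)
    have h1 : ∫⁻ z in unitDisc, ∑' n, ENNReal.ofReal (‖F n z‖ ^ p) * w ‖z‖ ≠ ∞ := by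
      rw [lintegral_tsum hm]
      exact ne_top_of_le_ne_top (ENNReal.mul_ne_top (by simp) hfin) htsum
    filter_upwards [ae_lt_top' (AEMeasurable.tsum hm) h1,
      ae_restrict_mem measurableSet_unitDisc] with z hz hzD
    have hlim := ENNReal.tendsto_atTop_zero_of_tsum_ne_top hz.ne
    have hk' : 0 < ENNReal.ofReal (‖k z‖ ^ p) * w ‖z‖ := by
      refine ENNReal.mul_pos ?_ (hw0 _ ⟨norm_nonneg z, hzD⟩)
      have := norm_pos_iff.2 (hk0 z hzD)
      exact (ENNReal.ofReal_pos.2 (by positivity)).ne'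
    filter_upwards [hlim.eventually_lt_const hk'] with n hn
    have h2 := lt_of_mul_lt_mul_right' hn
    have h3 := ((ENNReal.ofReal_lt_ofReal_iff_of_nonneg (by positivity)).1 h2).le
    exact (Real.rpow_le_rpow_iff (norm_nonneg _) (norm_nonneg _) hp).1 h3
  have key : ENNReal.ofReal (2 ^ (q - 1)) *
      ∫⁻ z in unitDisc, ENNReal.ofReal (‖k z‖ ^ p) * symDens g w z ≤
        ENNReal.ofReal (1 / (c * ε ^ 2)) * (2 * bergInt w p k) := by
    have hmeas : ∀ N, AEMeasurable (fun z => ENNReal.ofReal (S (N + 1) z ^ (q - 1) * S N z) *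
        symDens g w z) (volume.restrict unitDisc) := fun N => by
      refine AEMeasurable.mul (ENNReal.measurable_ofReal.comp_aemeasurable ?_)
        (measurable_symDens g hw).aemeasurable
      refine ContinuousOn.aemeasurable ?_ measurableSet_unitDisc
      exact ((hSc (N + 1)).rpow_const fun z hz => Or.inl (hSpos N z hz).ne').mul (hSc N)
    calc _ = ∫⁻ z in unitDisc, ENNReal.ofReal (2 ^ (q - 1)) *
          (ENNReal.ofReal (‖k z‖ ^ p) * symDens g w z) :=
          (lintegral_const_mul' _ _ ENNReal.ofReal_ne_top).symm
      _ ≤ ∫⁻ z in unitDisc, liminf (fun N =>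
          ENNReal.ofReal (S (N + 1) z ^ (q - 1) * S N z) * symDens g w z) atTop := by
          refine lintegral_mono_ae ?_
          filter_upwards [hae, ae_restrict_mem measurableSet_unitDisc] with z hz hzD
          refine le_liminf_of_le (by isBoundedDefault) ?_
          filter_upwards [hz, eventually_ge_atTop 1] with n hn hn1
          obtain ⟨m, rfl⟩ := Nat.exists_eq_add_of_le' hn1
          have hSm := hSpos m z hzD
          have h1 : S (m + 1 + 1) z ≤ 2 * S (m + 1) z := by
            have h2 : ‖F (m + 1) z‖ ^ 2 ≤ ‖k z‖ ^ 2 := by gcongr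
            have h3 := hSk m z
            simp only [hS] at h3 ⊢
            rw [Finset.sum_range_succ _ (m + 1)]
            linarith
          rw [← mul_assoc, ← ENNReal.ofReal_mul (by positivity)]
          refine mul_le_mul' (ENNReal.ofReal_le_ofReal ?_) le_rfl
          have h4 := hSpos (m + 1) z hzD
          calc 2 ^ (q - 1) * ‖k z‖ ^ p = 2 ^ (q - 1) * (‖k z‖ ^ 2) ^ q := by
                rw [hqdef, sq_rpow_half (norm_nonneg _)]
            _ ≤ 2 ^ (q - 1) * (S (m + 1) z) ^ q := by gcongr; exact hSk m z
            _ = (2 * S (m + 1) z) ^ (q - 1) * S (m + 1) z := by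
                rw [Real.mul_rpow (by norm_num) hSm.le, mul_assoc,
                  ← Real.rpow_add_one hSm.ne', sub_add_cancel]
            _ ≤ _ := by
                refine mul_le_mul_of_nonneg_right ?_ hSm.le
                exact Real.rpow_le_rpow_of_nonpos h4 h1 (by linarith)
      _ ≤ liminf (fun N => ∫⁻ z in unitDisc,
          ENNReal.ofReal (S (N + 1) z ^ (q - 1) * S N z) * symDens g w z) atTop :=
          lintegral_liminf_le' hmeas
      _ ≤ _ := liminf_le_of_frequently_le' (Frequently.of_forall hbound)
  refine (ENNReal.le_ofReal_one_div_mul (by positivity) key).trans (le_of_eq ?_)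
  rw [← mul_assoc, ← mul_assoc, ← ENNReal.ofReal_mul (by positivity), ← ENNReal.ofReal_ofNat,
    ← ENNReal.ofReal_mul (by positivity)]
  congr 2
  rw [hb]
  field_simp

end Necessity

/-- Every Carleson square carries a kernel which is bounded below there and whose parameter is
adapted to the size of the square. -/
lemma exists_diskKer_lower_bound (θ : ℝ) {h : ℝ} (h0 : 0 < h) :
    ∃ a : ℂ, ‖a‖ < 1 ∧ 1 - ‖a‖ ≤ h ∧ ∀ z ∈ CBox θ h, 2 / 5 ≤ ‖diskKer a z‖ := by
  set d := min h 1 with hd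
  have hd0 : 0 < d := lt_min h0 one_pos
  have hd1 : d ≤ 1 := min_le_right _ _
  set a : ℂ := ((1 - d : ℝ) : ℂ) * Complex.exp (θ * Complex.I) with ha
  have hna : ‖a‖ = 1 - d := by
    rw [ha, norm_mul, Complex.norm_exp_ofReal_mul_I, mul_one, Complex.norm_real,
      Real.norm_of_nonneg (by linarith)]
  have ha1 : ‖a‖ < 1 := by linarith
  refine ⟨a, ha1, by rw [hna]; linarith [min_le_left h 1], fun z hz => ?_⟩
  obtain ⟨h1, h2, h3⟩ := hz
  rw [norm_diskKer ha1, hna]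
  have hpos := norm_pos_iff.2 (one_sub_conj_mul_ne_zero ha1 (show z ∈ unitDisc from h2))
  set u := z * Complex.exp (-(θ : ℂ) * Complex.I) with hu
  have hnu : ‖u‖ = ‖z‖ := norm_rotate z θ
  have e : conj a * z = ((1 - d : ℝ) : ℂ) * u := by
    rw [ha, hu, map_mul, Complex.conj_ofReal, ← Complex.exp_conj, map_mul, Complex.conj_ofReal,
      Complex.conj_I, mul_neg, neg_mul]
    ring
  rw [le_div_iff₀ hpos]
  have key : ‖1 - conj a * z‖ ≤ 5 / 2 * d := by
    rw [e]
    rcases le_total h 1 with h4 | h4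
    · have hdh : d = h := min_eq_left h4
      have e1 : 1 - ((1 - d : ℝ) : ℂ) * u =
          ((1 - ‖u‖ : ℝ) : ℂ) - (u - ‖u‖) + (d : ℂ) * u := by push_cast; ring
      have e2 : ‖u - ‖u‖‖ ≤ 1 * (h / 2) :=
        (norm_sub_norm_le_mul_abs_arg u).trans (by gcongr; rw [hnu]; exact h2.le)
      have e3 : ‖((1 - ‖u‖ : ℝ) : ℂ)‖ ≤ h := by
        rw [Complex.norm_real, Real.norm_of_nonneg (by linarith)]; linarith
      have e4 : ‖(d : ℂ) * u‖ ≤ d * 1 := by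
        rw [norm_mul, Complex.norm_real, Real.norm_of_nonneg hd0.le, hnu]; gcongr
      rw [e1]
      have := norm_add_le (((1 - ‖u‖ : ℝ) : ℂ) - (u - ‖u‖)) ((d : ℂ) * u)
      have := norm_sub_le ((1 - ‖u‖ : ℝ) : ℂ) (u - ‖u‖)
      linarith
    · have hdh : d = 1 := min_eq_right h4
      rw [hdh]; norm_num
  nlinarith

namespace DoublingWeight

variable {w : ℝ → ℝ≥0∞} {κ : ℝ} (hw : DoublingWeight w κ)
include hw

lemma radMeasure_ball_le_CBox (θ : ℝ) {h : ℝ} (h0 : 0 < h) (h1 : h ≤ 2 * Real.pi) {a : ℂ}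
    (ha : ‖a‖ < 1) (hah : 1 - ‖a‖ ≤ h) :
    radMeasure w (Metric.ball a (2 * (1 - ‖a‖))) ≤
      ENNReal.ofReal (32 ^ (κ + 1) * 2 ^ (κ + 1) * 2 ^ (κ + 1)) * radMeasure w (CBox θ h) := by
  have g1 := hw.measure_ball_le (radMeasure_compl w) (M := 1) (fun θ h h0 h1 => by
    rw [one_mul]; exact radMeasure_CBox_le hw.measurable θ h1) ha le_rfl
  rw [one_mul] at g1
  have g2 : boxSize w (2 * (1 - ‖a‖)) ≤ boxSize w (2 * h) := boxSize_mono w (by linarith)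
  have g3 : boxSize w (2 * h) ≤ ENNReal.ofReal (2 ^ (κ + 1)) * boxSize w h := by
    have := hw.boxSize_growth h0 (show h ≤ 2 * h by linarith)
    rwa [mul_div_cancel_right₀ _ h0.ne'] at this
  calc _ ≤ ENNReal.ofReal (32 ^ (κ + 1)) * (ENNReal.ofReal (2 ^ (κ + 1)) *
        (ENNReal.ofReal (2 ^ (κ + 1)) * radMeasure w (CBox θ h))) :=
        g1.trans (mul_le_mul' le_rfl (g2.trans (g3.trans (mul_le_mul' le_rfl
          (hw.boxSize_le θ h0 h1)))))
    _ = _ := by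
        rw [ENNReal.ofReal_mul (by positivity), ENNReal.ofReal_mul (by positivity)]; ring

/-- Test functions adapted to Carleson squares. -/
lemma exists_test_function {p : ℝ} (hp : 0 < p) :
    ∃ c C : ℝ, 0 < c ∧ 0 < C ∧ ∀ θ h : ℝ, 0 < h → h ≤ 2 * Real.pi → ∃ k : ℂ → ℂ,
      DifferentiableOn ℂ k unitDisc ∧ (∀ z ∈ unitDisc, k z ≠ 0) ∧
      (∀ z ∈ CBox θ h, c ≤ ‖k z‖ ^ p) ∧
      bergInt w p k ≤ ENNReal.ofReal C * ∫⁻ z in CBox θ h, w ‖z‖ := by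
  obtain ⟨n, hn⟩ := exists_nat_ge ((κ + 2) / p)
  have hγ : κ + 2 ≤ n * p := (div_le_iff₀ hp).1 hn
  refine ⟨((2 / 5) ^ n) ^ p, 2 ^ (n * p) * 192 ^ (κ + 1) * 2 *
    (32 ^ (κ + 1) * 2 ^ (κ + 1) * 2 ^ (κ + 1)), by positivity, by positivity,
    fun θ h h0 h1 => ?_⟩
  obtain ⟨a, ha, hah, hlow⟩ := exists_diskKer_lower_bound θ h0
  have hd : DifferentiableOn ℂ (fun z => diskKer a z ^ n) unitDisc :=
    (differentiableOn_diskKer ha).pow n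
  refine ⟨fun z => diskKer a z ^ n, hd, fun z hz => pow_ne_zero n
    (norm_pos_iff.1 (norm_diskKer_pos ha hz)), fun z hz => ?_, ?_⟩
  · rw [norm_pow]
    have := hlow z hz
    gcongr
  have h2 := hw.lintegral_mul_diskKer_le (φ := fun _ => 1) measurable_const ha (N := 1)
    (fun R _ _ => by simp) hγ
  have h3 : bergInt w p (fun z => diskKer a z ^ n) ≤
      ∫⁻ z, 1 * ENNReal.ofReal (‖diskKer a z‖ ^ (n * p)) ∂radMeasure w := by
    rw [bergInt, lintegral_absPow_eq hw.measurable (measurable_absPow hd hp)]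
    refine lintegral_mono fun z => ?_
    rw [one_mul]
    refine (indicator_le_self _ _ z).trans (le_of_eq ?_)
    simp only [norm_pow]
    rw [← Real.rpow_natCast, ← Real.rpow_mul (norm_nonneg _)]
  have h4 := hw.radMeasure_ball_le_CBox θ h0 h1 ha hah
  refine h3.trans (h2.trans ?_)
  rw [mul_one]
  refine (mul_le_mul' le_rfl h4).trans (le_of_eq ?_)
  rw [← mul_assoc, ← ENNReal.ofReal_mul (by positivity), radMeasure, withDensity_apply_CBox]

/-- Boundedness of the integral operator forces the Carleson condition on its symbol. -/
theorem exists_carlesonSymbol (hw0 : ∀ r ∈ Ico (0 : ℝ) 1, w r ≠ 0) {g : ℂ → ℂ}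
    (hg : DifferentiableOn ℂ g unitDisc) {p : ℝ} (hp : 0 < p) {C : ℝ} (hC : 0 < C)
    (hT : ∀ f : ℂ → ℂ, DifferentiableOn ℂ f unitDisc →
      bergInt w p (Tg g f) ≤ ENNReal.ofReal C * bergInt w p f) :
    ∃ M, CarlesonSymbol g w M := by
  obtain ⟨D, hD, hsym⟩ : ∃ D : ℝ, 0 < D ∧ ∀ k : ℂ → ℂ, DifferentiableOn ℂ k unitDisc →
      (∀ z ∈ unitDisc, k z ≠ 0) →
      ∫⁻ z in unitDisc, ENNReal.ofReal (‖k z‖ ^ p) * symDens g w z ≤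
        ENNReal.ofReal D * bergInt w p k := by
    rcases le_total p 2 with h2 | h2
    · exact exists_lintegral_symDens_le_of_le_two hw.measurable hg hC hT hw0 hp h2
    · exact exists_lintegral_symDens_le_of_two_le hw.measurable hg hC hT h2
  obtain ⟨c, B, hc, hB, htest⟩ := hw.exists_test_function hp
  refine ⟨1 / c * (D * B), fun θ h h0 h1 => ?_⟩
  obtain ⟨k, hk, hk0, hlow, hnorm⟩ := htest θ h h0 h1
  rw [ENNReal.ofReal_mul (by positivity), mul_assoc]
  refine ENNReal.le_ofReal_one_div_mul hc ?_
  calc _ = ∫⁻ z in CBox θ h, ENNReal.ofReal c * symDens g w z :=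
        (lintegral_const_mul' _ _ ENNReal.ofReal_ne_top).symm
    _ ≤ ∫⁻ z in CBox θ h, ENNReal.ofReal (‖k z‖ ^ p) * symDens g w z := by
        refine setLIntegral_mono' (measurableSet_CBox θ h) fun z hz => ?_
        have := hlow z hz
        gcongr
    _ ≤ ∫⁻ z in unitDisc, ENNReal.ofReal (‖k z‖ ^ p) * symDens g w z :=
        lintegral_mono_set (CBox_subset θ h)
    _ ≤ ENNReal.ofReal D * (ENNReal.ofReal B * ∫⁻ z in CBox θ h, w ‖z‖) :=
        (hsym k hk hk0).trans (mul_le_mul' le_rfl hnorm)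
    _ = _ := by rw [← mul_assoc, ← ENNReal.ofReal_mul hD.le]

end DoublingWeight

section Translation

variable {ω : ℝ → ℝ}

lemma lintegral_norm_rpow_mul_weight (p : ℝ) (f : ℂ → ℂ) :
    ∫⁻ z in unitDisc, ENNReal.ofReal (‖f z‖ ^ p * ω ‖z‖) = bergInt (extWeight ω) p f := by
  refine setLIntegral_congr_fun measurableSet_unitDisc fun z hz => ?_
  rw [ENNReal.ofReal_mul (by positivity), extWeight_of_mem ⟨norm_nonneg z, hz⟩]

lemma lintegral_CBox_weight (θ h : ℝ) :
    ∫⁻ z in CBox θ h, ENNReal.ofReal (ω ‖z‖) = ∫⁻ z in CBox θ h, extWeight ω ‖z‖ := by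
  refine setLIntegral_congr_fun (measurableSet_CBox θ h) fun z hz => ?_
  rw [extWeight_of_mem ⟨norm_nonneg z, hz.2.1⟩]

lemma lintegral_CBox_symDens (hω : IsRadialWeight ω) (g : ℂ → ℂ) (θ h : ℝ) :
    ∫⁻ z in CBox θ h, ENNReal.ofReal (‖deriv g z‖ ^ 2 * wStar ω z) =
      ∫⁻ z in CBox θ h, symDens g (extWeight ω) z := by
  refine lintegral_congr_ae ?_
  filter_upwards [ae_restrict_mem (measurableSet_CBox θ h),
    ae_restrict_of_ae (Measure.ae_ne volume (0 : ℂ))] with z hz hz0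
  rw [ENNReal.ofReal_mul (by positivity), symDens,
    ofReal_wStar hω (norm_pos_iff.2 hz0) hz.2.1]

end Translation

end

theorem stmt18 (p : ℝ) (hp : 0 < p) (ω : ℝ → ℝ)
    (hω : IsRegularWeight ω ∨ IsRapidlyIncreasing ω)
    (g : ℂ → ℂ) (hg : DifferentiableOn ℂ g unitDisc) :
    (∃ C : ℝ, 0 < C ∧ ∀ f : ℂ → ℂ, DifferentiableOn ℂ f unitDisc →
      (∫⁻ z in unitDisc, ENNReal.ofReal (‖Tg g f z‖ ^ p * ω ‖z‖)) ≤
        ENNReal.ofReal C * ∫⁻ z in unitDisc, ENNReal.ofReal (‖f z‖ ^ p * ω ‖z‖)) ↔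
    (∃ M : ℝ, ∀ θ h : ℝ, 0 < h → h ≤ 2 * Real.pi →
      (∫⁻ z in CBox θ h, ENNReal.ofReal (‖deriv g z‖ ^ 2 * wStar ω z)) ≤
        ENNReal.ofReal M * ∫⁻ z in CBox θ h, ENNReal.ofReal (ω ‖z‖)) := by
  have hrad : IsRadialWeight ω := hω.elim (fun h => h.1.1) fun h => h.1.1
  obtain ⟨κ, hw⟩ := exists_doublingWeight hω
  have hw0 : ∀ r ∈ Ico (0 : ℝ) 1, extWeight ω r ≠ 0 := fun r hr => by
    rw [extWeight_of_mem hr]; exact (ENNReal.ofReal_pos.2 (hrad.1 r hr)).ne'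
  simp only [lintegral_norm_rpow_mul_weight, lintegral_CBox_weight, lintegral_CBox_symDens hrad]
  constructor
  · rintro ⟨C, hC, hT⟩
    exact hw.exists_carlesonSymbol hw0 hg hp hC hT
  · rintro ⟨M, hM⟩
    exact hw.exists_bergInt_Tg_le hg hM hp
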